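/- Let n ≥ 2, let A = (a_{rs}) ∈ ℂ^{n×n} satisfy Re(Σ_{r,s} a_{rs}ξ_rξ_s) > 0 for all ξ ∈ ℝⁿ∖{0}, and set A_sym := (A+Aᵀ)/2. Fix p ∈ (1,∞), ℓ ∈ ℕ₀, and κ > 0. Then there exist d ∈ ℂ with d² = det(A_sym) and a finite constant C = C(n,p,A,ℓ,κ) > 0 such that for every f ∈ L^p_ℓ(ℝ^{n-1};ℂ), the function u(x',t) := (2t/(ω_{n-1}d)) ∫_{ℝ^{n-1}} f(y') ⟨A_sym^{-1}(x'-y',t),(x'-y',t)⟩^{-n/2} dy' on ℝⁿ₊ satisfies: (i) Σ_{r,s} a_{rs}∂_r∂_s u = 0 in ℝⁿ₊; (ii) the nontangential limit of u at (x',0) exists and equals f(x') for almost every x' ∈ ℝ^{n-1}; (iii) N_κ(∇^k u) ∈ L^p(ℝ^{n-1}) for every 0 ≤ k ≤ ℓ, and Σ_{k=0}^ℓ ‖N_κ(∇^k u)‖_{L^p(ℝ^{n-1})} ≤ C‖f‖_{L^p_ℓ(ℝ^{n-1})}. -/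

import Mathlib

open MeasureTheory Filter Metric Real
open scoped ENNReal NNReal Topology

noncomputable section

set_option linter.all false
set_option linter.unusedSectionVars false
set_option linter.deprecated false

/-- The point `(x', t)` of `ℝⁿ`, where `x' ∈ ℝ^{n-1}` and `t ∈ ℝ` is the last coordinate. -/
def toUp {n : ℕ} (x' : EuclideanSpace ℝ (Fin (n - 1))) (t : ℝ) :
    EuclideanSpace ℝ (Fin n) :=
  (WithLp.equiv 2 (Fin n → ℝ)).symm
    (fun i => if h : (i : ℕ) < n - 1 then x' ⟨i, h⟩ else t)

/-- The first `n-1` coordinates of a point of `ℝⁿ`. -/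
def xinit {n : ℕ} (x : EuclideanSpace ℝ (Fin n)) : EuclideanSpace ℝ (Fin (n - 1)) :=
  (WithLp.equiv 2 (Fin (n - 1) → ℝ)).symm
    (fun i => x ⟨(i : ℕ), Nat.lt_of_lt_of_le i.isLt (Nat.sub_le n 1)⟩)

/-- The last coordinate of a point of `ℝⁿ`. -/
def xlast {n : ℕ} (x : EuclideanSpace ℝ (Fin n)) : ℝ :=
  if h : 0 < n then x ⟨n - 1, by omega⟩ else 0

/-- The upper half space `ℝⁿ₊`. -/
def upperHalfSpace (n : ℕ) : Set (EuclideanSpace ℝ (Fin n)) := {x | 0 < xlast x}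

/-- The embedding `Fin (n-1) → Fin n`. -/
def finUp {n : ℕ} (i : Fin (n - 1)) : Fin n :=
  ⟨(i : ℕ), Nat.lt_of_lt_of_le i.isLt (Nat.sub_le n 1)⟩

/-- The last index of `Fin n`. -/
def lastIdx (n : ℕ) (h : 0 < n) : Fin n := ⟨n - 1, by omega⟩

/-- Partial derivative along the `i`-th coordinate direction. -/
def pd {n : ℕ} {F : Type*} [NormedAddCommGroup F] [NormedSpace ℝ F]
    (i : Fin n) (u : EuclideanSpace ℝ (Fin n) → F) (x : EuclideanSpace ℝ (Fin n)) : F :=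
  fderiv ℝ u x (EuclideanSpace.single i 1)

/-- Iterated mixed partial derivative along the string of coordinate directions `d`. -/
def mpd {n : ℕ} {F : Type*} [NormedAddCommGroup F] [NormedSpace ℝ F]
    (k : ℕ) (d : Fin k → Fin n) (u : EuclideanSpace ℝ (Fin n) → F)
    (x : EuclideanSpace ℝ (Fin n)) : F :=
  iteratedFDeriv ℝ k u x (fun i => EuclideanSpace.single (d i) 1)

/-- The nontangential approach filter for the cone `Γ_κ(x')` (points written as `(y', t)`). -/
def ntFilter {n : ℕ} (κ : ℝ) (x' : EuclideanSpace ℝ (Fin (n - 1))) :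
    Filter ((EuclideanSpace ℝ (Fin (n - 1))) × ℝ) :=
  (nhds (x', (0 : ℝ))) ⊓ Filter.principal {q | 0 < q.2 ∧ dist x' q.1 < κ * q.2}

/-- The nontangential maximal function (aperture `κ`) of `u : ℝⁿ → F`,
as an `ℝ≥0∞`-valued function on `ℝ^{n-1}`. -/
def ntMax {n : ℕ} {F : Type*} [NormedAddCommGroup F] (κ : ℝ)
    (u : EuclideanSpace ℝ (Fin n) → F) (x' : EuclideanSpace ℝ (Fin (n - 1))) : ℝ≥0∞ :=
  ⨆ (y' : EuclideanSpace ℝ (Fin (n - 1))) (t : ℝ) (_ : 0 < t ∧ dist x' y' < κ * t),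
    (‖u (toUp y' t)‖₊ : ℝ≥0∞)

/-- The `L^p` norm (`p ∈ (0,∞]`) of an `ℝ≥0∞`-valued function on `ℝ^m`. -/
def lpNormE {m : ℕ} (g : EuclideanSpace ℝ (Fin m) → ℝ≥0∞) (p : ℝ≥0∞) : ℝ≥0∞ :=
  if p = ∞ then essSup g volume
  else (∫⁻ x', (g x') ^ p.toReal) ^ (1 / p.toReal)

/-- The Hardy–Littlewood maximal function. -/
def hlMax {m : ℕ} {F : Type*} [NormedAddCommGroup F]
    (f : EuclideanSpace ℝ (Fin m) → F) (x' : EuclideanSpace ℝ (Fin m)) : ℝ≥0∞ :=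
  ⨆ (r : ℝ) (_ : 0 < r),
    (volume (ball x' r))⁻¹ * ∫⁻ y' in ball x' r, (‖f y'‖₊ : ℝ≥0∞)

/-- The Legendre-Hadamard ellipticity condition for the coefficient tensor `A`,
where `A r s α β` stands for `a^{αβ}_{rs}`. -/
def LegendreHadamard {n M : ℕ} (A : Fin n → Fin n → Fin M → Fin M → ℂ) : Prop :=
  ∃ κ₀ : ℝ, 0 < κ₀ ∧ ∀ (ξ : Fin n → ℝ) (η : Fin M → ℂ),
    κ₀ * (∑ r, ξ r ^ 2) * (∑ a, ‖η a‖ ^ 2) ≤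
      (∑ r, ∑ s, ∑ a, ∑ b, A r s a b * ξ r * ξ s * (starRingEnd ℂ) (η a) * η b).re

/-- `g` is the weak (distributional) mixed partial derivative of `f` of order `k`
along the string of directions `d`. -/
def IsWeakDeriv {m : ℕ} {F : Type*} [NormedAddCommGroup F] [NormedSpace ℝ F]
    (k : ℕ) (d : Fin k → Fin m) (f g : EuclideanSpace ℝ (Fin m) → F) : Prop :=
  ∀ φ : EuclideanSpace ℝ (Fin m) → ℝ, ContDiff ℝ (⊤ : ℕ∞) φ → HasCompactSupport φ →
    ∫ x', (mpd k d φ x') • f x' = ((-1 : ℝ) ^ k) • ∫ x', φ x' • g x'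

/-- The surface area `ω_{n-1}` of the unit sphere `S^{n-1}` in `ℝⁿ`. -/
def sphereArea (n : ℕ) : ℝ :=
  (n : ℝ) * (volume (ball (0 : EuclideanSpace ℝ (Fin n)) (1 : ℝ))).toReal

/-- The parabolic dilation `F_t(x') = t^{1-n} F(x'/t)` of a matrix-valued kernel. -/
def matDil {n M : ℕ} (P : EuclideanSpace ℝ (Fin (n - 1)) → Matrix (Fin M) (Fin M) ℂ)
    (t : ℝ) (x' : EuclideanSpace ℝ (Fin (n - 1))) : Matrix (Fin M) (Fin M) ℂ :=
  (t ^ ((1 : ℤ) - (n : ℤ))) • P (t⁻¹ • x')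

/-- The convolution `(P_t * f)(x')` of a dilated matrix kernel with a `ℂ^M`-valued function. -/
def matConv {n M : ℕ} (P : EuclideanSpace ℝ (Fin (n - 1)) → Matrix (Fin M) (Fin M) ℂ)
    (f : EuclideanSpace ℝ (Fin (n - 1)) → EuclideanSpace ℂ (Fin M))
    (t : ℝ) (x' : EuclideanSpace ℝ (Fin (n - 1))) : EuclideanSpace ℂ (Fin M) :=
  (WithLp.equiv 2 (Fin M → ℂ)).symm
    (fun γ => ∫ y', ∑ α, matDil P t (x' - y') γ α * f y' α)



section HLpart
variable {E : Type*} [NormedAddCommGroup E] [NormedSpace ℝ E] [FiniteDimensional ℝ E]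
  [MeasurableSpace E] [BorelSpace E] (μ : Measure E) [μ.IsAddHaarMeasure]

/-- ball average -/
def bavg (h : E → ℝ≥0∞) (x : E) (r : ℝ) : ℝ≥0∞ :=
  (μ (ball x r))⁻¹ * ∫⁻ y in ball x r, h y ∂μ

/-- dyadic-radius maximal function -/
def MF (h : E → ℝ≥0∞) (x : E) : ℝ≥0∞ := ⨆ k : ℤ, bavg μ h x ((2 : ℝ) ^ k)

lemma bavg_le_MF (h : E → ℝ≥0∞) (x : E) (k : ℤ) : bavg μ h x ((2 : ℝ) ^ k) ≤ MF μ h x :=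
  le_iSup (fun k : ℤ => bavg μ h x ((2 : ℝ) ^ k)) k

lemma bavg_mono {h h' : E → ℝ≥0∞} (hh : ∀ y, h y ≤ h' y) (x : E) (r : ℝ) :
    bavg μ h x r ≤ bavg μ h' x r := by
  unfold bavg; gcongr; exact hh _

lemma MF_mono {h h' : E → ℝ≥0∞} (hh : ∀ y, h y ≤ h' y) (x : E) : MF μ h x ≤ MF μ h' x :=
  iSup_mono fun _ => bavg_mono μ hh x _

lemma measurable_bavg {h : E → ℝ≥0∞} (hh : Measurable h) (r : ℝ) :
    Measurable (fun x => bavg μ h x r) := by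
  have e : (fun x => bavg μ h x r) = fun x => (μ (ball (0:E) r))⁻¹ *
      ∫⁻ y, ({z : E × E | dist z.2 z.1 < r}.indicator (fun z => h z.2)) (x, y) ∂μ := by
    funext x
    unfold bavg
    rw [Measure.addHaar_ball_center, ← lintegral_indicator measurableSet_ball]
    rfl
  rw [e]
  apply Measurable.const_mul
  apply Measurable.lintegral_prod_right'
    (f := {z : E × E | dist z.2 z.1 < r}.indicator (fun z => h z.2))
  apply (hh.comp measurable_snd).indicator
  exact measurableSet_lt (by fun_prop) measurable_const

lemma measurable_MF {h : E → ℝ≥0∞} (hh : Measurable h) : Measurable (MF μ h) :=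
  Measurable.iSup fun _ => measurable_bavg μ hh _

lemma meas_ball_ne_zero (x : E) {r : ℝ} (hr : 0 < r) : μ (ball x r) ≠ 0 :=
  (measure_ball_pos μ x hr).ne'

lemma meas_ball_ne_top (x : E) (r : ℝ) : μ (ball x r) ≠ ∞ := measure_ball_lt_top.ne

lemma lt_bavg_iff {h : E → ℝ≥0∞} {x : E} {r : ℝ} (hr : 0 < r) {a : ℝ≥0∞} :
    a < bavg μ h x r ↔ a * μ (ball x r) < ∫⁻ y in ball x r, h y ∂μ := by
  unfold bavg
  rw [mul_comm, ← div_eq_mul_inv, ENNReal.lt_div_iff_mul_lt (Or.inl (meas_ball_ne_zero μ x hr))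
    (Or.inl (meas_ball_ne_top μ x r))]

lemma MF_weak_aux (h : E → ℝ≥0∞) (a : ℝ≥0∞) (K : ℤ) :
    a * μ {x | ∃ k : ℤ, k ≤ K ∧ a < bavg μ h x ((2:ℝ)^k)} ≤
      ENNReal.ofReal (4 ^ Module.finrank ℝ E) * ∫⁻ y, h y ∂μ := by
  set t : Set (E × ℤ) := {q | q.2 ≤ K ∧ a < bavg μ h q.1 ((2:ℝ)^q.2)} with ht
  obtain ⟨u, hut, hdisj, hcov⟩ := Vitali.exists_disjoint_subfamily_covering_enlargement_ball t
    (fun q => q.1) (fun q => (2:ℝ)^q.2) ((2:ℝ)^K)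
    (fun q hq => zpow_le_zpow_right₀ (by norm_num) hq.1) 4 (by norm_num)
  have hpos : ∀ k : ℤ, (0:ℝ) < 2^k := fun k => by positivity
  have hcount : u.Countable := hdisj.countable_of_isOpen (fun _ _ => isOpen_ball)
    (fun q _ => ⟨q.1, mem_ball_self (hpos _)⟩)
  have hsub : {x | ∃ k : ℤ, k ≤ K ∧ a < bavg μ h x ((2:ℝ)^k)} ⊆
      ⋃ q ∈ u, ball q.1 (4 * (2:ℝ)^q.2) := by
    rintro x ⟨k, hk, hx⟩
    obtain ⟨b, hb, hsb⟩ := hcov (x, k) ⟨hk, hx⟩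
    exact Set.mem_biUnion hb (hsb (mem_ball_self (hpos _)))
  calc a * μ {x | ∃ k : ℤ, k ≤ K ∧ a < bavg μ h x ((2:ℝ)^k)}
      ≤ a * ∑' q : u, μ (ball q.1.1 (4 * (2:ℝ)^q.1.2)) := by
        gcongr
        exact (measure_mono hsub).trans (measure_biUnion_le μ hcount _)
    _ = ∑' q : u, ENNReal.ofReal (4 ^ Module.finrank ℝ E) * (a * μ (ball q.1.1 ((2:ℝ)^q.1.2))) := by
        rw [← ENNReal.tsum_mul_left]
        congr 1; funext q
        rw [Measure.addHaar_ball_of_pos μ _ (by have := hpos q.1.2; positivity),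
          Measure.addHaar_ball_of_pos μ _ (hpos q.1.2), mul_pow,
          ENNReal.ofReal_mul (by positivity)]
        ring
    _ ≤ ∑' q : u, ENNReal.ofReal (4 ^ Module.finrank ℝ E) *
          ∫⁻ y in ball q.1.1 ((2:ℝ)^q.1.2), h y ∂μ := by
        gcongr with q
        exact ((lt_bavg_iff μ (hpos _)).1 (hut q.2).2).le
    _ = ENNReal.ofReal (4 ^ Module.finrank ℝ E) *
          ∫⁻ y in ⋃ q ∈ u, ball q.1 ((2:ℝ)^q.2), h y ∂μ := by
        rw [ENNReal.tsum_mul_left, lintegral_biUnion hcount (fun _ _ => measurableSet_ball) hdisj]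
    _ ≤ _ := by
        gcongr
        exact Measure.restrict_le_self

lemma MF_weak (h : E → ℝ≥0∞) (a : ℝ≥0∞) :
    a * μ {x | a < MF μ h x} ≤
      ENNReal.ofReal (4 ^ Module.finrank ℝ E) * ∫⁻ y, h y ∂μ := by
  have e : {x | a < MF μ h x} = ⋃ K : ℕ, {x | ∃ k : ℤ, k ≤ (K:ℤ) ∧ a < bavg μ h x ((2:ℝ)^k)} := by
    ext x
    simp only [Set.mem_setOf_eq, MF, lt_iSup_iff, Set.mem_iUnion]
    constructor
    · rintro ⟨k, hk⟩
      exact ⟨k.toNat, k, Int.self_le_toNat k, hk⟩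
    · rintro ⟨_, k, _, hk⟩
      exact ⟨k, hk⟩
  have hm : Monotone (fun K : ℕ => {x | ∃ k : ℤ, k ≤ (K:ℤ) ∧ a < bavg μ h x ((2:ℝ)^k)}) := by
    rintro K K' hK x ⟨k, hk, hx⟩
    exact ⟨k, hk.trans (by exact_mod_cast hK), hx⟩
  rw [e, hm.measure_iUnion, ENNReal.mul_iSup]
  exact iSup_le fun K => MF_weak_aux μ h a K

lemma layer (q : ℝ) (hq : 0 < q) (a : ℝ≥0∞) :
    ∫⁻ s in Set.Ioi (0:ℝ), {s : ℝ | ENNReal.ofReal s < a}.indicator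
      (fun s => ENNReal.ofReal (s ^ (q - 1))) s = ENNReal.ofReal q⁻¹ * a ^ q := by
  have fin : ∀ b : ℝ, 0 ≤ b → ∫⁻ s in Set.Ioc (0:ℝ) b, ENNReal.ofReal (s ^ (q - 1)) =
      ENNReal.ofReal q⁻¹ * ENNReal.ofReal b ^ q := by
    intro b hb
    have hint : IntegrableOn (fun s : ℝ => s ^ (q - 1)) (Set.Ioc 0 b) := by
      have := intervalIntegral.intervalIntegrable_rpow' (a := 0) (b := b) (r := q - 1) (by linarith)
      rwa [intervalIntegrable_iff_integrableOn_Ioc_of_le hb] at this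
    rw [← ofReal_integral_eq_lintegral_ofReal hint
      ((ae_restrict_iff' measurableSet_Ioc).2 (Eventually.of_forall fun s hs =>
        Real.rpow_nonneg hs.1.le _)), ← intervalIntegral.integral_of_le hb,
      integral_rpow (Or.inl (by linarith)), ENNReal.ofReal_rpow_of_nonneg hb hq.le,
      ← ENNReal.ofReal_mul (by positivity)]
    congr 1
    rw [sub_add_cancel, Real.zero_rpow hq.ne']; field_simp; ring
  have hms : MeasurableSet {s : ℝ | ENNReal.ofReal s < a} :=
    measurableSet_lt ENNReal.measurable_ofReal measurable_const
  rw [lintegral_indicator hms, Measure.restrict_restrict hms]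
  rcases eq_or_ne a ∞ with rfl | ha
  · have : ENNReal.ofReal q⁻¹ * (⊤:ℝ≥0∞) ^ q = ⊤ := by
      rw [ENNReal.top_rpow_of_pos hq, ENNReal.mul_top]; simpa using hq
    rw [this, eq_top_iff]
    refine le_of_forall_lt fun c hc => ?_
    have ht : Tendsto (fun N : ℕ => ENNReal.ofReal q⁻¹ * ENNReal.ofReal (N:ℝ) ^ q) atTop (𝓝 ⊤) := by
      have h1 : Tendsto (fun N : ℕ => ENNReal.ofReal (N:ℝ) ^ q) atTop (𝓝 (⊤ ^ q)) := by
        refine (ENNReal.continuous_rpow_const.tendsto _).comp ?_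
        exact ENNReal.tendsto_ofReal_nhds_top.2 tendsto_natCast_atTop_atTop
      have := ENNReal.Tendsto.const_mul h1 (a := ENNReal.ofReal q⁻¹) (Or.inr ENNReal.ofReal_ne_top)
      rwa [‹ENNReal.ofReal q⁻¹ * (⊤:ℝ≥0∞) ^ q = ⊤›] at this
    obtain ⟨N, hN⟩ := (ht.eventually (lt_mem_nhds hc)).exists
    refine hN.trans_le ?_
    rw [← fin N (by positivity)]
    refine lintegral_mono_set fun s hs => ⟨by simp, hs.1⟩
  · lift a to ℝ≥0 using ha
    have e1 : ({s : ℝ | ENNReal.ofReal s < a} ∩ Set.Ioi 0) = Set.Ioo 0 (a:ℝ) := by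
      ext s
      simp only [Set.mem_inter_iff, Set.mem_setOf_eq, Set.mem_Ioi, Set.mem_Ioo]
      rw [and_comm]
      refine and_congr_right fun hs => ?_
      rw [← ENNReal.ofReal_coe_nnreal, ENNReal.ofReal_lt_ofReal_iff_of_nonneg hs.le]
    rw [e1, setLIntegral_congr Ioo_ae_eq_Ioc, fin a a.2, ENNReal.ofReal_coe_nnreal]

lemma lintegral_rpow_layer {g : E → ℝ≥0∞} (hg : Measurable g) (q : ℝ) (hq : 0 < q) :
    ENNReal.ofReal q⁻¹ * ∫⁻ x, g x ^ q ∂μ = ∫⁻ s in Set.Ioi (0:ℝ),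
      ENNReal.ofReal (s ^ (q - 1)) * μ {x | ENNReal.ofReal s < g x} := by
  rw [← lintegral_const_mul _ (hg.pow_const q)]
  simp_rw [← layer q hq]
  rw [lintegral_lintegral_swap]
  · refine lintegral_congr fun s => ?_
    have : ∀ x, {s : ℝ | ENNReal.ofReal s < g x}.indicator
      (fun s => ENNReal.ofReal (s ^ (q - 1))) s = {x | ENNReal.ofReal s < g x}.indicator
        (fun _ => ENNReal.ofReal (s ^ (q - 1))) x := fun x => by
      simp [Set.indicator]
    simp_rw [this]
    rw [lintegral_indicator_const (measurableSet_lt measurable_const hg)]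
  · have : (Function.uncurry fun (x : E) (s : ℝ) => {s : ℝ | ENNReal.ofReal s < g x}.indicator
      (fun s => ENNReal.ofReal (s ^ (q - 1))) s) = {z : E × ℝ | ENNReal.ofReal z.2 < g z.1}.indicator
        (fun z => ENNReal.ofReal (z.2 ^ (q - 1))) := by
      funext z; simp [Function.uncurry, Set.indicator]
    rw [this]
    refine (Measurable.indicator ?_ ?_).aemeasurable
    · exact ENNReal.measurable_ofReal.comp (measurable_snd.pow_const _)
    · exact measurableSet_lt (by fun_prop) (hg.comp measurable_fst)

lemma MF_split (h : E → ℝ≥0∞) (s : ℝ≥0∞) (x : E) :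
    MF μ h x ≤ MF μ ({y | s < h y}.indicator h) x + s := by
  refine iSup_le fun k => ?_
  have hp : (0:ℝ) < 2 ^ k := by positivity
  refine le_trans ?_ (add_le_add_left (bavg_le_MF μ _ x k) s)
  have : ∀ y, h y ≤ {y | s < h y}.indicator h y + s := by
    intro y
    by_cases hy : s < h y
    · simp [Set.indicator, hy]
    · simp [Set.indicator, hy, not_lt.1 hy]
  calc bavg μ h x (2 ^ k) ≤ (μ (ball x (2^k)))⁻¹ *
        (∫⁻ y in ball x (2^k), ({y | s < h y}.indicator h y + s) ∂μ) := by
        unfold bavg; gcongr; exact this _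
    _ = bavg μ ({y | s < h y}.indicator h) x (2 ^ k) +
        (μ (ball x (2^k)))⁻¹ * (s * μ (ball x (2^k))) := by
        rw [lintegral_add_right _ measurable_const, mul_add, setLIntegral_const]; rfl
    _ = _ := by
        rw [mul_comm s, ← mul_assoc, ENNReal.inv_mul_cancel (meas_ball_ne_zero μ x hp)
          (meas_ball_ne_top μ x _), one_mul]

lemma MF_strong (p : ℝ) (hp : 1 < p) : ∃ C : ℝ, 0 < C ∧ ∀ h : E → ℝ≥0∞, Measurable h →
    ∫⁻ x, (MF μ h x) ^ p ∂μ ≤ ENNReal.ofReal C * ∫⁻ x, h x ^ p ∂μ := by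
  set c : ℝ := 4 ^ Module.finrank ℝ E with hc
  have hcpos : 0 < c := by positivity
  refine ⟨p * (2 * c * ((p-1)⁻¹ * 2 ^ (p - 1))), by
    have : 0 < p - 1 := by linarith
    positivity, fun h hh => ?_⟩
  have hp0 : 0 < p := by linarith
  have hp1 : 0 < p - 1 := by linarith
  have key : ENNReal.ofReal p⁻¹ * ∫⁻ x, (MF μ h x) ^ p ∂μ ≤
      ENNReal.ofReal (2 * c * ((p-1)⁻¹ * 2 ^ (p - 1))) * ∫⁻ x, h x ^ p ∂μ := by
    rw [lintegral_rpow_layer μ (measurable_MF μ hh) p hp0]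
    calc ∫⁻ s in Set.Ioi (0:ℝ), ENNReal.ofReal (s ^ (p - 1)) * μ {x | ENNReal.ofReal s < MF μ h x}
        ≤ ∫⁻ s in Set.Ioi (0:ℝ), ∫⁻ y, ENNReal.ofReal (2 * c) * h y *
          {s : ℝ | ENNReal.ofReal s < 2 * h y}.indicator
            (fun s => ENNReal.ofReal (s ^ (p - 1 - 1))) s ∂μ := by
          refine setLIntegral_mono' measurableSet_Ioi fun s hs => ?_
          have hs0 : (0:ℝ) < s := hs
          have h1 : μ {x | ENNReal.ofReal s < MF μ h x} ≤
              μ {x | ENNReal.ofReal (s/2) < MF μ ({y | ENNReal.ofReal (s/2) < h y}.indicator h) x} := by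
            refine measure_mono fun x hx => ?_
            have h2 := MF_split μ h (ENNReal.ofReal (s/2)) x
            have h3 : ENNReal.ofReal s = ENNReal.ofReal (s/2) + ENNReal.ofReal (s/2) := by
              rw [← ENNReal.ofReal_add (by positivity) (by positivity)]; congr 1; ring
            have h4 : ENNReal.ofReal s < MF μ h x := hx
            have h5 := h4.trans_le h2
            rw [h3] at h5
            exact lt_of_add_lt_add_right h5
          have h2 := MF_weak μ ({y | ENNReal.ofReal (s/2) < h y}.indicator h) (ENNReal.ofReal (s/2))
          calc ENNReal.ofReal (s ^ (p - 1)) * μ {x | ENNReal.ofReal s < MF μ h x}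
              = ENNReal.ofReal (2 * s ^ (p - 1 - 1)) *
                (ENNReal.ofReal (s/2) * μ {x | ENNReal.ofReal s < MF μ h x}) := by
                rw [← mul_assoc, ← ENNReal.ofReal_mul (by positivity)]
                congr 2
                rw [Real.rpow_sub_one hs0.ne' (p-1)]; field_simp
            _ ≤ ENNReal.ofReal (2 * s ^ (p - 1 - 1)) * (ENNReal.ofReal c *
                ∫⁻ y, {y | ENNReal.ofReal (s/2) < h y}.indicator h y ∂μ) := by
                exact mul_le_mul_right ((mul_le_mul_right h1 _).trans h2) _
            _ = _ := by
                rw [← mul_assoc, ← ENNReal.ofReal_mul (by positivity), ← lintegral_const_mul]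
                · refine lintegral_congr fun y => ?_
                  have : ENNReal.ofReal (s/2) < h y ↔ ENNReal.ofReal s < 2 * h y := by
                    rw [ENNReal.ofReal_div_of_pos (by norm_num), ENNReal.div_lt_iff] <;> simp [mul_comm]
                  simp only [Set.indicator, Set.mem_setOf_eq, this]
                  split_ifs
                  · rw [mul_right_comm (ENNReal.ofReal (2*c)), ← ENNReal.ofReal_mul (by positivity)]; congr 2; ring
                  · simp
                · exact hh.indicator (measurableSet_lt measurable_const hh)
      _ = ∫⁻ y, ∫⁻ s in Set.Ioi (0:ℝ), ENNReal.ofReal (2 * c) * h y *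
          {s : ℝ | ENNReal.ofReal s < 2 * h y}.indicator
            (fun s => ENNReal.ofReal (s ^ (p - 1 - 1))) s ∂volume ∂μ := by
          rw [lintegral_lintegral_swap]
          have : (Function.uncurry fun (s : ℝ) (y : E) => ENNReal.ofReal (2 * c) * h y *
              {s : ℝ | ENNReal.ofReal s < 2 * h y}.indicator
              (fun s => ENNReal.ofReal (s ^ (p - 1 - 1))) s) = fun z : ℝ × E =>
              ENNReal.ofReal (2 * c) * h z.2 * {z : ℝ × E | ENNReal.ofReal z.1 < 2 * h z.2}.indicator
              (fun z => ENNReal.ofReal (z.1 ^ (p - 1 - 1))) z := by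
            funext z; simp [Function.uncurry, Set.indicator]
          rw [this]
          refine Measurable.aemeasurable (Measurable.mul (by fun_prop) (Measurable.indicator ?_ ?_))
          · exact ENNReal.measurable_ofReal.comp (measurable_fst.pow_const _)
          · exact measurableSet_lt (by fun_prop) (by fun_prop)
      _ = ∫⁻ y, ENNReal.ofReal (2 * c * ((p-1)⁻¹ * 2 ^ (p - 1))) * h y ^ p ∂μ := by
          refine lintegral_congr fun y => ?_
          rw [lintegral_const_mul, layer (p-1) hp1, ENNReal.mul_rpow_of_nonneg _ _ hp1.le,
            ENNReal.ofReal_mul (p := 2 * c) (by positivity), ENNReal.ofReal_mul (p := (p-1)⁻¹) (by positivity),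
            ← ENNReal.ofReal_rpow_of_pos (by norm_num)]
          · rw [show ENNReal.ofReal 2 = 2 by simp]
            have : h y ^ p = h y * h y ^ (p - 1) := by
              conv_lhs => rw [show p = 1 + (p - 1) by ring]
              rw [ENNReal.rpow_add_of_nonneg _ _ zero_le_one hp1.le, ENNReal.rpow_one]
            rw [this]; ring
          · refine Measurable.indicator ?_ ?_
            · exact ENNReal.measurable_ofReal.comp (measurable_id.pow_const _)
            · exact measurableSet_lt (by fun_prop) (by fun_prop)
      _ = _ := by rw [lintegral_const_mul _ (hh.pow_const p)]
  calc ∫⁻ x, (MF μ h x) ^ p ∂μ = ENNReal.ofReal p * (ENNReal.ofReal p⁻¹ * ∫⁻ x, (MF μ h x) ^ p ∂μ) := by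
        rw [← mul_assoc, ← ENNReal.ofReal_mul hp0.le, mul_inv_cancel₀ hp0.ne']; simp
    _ ≤ ENNReal.ofReal p * (ENNReal.ofReal (2 * c * ((p-1)⁻¹ * 2 ^ (p - 1))) * ∫⁻ x, h x ^ p ∂μ) := by
        gcongr
    _ = _ := by rw [← mul_assoc, ← ENNReal.ofReal_mul hp0.le]

/-- approximate-identity weight -/
def wt (m : ℕ) (t : ℝ) (r : ℝ) : ℝ := t / (t + r) ^ (m + 1)

lemma wt_le_tsum (m : ℕ) {t : ℝ} (ht : 0 < t) (r : ℝ) (hr : 0 ≤ r) :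
    ENNReal.ofReal (wt m t r) ≤ ∑' k : ℕ, {k : ℕ | r < 2 ^ k * t}.indicator
      (fun k => ENNReal.ofReal (2 ^ (m+1) * (2⁻¹) ^ k * ((2 ^ k * t) ^ m)⁻¹)) k := by
  obtain ⟨k, hk⟩ : ∃ k : ℕ, r < 2 ^ k * t := by
    obtain ⟨k, hk⟩ := pow_unbounded_of_one_lt (r / t) (one_lt_two)
    exact ⟨k, by rwa [div_lt_iff₀ ht] at hk⟩
  classical
  have hex : ∃ k : ℕ, r < 2 ^ k * t := ⟨k, hk⟩
  let k0 := Nat.find hex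
  have h1 : r < 2 ^ k0 * t := Nat.find_spec hex
  have h2 : 2 ^ k0 * t / 2 ≤ t + r := by
    rcases Nat.eq_zero_or_pos k0 with h0 | h0
    · rw [h0]; linarith
    · have := Nat.find_min hex (m := k0 - 1) (by omega)
      rw [not_lt] at this
      have e : (2:ℝ) ^ k0 = 2 * 2 ^ (k0 - 1) := by
        rw [← pow_succ']; congr 1; omega
      rw [e]; nlinarith
  refine le_trans ?_ (ENNReal.le_tsum k0)
  rw [Set.indicator_of_mem (by exact h1)]
  apply ENNReal.ofReal_le_ofReal
  unfold wt
  calc t / (t + r) ^ (m+1) ≤ t / (2 ^ k0 * t / 2) ^ (m+1) := by gcongr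
    _ = _ := by
      rw [div_pow, pow_succ (2 ^ k0 * t) m, inv_pow]
      field_simp

lemma wt_lintegral_le (h : E → ℝ≥0∞) (hh : Measurable h) (x : E) {t : ℝ} (ht : 0 < t) :
    ∫⁻ z, ENNReal.ofReal (wt (Module.finrank ℝ E) t ‖x - z‖) * h z ∂μ ≤
      ∑' k : ℕ, ENNReal.ofReal (2 ^ (Module.finrank ℝ E + 1) * (2⁻¹) ^ k) * μ (ball 0 1) *
        bavg μ h x (2 ^ k * t) := by
  set m := Module.finrank ℝ E
  calc _ ≤ ∫⁻ z, ∑' k : ℕ, ENNReal.ofReal (2 ^ (m+1) * (2⁻¹) ^ k * ((2 ^ k * t) ^ m)⁻¹) *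
        (ball x (2^k * t)).indicator h z ∂μ := by
        refine lintegral_mono fun z => ?_
        dsimp only
        calc _ ≤ _ := mul_le_mul_left (wt_le_tsum m ht ‖x - z‖ (norm_nonneg _)) _
          _ = _ := by
            rw [← ENNReal.tsum_mul_right]
            congr 1; funext k
            have : z ∈ ball x (2 ^ k * t) ↔ ‖x - z‖ < 2 ^ k * t := by
              rw [mem_ball, dist_comm, dist_eq_norm]
            simp only [Set.indicator, Set.mem_setOf_eq, this]
            split_ifs <;> simp
    _ = ∑' k : ℕ, ENNReal.ofReal (2 ^ (m+1) * (2⁻¹) ^ k * ((2 ^ k * t) ^ m)⁻¹) *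
        ∫⁻ z in ball x (2^k * t), h z ∂μ := by
        rw [lintegral_tsum]
        · congr 1; funext k
          rw [lintegral_const_mul _ (hh.indicator measurableSet_ball),
            lintegral_indicator measurableSet_ball]
        · intro k
          exact ((hh.indicator measurableSet_ball).const_mul _).aemeasurable
    _ = _ := by
        congr 1; funext k
        unfold bavg
        rw [Measure.addHaar_ball_of_pos μ x (by positivity),
          ENNReal.ofReal_mul (by positivity), ENNReal.ofReal_inv_of_pos (by positivity)]
        have h0 := meas_ball_ne_zero μ (0:E) one_pos
        have h1 := meas_ball_ne_top μ (0:E) 1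
        rw [ENNReal.mul_inv (Or.inr h1) (Or.inr h0)]
        simp only [← mul_assoc]
        congr 1
        rw [mul_assoc, mul_assoc, mul_comm (μ _) , mul_assoc, ENNReal.inv_mul_cancel h0 h1,
          mul_one]

lemma wt_MF (h : E → ℝ≥0∞) (hh : Measurable h) (x : E) (j : ℤ) :
    ∫⁻ z, ENNReal.ofReal (wt (Module.finrank ℝ E) (2 ^ j) ‖x - z‖) * h z ∂μ ≤
      ENNReal.ofReal (2 ^ (Module.finrank ℝ E + 2)) * μ (ball 0 1) * MF μ h x := by
  refine (wt_lintegral_le μ h hh x (t := 2 ^ j) (by positivity)).trans ?_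
  calc _ ≤ ∑' k : ℕ, ENNReal.ofReal (2 ^ (Module.finrank ℝ E + 1) * (2⁻¹) ^ k) * μ (ball 0 1) *
        MF μ h x := by
        gcongr with k
        have := bavg_le_MF μ h x ((k:ℤ) + j)
        rwa [zpow_add₀ two_ne_zero, zpow_natCast] at this
    _ = _ := by
        rw [ENNReal.tsum_mul_right, ENNReal.tsum_mul_right]
        congr 2
        rw [← ENNReal.ofReal_tsum_of_nonneg (fun k => by positivity)]
        · rw [tsum_mul_left, tsum_geometric_of_lt_one (by norm_num) (by norm_num)]
          congr 1; ring
        · exact (summable_geometric_of_lt_one (by norm_num) (by norm_num)).mul_left _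
end HLpart


lemma contour_zero (Φ : ℂ → ℂ) (hΦ : DifferentiableOn ℂ Φ {z | 0 < z.im}) {t q C R₀ : ℝ}
    (ht : 0 < t) (hq : 1 < q)
    (hb : ∀ z : ℂ, t ≤ z.im → R₀ ≤ ‖z‖ → ‖Φ z‖ ≤ C * ‖z‖ ^ (-q)) :
    ∫ x : ℝ, Φ (x + t * Complex.I) = 0 := by
  by_cases hint : Integrable (fun x : ℝ => Φ (x + t * Complex.I))
  swap
  · exact integral_undef hint
  have hlim := intervalIntegral_tendsto_integral hint (tendsto_neg_atTop_atBot) tendsto_id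
  have hC : 0 ≤ |C| := abs_nonneg C
  refine tendsto_nhds_unique hlim ?_
  have hz : Tendsto (fun R : ℝ => 4 * |C| * R ^ (-(q-1))) atTop (𝓝 0) := by
    simpa using (tendsto_rpow_neg_atTop (y := q - 1) (by linarith)).const_mul (4 * |C|)
  refine squeeze_zero_norm' ?_ hz
  filter_upwards [eventually_ge_atTop (max R₀ 1)] with R hR
  have hR1 : 1 ≤ R := (le_max_right _ _).trans hR
  have hR0 : R₀ ≤ R := (le_max_left _ _).trans hR
  have hpos : 0 < R := by linarith
  have bd : ∀ z : ℂ, t ≤ z.im → R ≤ ‖z‖ → ‖Φ z‖ ≤ |C| * R ^ (-q) := by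
    intro z h1 h2
    refine (hb z h1 (hR0.trans h2)).trans ?_
    refine mul_le_mul (le_abs_self _) ?_ (by positivity) hC
    exact Real.rpow_le_rpow_of_nonpos hpos h2 (by linarith)
  have rect := Complex.integral_boundary_rect_eq_zero_of_differentiableOn Φ
    (-R + t * Complex.I) (R + (t + R : ℝ) * Complex.I) (by
      refine hΦ.mono ?_
      intro z hz
      have := hz.2
      simp only [Set.mem_preimage, Complex.add_im, Complex.neg_im, Complex.ofReal_im, Complex.mul_im,
        Complex.ofReal_re, Complex.I_im, Complex.I_re, mul_one, mul_zero, add_zero, neg_zero, zero_add] at this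
      rw [Set.uIcc_of_le (by linarith)] at this
      show 0 < z.im
      linarith [this.1])
  simp only [Complex.add_im, Complex.add_re, Complex.neg_re, Complex.mul_re, Complex.neg_im, Complex.ofReal_im, Complex.mul_im,
        Complex.ofReal_re, Complex.I_im, Complex.I_re, mul_one, mul_zero, add_zero, neg_zero, zero_add, sub_zero, sub_self, zero_mul] at rect
  have n1 : ‖∫ x : ℝ in (-R)..R, Φ (x + (t + R : ℝ) * Complex.I)‖ ≤ (|C| * R ^ (-q)) * |R - (-R)| := by
    refine intervalIntegral.norm_integral_le_of_norm_le_const fun x _ => bd _ (by simp; linarith) ?_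
    refine le_trans ?_ (Complex.abs_im_le_norm _)
    simp
    rw [abs_of_pos (by linarith)]; linarith
  have n2 : ∀ a : ℝ, |a| = R → ‖Complex.I • ∫ y : ℝ in t..(t+R), Φ (a + y * Complex.I)‖ ≤
      (|C| * R ^ (-q)) * |t + R - t| := by
    intro a ha
    rw [norm_smul, Complex.norm_I, one_mul]
    refine intervalIntegral.norm_integral_le_of_norm_le_const fun x hx => bd _ ?_ ?_
    · rw [Set.uIoc_of_le (by linarith)] at hx
      simpa using hx.1.le
    · refine le_trans ?_ (Complex.abs_re_le_norm _)
      simp [ha]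
  have n3 := n2 R (abs_of_pos hpos)
  have n4 := n2 (-R) (by rw [abs_neg, abs_of_pos hpos])
  have e : ∫ x : ℝ in (-R)..R, Φ (x + t * Complex.I) =
      (∫ x : ℝ in (-R)..R, Φ (x + (t + R : ℝ) * Complex.I)) -
      Complex.I • (∫ y : ℝ in t..(t+R), Φ ((R:ℝ) + y * Complex.I)) +
      Complex.I • (∫ y : ℝ in t..(t+R), Φ ((-R:ℝ) + y * Complex.I)) := by
    push_cast at rect ⊢
    linear_combination rect
  simp only [id]
  rw [e]
  refine (norm_add_le _ _).trans ((add_le_add_left (norm_sub_le _ _) _).trans ?_)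
  have e2 : R ^ (-(q-1)) = R ^ (-q) * R := by
    rw [show -(q-1) = -q + 1 by ring, Real.rpow_add_one hpos.ne']
  rw [e2]
  rw [show R - -R = 2 * R by ring, abs_of_pos (show 0 < 2 * R by linarith)] at n1
  rw [show t + R - t = R by ring, abs_of_pos hpos] at n3 n4
  linarith

/-- bounded, measurable, boundedly supported -/
def Nice {E : Type*} [NormedAddCommGroup E] [MeasurableSpace E] (g : E → ℝ) : Prop :=
  Measurable g ∧ ∃ B R : ℝ, 0 < B ∧ 0 < R ∧ (∀ y, |g y| ≤ B) ∧ ∀ y, R < ‖y‖ → g y = 0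

lemma Nice.integrable {E : Type*} [NormedAddCommGroup E] [NormedSpace ℝ E] [FiniteDimensional ℝ E]
    [MeasurableSpace E] [BorelSpace E] {g : E → ℝ} (hg : Nice g) (μ : Measure E)
    [μ.IsAddHaarMeasure] : Integrable g μ := by
  obtain ⟨hm, B, R, hB, hR, hb, hs⟩ := hg
  have : Integrable ((closedBall (0:E) R).indicator (fun _ => B)) μ := by
    rw [integrable_indicator_iff measurableSet_closedBall]
    exact integrableOn_const measure_closedBall_lt_top.ne
  refine this.mono' hm.aestronglyMeasurable (Eventually.of_forall fun y => ?_)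
  by_cases hy : R < ‖y‖
  · rw [hs y hy]; simp; exact Set.indicator_nonneg (fun _ _ => hB.le) _
  · rw [Set.indicator_of_mem (by simpa using hy)]; exact hb y

/-- Cauchy-type transform -/
def CF (g : ℝ → ℝ) (z : ℂ) : ℂ := ∫ y : ℝ, (Complex.I / (z - y)) * (g y : ℂ)

lemma im_le_norm_sub (z : ℂ) (y : ℝ) : |z.im| ≤ ‖z - y‖ := by
  have := Complex.abs_im_le_norm (z - y)
  simpa using this

lemma CF_integrable {g : ℝ → ℝ} (hg : Nice g) {z : ℂ} (hz : 0 < z.im) :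
    Integrable (fun y : ℝ => (Complex.I / (z - y)) * (g y : ℂ)) := by
  refine Integrable.bdd_mul (c := 1 / z.im) (hg.integrable volume).ofReal ?_ ?_
  · refine Measurable.aestronglyMeasurable ?_
    exact measurable_const.div (measurable_const.sub Complex.measurable_ofReal)
  · refine Eventually.of_forall fun y => ?_
    rw [norm_div, Complex.norm_I]
    have := im_le_norm_sub z y
    rw [abs_of_pos hz] at this
    gcongr

lemma CF_diff {g : ℝ → ℝ} (hg : Nice g) : DifferentiableOn ℂ (CF g) {z | 0 < z.im} := by
  intro z₀ hz₀
  have hz₀ : 0 < z₀.im := hz₀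
  have him : ∀ z ∈ ball z₀ (z₀.im/2), z₀.im/2 ≤ z.im := by
    intro z hz
    have h1 := Complex.abs_im_le_norm (z - z₀)
    rw [mem_ball, dist_eq_norm] at hz
    have h2 := (abs_le.1 (h1.trans hz.le)).1
    simp at h2; linarith
  have := hasDerivAt_integral_of_dominated_loc_of_deriv_le (μ := volume) (𝕜 := ℂ)
    (F := fun (z : ℂ) (y : ℝ) => (Complex.I / (z - y)) * (g y : ℂ))
    (F' := fun (z : ℂ) (y : ℝ) => (-Complex.I / (z - y)^2) * (g y : ℂ)) (x₀ := z₀)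
    (bound := fun y => (1 / (z₀.im/2)^2) * |g y|) (s := ball z₀ (z₀.im/2))
    (ball_mem_nhds _ (by positivity)) ?_ (CF_integrable hg hz₀) ?_ ?_ ?_ ?_
  · exact this.2.differentiableAt.differentiableWithinAt
  · filter_upwards [ball_mem_nhds z₀ (show 0 < z₀.im/2 by positivity)] with z hz
    exact (CF_integrable hg (by have := him z hz; linarith)).aestronglyMeasurable
  · refine Measurable.aestronglyMeasurable ?_
    refine Measurable.mul ?_ (Complex.measurable_ofReal.comp hg.1)
    exact measurable_const.div ((measurable_const.sub Complex.measurable_ofReal).pow_const 2)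
  · refine Eventually.of_forall fun y z hz => ?_
    rw [norm_mul, norm_div, norm_neg, Complex.norm_I, norm_pow, Complex.norm_real, Real.norm_eq_abs]
    have h1 := im_le_norm_sub z y
    have h2 := him z hz
    rw [abs_of_pos (by linarith)] at h1
    gcongr
    linarith
  · exact (hg.integrable volume).abs.const_mul _
  · refine Eventually.of_forall fun y z hz => ?_
    have h2 := him z hz
    have hne : z - y ≠ 0 := by
      intro h
      have := congrArg Complex.im h
      simp at this; linarith
    refine HasDerivAt.mul_const ?_ _
    have h3 : HasDerivAt (fun z : ℂ => z - (y:ℂ)) 1 z := (hasDerivAt_id z).sub_const _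
    have := (hasDerivAt_const z Complex.I).div h3 hne
    exact this.congr_deriv (by ring)

lemma CF_bound {g : ℝ → ℝ} (hg : Nice g) {t : ℝ} (ht : 0 < t) :
    ∃ C : ℝ, 0 ≤ C ∧ ∀ z : ℂ, t ≤ z.im → ‖CF g z‖ ≤ C * ‖z‖⁻¹ := by
  obtain ⟨hm, B, R, hB, hR, hb, hs⟩ := id hg
  set L := ∫ y, |g y|
  have hL : 0 ≤ L := integral_nonneg fun _ => abs_nonneg _
  refine ⟨(2 + 2 * R / t) * L, by positivity, fun z hz => ?_⟩
  have hzn : 0 < ‖z‖ := lt_of_lt_of_le (by linarith : 0 < z.im) ((le_abs_self _).trans (Complex.abs_im_le_norm z))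
  unfold CF
  calc _ ≤ ∫ y : ℝ, ((2 + 2 * R / t) * ‖z‖⁻¹) * |g y| := by
        refine norm_integral_le_of_norm_le ((hg.integrable volume).abs.const_mul _)
          (Eventually.of_forall fun y => ?_)
        rw [norm_mul, norm_div, Complex.norm_I, Complex.norm_real, Real.norm_eq_abs]
        by_cases hy : R < ‖y‖
        · rw [hs y hy]; simp
        refine mul_le_mul_of_nonneg_right ?_ (abs_nonneg _)
        have h1 := im_le_norm_sub z y
        rw [abs_of_pos (by linarith)] at h1
        have h2 : ‖z‖ ≤ (2 + 2 * R / t) * ‖z - y‖ := by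
          have h3 : ‖z‖ - ‖y‖ ≤ ‖z - y‖ := by
            have := norm_sub_norm_le z y; simpa using this
          have h4 : 2 * R ≤ 2 * R / t * ‖z - y‖ := by
            rw [div_mul_eq_mul_div, le_div_iff₀ ht]
            have : t ≤ ‖z - y‖ := by linarith
            gcongr
          have : 0 ≤ ‖z - y‖ := norm_nonneg _
          nlinarith [not_lt.1 hy]
        have h5 : 0 < ‖z - y‖ := by linarith
        rw [← div_eq_mul_inv, div_le_div_iff₀ h5 hzn]
        linarith
    _ = _ := by rw [integral_const_mul]; ring

/-- smooth truncated Hilbert transform -/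
def Hs (t : ℝ) (g : ℝ → ℝ) (x : ℝ) : ℝ := ∫ y : ℝ, ((x - y) / ((x-y)^2 + t^2)) * g y
/-- Poisson -/
def Ps (t : ℝ) (g : ℝ → ℝ) (x : ℝ) : ℝ := ∫ y : ℝ, (t / ((x-y)^2 + t^2)) * g y

lemma CF_eq {g : ℝ → ℝ} (hg : Nice g) {t : ℝ} (ht : 0 < t) (x : ℝ) :
    CF g (x + t * Complex.I) = Ps t g x + Hs t g x * Complex.I := by
  have hi := CF_integrable hg (z := x + t * Complex.I) (by simpa using ht)
  have e : ∀ y : ℝ, (Complex.I / ((x + t * Complex.I : ℂ) - y)) * (g y : ℂ) =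
      (((t / ((x-y)^2 + t^2)) * g y : ℝ) : ℂ) + (((x - y) / ((x-y)^2 + t^2) * g y : ℝ) : ℂ) * Complex.I := by
    intro y
    have h1 : ((x + t * Complex.I : ℂ) - y) ≠ 0 := by
      intro h
      have := congrArg Complex.im h
      simp at this; linarith
    have h2 : (((x-y)^2 + t^2 : ℝ) : ℂ) ≠ 0 := by
      rw [Complex.ofReal_ne_zero]; positivity
    have h3 : Complex.I / ((x + t * Complex.I : ℂ) - y) =
        (t + (x - y) * Complex.I) / (((x-y)^2 + t^2 : ℝ) : ℂ) := by
      rw [div_eq_div_iff h1 h2]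
      push_cast
      linear_combination (t:ℂ) * (y - x) * Complex.I_sq + (-t:ℂ)* Complex.I * (t) * Complex.I_sq * 0 
    rw [h3]
    push_cast
    ring
  have hre : CF g (x + t * Complex.I) = ∫ y : ℝ, ((((t / ((x-y)^2 + t^2)) * g y : ℝ) : ℂ) +
      (((x - y) / ((x-y)^2 + t^2) * g y : ℝ) : ℂ) * Complex.I) := by
    unfold CF; exact integral_congr_ae (Eventually.of_forall e)
  simp_rw [e] at hi
  apply Complex.ext
  · have h1 := hi.re
    have : (CF g (x + t * Complex.I)).re = ∫ y : ℝ, RCLike.re ((((t / ((x-y)^2 + t^2)) * g y : ℝ) : ℂ) +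
      (((x - y) / ((x-y)^2 + t^2) * g y : ℝ) : ℂ) * Complex.I) := by
      rw [integral_re hi, hre]; rfl
    rw [this]
    simp [Ps, Hs, -Complex.ofReal_mul, -Complex.ofReal_div]
  · have : (CF g (x + t * Complex.I)).im = ∫ y : ℝ, RCLike.im ((((t / ((x-y)^2 + t^2)) * g y : ℝ) : ℂ) +
      (((x - y) / ((x-y)^2 + t^2) * g y : ℝ) : ℂ) * Complex.I) := by
      rw [integral_im hi, hre]; rfl
    rw [this]
    simp [Ps, Hs, -Complex.ofReal_mul, -Complex.ofReal_div]


lemma cos_ineq {p : ℝ} (hp : 1 < p) (hp2 : p ≤ 2) : ∃ A B : ℝ, 0 < A ∧ 0 < B ∧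
    ∀ θ : ℝ, |θ| < π / 2 → 1 ≤ A * (Real.cos θ) ^ p - B * Real.cos (p * θ) := by
  have hc : Real.cos (p * (π/2)) < 0 := by
    apply Real.cos_neg_of_pi_div_two_lt_of_lt <;> nlinarith [Real.pi_pos]
  set B := 2 / (- Real.cos (p * (π/2))) with hB
  have hBpos : 0 < B := by rw [hB]; apply div_pos two_pos; linarith
  have hcont : ContinuousAt (fun θ : ℝ => 1 + B * Real.cos (p * θ)) (π/2) := by fun_prop
  have hval : 1 + B * Real.cos (p * (π/2)) = -1 := by
    have h0 : -Real.cos (p * (π/2)) ≠ 0 := (neg_pos.2 hc).ne'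
    have : B * (-Real.cos (p * (π/2))) = 2 := by rw [hB]; exact div_mul_cancel₀ _ h0
    linarith
  have hev : ∀ᶠ θ in 𝓝 (π/2), 1 + B * Real.cos (p * θ) < 0 := by
    apply hcont.eventually_lt continuousAt_const
    rw [hval]; norm_num
  obtain ⟨δ, hδ, hd⟩ := Metric.eventually_nhds_iff.1 hev
  set η := min δ (π/2) with hη
  have hη0 : 0 < η := lt_min hδ (by positivity)
  have hη1 : η ≤ π/2 := min_le_right _ _
  have hs : 0 < Real.sin η := Real.sin_pos_of_pos_of_lt_pi hη0 (by linarith [Real.pi_pos])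
  refine ⟨(1 + B) / (Real.sin η) ^ p, B, by positivity, hBpos, fun θ hθ => ?_⟩
  have hA : 0 < (1 + B) / (Real.sin η) ^ p := by positivity
  have hcosθ : 0 < Real.cos θ := Real.cos_pos_of_mem_Ioo (by
    rw [abs_lt] at hθ; exact ⟨by linarith [hθ.1], hθ.2⟩)
  have hcp : Real.cos (p * θ) = Real.cos (p * |θ|) := by
    rcases abs_cases θ with ⟨h, _⟩ | ⟨h, _⟩ <;> rw [h]
    rw [mul_neg, Real.cos_neg]
  rw [hcp]
  by_cases h : π/2 - η < |θ|
  · have := @hd |θ| (by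
      rw [Real.dist_eq, abs_lt]; constructor <;> linarith [min_le_left δ (π/2)])
    have h2 : 0 ≤ (1 + B) / (Real.sin η) ^ p * (Real.cos θ) ^ p := by positivity
    linarith
  · have h3 : Real.sin η ≤ Real.cos θ := by
      rw [← Real.cos_pi_div_two_sub, ← Real.cos_abs θ]
      apply Real.cos_le_cos_of_nonneg_of_le_pi (abs_nonneg _) (by linarith [Real.pi_pos]) (by linarith)
    have h4 : (1 + B) ≤ (1 + B) / (Real.sin η) ^ p * (Real.cos θ) ^ p := by
      rw [div_mul_eq_mul_div, le_div_iff₀ (by positivity)]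
      gcongr
    have h5 := Real.cos_le_one (p * |θ|)
    nlinarith

lemma cpow_ineq {p : ℝ} (hp : 1 < p) (hp2 : p ≤ 2) : ∃ A B : ℝ, 0 < A ∧ 0 < B ∧
    ∀ w : ℂ, 0 < w.re → ‖w‖ ^ p ≤ A * w.re ^ p - B * (w ^ (p : ℂ)).re := by
  obtain ⟨A, B, hA, hB, h⟩ := cos_ineq hp hp2
  refine ⟨A, B, hA, hB, fun w hw => ?_⟩
  have hw0 : w ≠ 0 := by rintro rfl; simp at hw
  have h1 := h w.arg ((Complex.abs_arg_lt_pi_div_two_iff).2 (Or.inl hw))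
  have hn : 0 < ‖w‖ := norm_pos_iff.2 hw0
  have e1 : w.re = ‖w‖ * Real.cos w.arg := (Complex.norm_mul_cos_arg w).symm
  have e2 : (w ^ (p : ℂ)).re = ‖w‖ ^ p * Real.cos (p * w.arg) := by
    rw [Complex.cpow_ofReal_re]; ring_nf
  have hcos : 0 ≤ Real.cos w.arg := by
    have : 0 < ‖w‖ * Real.cos w.arg := e1 ▸ hw
    exact (pos_of_mul_pos_right this hn.le).le
  rw [e2]
  calc ‖w‖ ^ p ≤ ‖w‖ ^ p * (A * (Real.cos w.arg) ^ p - B * Real.cos (p * w.arg)) :=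
        le_mul_of_one_le_right (by positivity) h1
    _ = _ := by rw [e1, Real.mul_rpow hn.le hcos]; ring

lemma wt_one (t r : ℝ) (ht : 0 < t) (hr : 0 ≤ r) : t / (r^2 + t^2) ≤ 2 * wt 1 t r := by
  unfold wt
  rw [← mul_div_assoc, div_le_div_iff₀ (by positivity) (by positivity)]
  have : t * (t+r)^(1+1) + t * (t-r)^2 = 2 * t * (r^2+t^2) := by ring
  nlinarith [mul_nonneg ht.le (sq_nonneg (t - r))]

lemma Ps_integrable {g : ℝ → ℝ} (hg : Nice g) {t : ℝ} (ht : 0 < t) (x : ℝ) :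
    Integrable (fun y => (t / ((x-y)^2 + t^2)) * g y) := by
  refine Integrable.bdd_mul (c := 1 / t) (hg.integrable volume) ?_ ?_
  · exact Measurable.aestronglyMeasurable (by fun_prop)
  · refine Eventually.of_forall fun y => ?_
    rw [Real.norm_of_nonneg (by positivity), div_le_div_iff₀ (by positivity) (by positivity)]
    nlinarith [sq_nonneg (x-y)]

lemma Hs_integrable {g : ℝ → ℝ} (hg : Nice g) {t : ℝ} (ht : 0 < t) (x : ℝ) :
    Integrable (fun y => ((x-y) / ((x-y)^2 + t^2)) * g y) := by
  refine Integrable.bdd_mul (c := 1 / t) (hg.integrable volume) ?_ ?_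
  · exact Measurable.aestronglyMeasurable (by fun_prop)
  · refine Eventually.of_forall fun y => ?_
    rw [norm_div, Real.norm_of_nonneg (show 0 ≤ (x-y)^2+t^2 by positivity), Real.norm_eq_abs, div_le_div_iff₀ (by positivity) (by positivity)]
    nlinarith [sq_nonneg (|x-y| - t), sq_abs (x-y)]

lemma MF_finrank1 (h : ℝ → ℝ≥0∞) (hh : Measurable h) (x : ℝ) (j : ℤ) :
    ∫⁻ z, ENNReal.ofReal (wt 1 ((2:ℝ)^j) |x-z|) * h z ≤ 16 * MF volume h x := by
  have := wt_MF (volume : Measure ℝ) h hh x j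
  simp only [Module.finrank_self, Real.volume_ball, Real.norm_eq_abs] at this
  refine this.trans (le_of_eq ?_)
  congr 1
  rw [← ENNReal.ofReal_mul (by positivity)]
  norm_num

/-- kernel bound gives maximal function bound -/
lemma ker_MF {k g : ℝ → ℝ} (hg : Measurable g) {c : ℝ} (hc : 0 ≤ c) (x : ℝ) (j : ℤ)
    (hk : ∀ y, |k y| ≤ c * wt 1 ((2:ℝ)^j) |x - y|) :
    ENNReal.ofReal |∫ y, k y * g y| ≤ ENNReal.ofReal c * (16 * MF volume (fun y => ENNReal.ofReal |g y|) x) := by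
  calc ENNReal.ofReal |∫ y, k y * g y| ≤ ∫⁻ y, ENNReal.ofReal |k y * g y| := by
        have := enorm_integral_le_lintegral_enorm (μ := volume) (fun y => k y * g y)
        simpa only [← ofReal_norm_eq_enorm, Real.norm_eq_abs] using this
    _ ≤ ∫⁻ y, ENNReal.ofReal c * (ENNReal.ofReal (wt 1 ((2:ℝ)^j) |x-y|) * ENNReal.ofReal |g y|) := by
        refine lintegral_mono fun y => ?_
        rw [abs_mul, ENNReal.ofReal_mul (abs_nonneg _), ← mul_assoc, ← ENNReal.ofReal_mul hc]
        gcongr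
        exact hk y
    _ = ENNReal.ofReal c * ∫⁻ y, (ENNReal.ofReal (wt 1 ((2:ℝ)^j) |x-y|) * ENNReal.ofReal |g y|) := by
        rw [lintegral_const_mul' _ _ ENNReal.ofReal_ne_top]
    _ ≤ _ := by
        gcongr
        exact MF_finrank1 _ (by fun_prop) x j

lemma Ps_MF {g : ℝ → ℝ} (hg : Measurable g) (x : ℝ) (j : ℤ) :
    ENNReal.ofReal |Ps ((2:ℝ)^j) g x| ≤ ENNReal.ofReal 2 * (16 * MF volume (fun y => ENNReal.ofReal |g y|) x) := by
  refine ker_MF hg (by norm_num) x j fun y => ?_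
  rw [abs_of_nonneg (by positivity), ← sq_abs (x-y)]
  exact wt_one _ _ (by positivity) (abs_nonneg _)


lemma cf_pos {g : ℝ → ℝ} (hg : Nice g) (h0 : ∀ y, 0 ≤ g y) (hne : ¬ g =ᵐ[volume] 0)
    {z : ℂ} (hz : 0 < z.im) : 0 < (CF g z).re := by
  have e : z = (z.re : ℂ) + z.im * Complex.I := (Complex.re_add_im z).symm
  rw [e, CF_eq hg hz]
  simp only [Complex.add_re, Complex.ofReal_re, Complex.mul_re, Complex.I_re, mul_zero,
    Complex.ofReal_im, Complex.I_im, mul_one, sub_self, add_zero]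
  unfold Ps
  rw [integral_pos_iff_support_of_nonneg (fun y => mul_nonneg (by positivity) (h0 y)) (Ps_integrable hg hz _)]
  rw [pos_iff_ne_zero]
  intro h
  apply hne
  have : ∀ᵐ y, y ∉ Function.support (fun y => z.im / ((z.re - y) ^ 2 + z.im ^ 2) * g y) :=
    measure_eq_zero_iff_ae_notMem.1 h
  filter_upwards [this] with y hy
  simp only [Function.mem_support, not_not, mul_eq_zero] at hy
  rcases hy with hy | hy
  · exfalso
    have : 0 < z.im / ((z.re - y) ^ 2 + z.im ^ 2) := by positivity
    linarith
  · exact hy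

lemma integrable_line {t q : ℝ} (ht : 0 < t) (hq : 1 < q) :
    Integrable (fun x : ℝ => ‖(x + t * Complex.I : ℂ)‖ ^ (-q)) := by
  have hi := integrable_rpow_neg_one_add_norm_sq (E := ℝ) (μ := volume) (r := q) (by simpa using hq)
  have hs := hi.comp_mul_left' (R := t⁻¹) (by positivity)
  refine (hs.const_mul (t ^ (-q))).congr (Eventually.of_forall fun x => ?_)
  have e : ‖(x + t * Complex.I : ℂ)‖ = (t^2 * (1 + ‖t⁻¹ * x‖^2)) ^ (1/2 : ℝ) := by
    rw [← Real.sqrt_eq_rpow, Complex.norm_eq_sqrt_sq_add_sq]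
    congr 1
    rw [Real.norm_eq_abs, sq_abs]
    simp
    field_simp
    ring
  simp only
  rw [e, ← Real.rpow_mul (by positivity), Real.mul_rpow (by positivity) (by positivity),
    ← Real.rpow_natCast t 2, ← Real.rpow_mul ht.le]
  congr 1
  · congr 1; push_cast; ring
  · congr 1; ring

lemma continuous_CF_line {g : ℝ → ℝ} (hg : Nice g) {t : ℝ} (ht : 0 < t) :
    Continuous (fun x : ℝ => CF g (x + t * Complex.I)) := by
  have := (CF_diff hg).continuousOn
  refine this.comp_continuous (by fun_prop) fun x => ?_
  simpa using ht

lemma continuous_Ps {g : ℝ → ℝ} (hg : Nice g) {t : ℝ} (ht : 0 < t) : Continuous (Ps t g) := by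
  have := Complex.continuous_re.comp (continuous_CF_line hg ht)
  refine this.congr fun x => ?_
  simp [CF_eq hg ht]

lemma continuous_Hs {g : ℝ → ℝ} (hg : Nice g) {t : ℝ} (ht : 0 < t) : Continuous (Hs t g) := by
  have := Complex.continuous_im.comp (continuous_CF_line hg ht)
  refine this.congr fun x => ?_
  simp [CF_eq hg ht]

lemma hs_pos_int {p : ℝ} (hp : 1 < p) (hp2 : p ≤ 2) : ∃ A : ℝ, 0 < A ∧ ∀ g : ℝ → ℝ, Nice g →
    (∀ y, 0 ≤ g y) → ∀ t : ℝ, 0 < t →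
    ∫⁻ x, ENNReal.ofReal |Hs t g x| ^ p ≤ ENNReal.ofReal A * ∫⁻ x, ENNReal.ofReal |Ps t g x| ^ p := by
  obtain ⟨A, B, hA, hB, hineq⟩ := cpow_ineq hp hp2
  refine ⟨A, hA, fun g hg h0 t ht => ?_⟩
  have hp0 : 0 < p := by linarith
  by_cases hne : g =ᵐ[volume] 0
  · have : ∀ x, Hs t g x = 0 := by
      intro x
      unfold Hs
      rw [integral_eq_zero_of_ae]
      filter_upwards [hne] with y hy
      simp [hy]
    simp [this, hp0]
  set F : ℝ → ℂ := fun x => CF g (x + t * Complex.I) with hF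
  have hFc : Continuous F := continuous_CF_line hg ht
  obtain ⟨C, hC, hCb⟩ := CF_bound hg ht
  have hre : ∀ x, 0 < (F x).re := fun x => cf_pos hg h0 hne (by simpa using ht)
  have hRe : ∀ x, (F x).re = Ps t g x := fun x => by simp [hF, CF_eq hg ht]
  have hIm : ∀ x, (F x).im = Hs t g x := fun x => by simp [hF, CF_eq hg ht]
  have hb : ∀ x, ‖F x‖ ^ p ≤ C ^ p * ‖(x + t * Complex.I : ℂ)‖ ^ (-p) := by
    intro x
    rw [Real.rpow_neg (norm_nonneg _), ← Real.inv_rpow (norm_nonneg _), ← Real.mul_rpow hC (by positivity)]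
    exact Real.rpow_le_rpow (norm_nonneg _) (hCb _ (by simp)) hp0.le
  have hI1 : Integrable (fun x => ‖F x‖ ^ p) := by
    refine ((integrable_line ht hp).const_mul (C^p)).mono' ?_ (Eventually.of_forall fun x => ?_)
    · exact (hFc.norm.rpow_const fun x => Or.inr hp0.le).aestronglyMeasurable
    · rw [Real.norm_of_nonneg (by positivity)]; exact hb x
  have hnorm : ∀ w : ℂ, w ≠ 0 → ‖w ^ (p:ℂ)‖ = ‖w‖ ^ p := fun w hw => by
    exact Complex.norm_cpow_real w p
  have hFne : ∀ x, F x ≠ 0 := fun x h => by have := hre x; rw [h] at this; simp at this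
  have hFs : ∀ x, F x ∈ Complex.slitPlane := fun x => Or.inl (hre x)
  have hcp : Continuous (fun x => F x ^ (p:ℂ)) := hFc.cpow continuous_const hFs
  have hI2 : Integrable (fun x => F x ^ (p:ℂ)) := by
    refine hI1.mono' hcp.aestronglyMeasurable (Eventually.of_forall fun x => ?_)
    rw [hnorm _ (hFne x)]
  have hz : ∫ x, F x ^ (p:ℂ) = 0 := by
    refine contour_zero (fun z => CF g z ^ (p:ℂ)) ?_ (C := C^p) (R₀ := 0) ht hp ?_
    · refine (CF_diff hg).cpow (differentiableOn_const _) fun z hz => Or.inl (cf_pos hg h0 hne hz)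
    · intro z hz _
      have hz0 : CF g z ≠ 0 := fun h => by
        have := cf_pos hg h0 hne (lt_of_lt_of_le ht hz); rw [h] at this; simp at this
      rw [hnorm _ hz0, Real.rpow_neg (norm_nonneg _), ← Real.inv_rpow (norm_nonneg _), ← Real.mul_rpow hC (by positivity)]
      exact Real.rpow_le_rpow (norm_nonneg _) (hCb _ hz) hp0.le
  have hI3 : Integrable (fun x => (Ps t g x) ^ p) := by
    refine hI1.mono' ?_ (Eventually.of_forall fun x => ?_)
    · exact ((continuous_Ps hg ht).rpow_const fun x => Or.inr hp0.le).aestronglyMeasurable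
    · rw [← hRe, Real.norm_of_nonneg (Real.rpow_nonneg (hre x).le _)]
      exact Real.rpow_le_rpow (hre x).le ((le_abs_self _).trans (Complex.abs_re_le_norm _)) hp0.le
  have hz2 : ∫ x, (F x ^ (p:ℂ)).re = 0 := by
    have : ∫ x, RCLike.re (F x ^ (p:ℂ)) = 0 := by rw [integral_re hI2, hz]; simp
    exact this
  have hI4 : Integrable (fun x => (F x ^ (p:ℂ)).re) := hI2.re
  have main : ∫ x, ‖F x‖ ^ p ≤ A * ∫ x, (Ps t g x) ^ p := by
    calc ∫ x, ‖F x‖ ^ p ≤ ∫ x, (A * (Ps t g x) ^ p - B * (F x ^ (p:ℂ)).re) := by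
          refine integral_mono hI1 ((hI3.const_mul A).sub (hI4.const_mul B)) fun x => ?_
          simp only; rw [← hRe]; exact hineq _ (hre x)
      _ = _ := by
          rw [integral_sub (hI3.const_mul A) (hI4.const_mul B), integral_const_mul, integral_const_mul, hz2]; ring
  calc ∫⁻ x, ENNReal.ofReal |Hs t g x| ^ p ≤ ∫⁻ x, ENNReal.ofReal (‖F x‖ ^ p) := by
        refine lintegral_mono fun x => ?_
        rw [ENNReal.ofReal_rpow_of_nonneg (abs_nonneg _) hp0.le, ← hIm]
        apply ENNReal.ofReal_le_ofReal
        exact Real.rpow_le_rpow (abs_nonneg _) (Complex.abs_im_le_norm _) hp0.le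
    _ = ENNReal.ofReal (∫ x, ‖F x‖ ^ p) := by
        rw [ofReal_integral_eq_lintegral_ofReal hI1 (Eventually.of_forall fun x => by positivity)]
    _ ≤ ENNReal.ofReal (A * ∫ x, (Ps t g x) ^ p) := ENNReal.ofReal_le_ofReal main
    _ = ENNReal.ofReal A * ∫⁻ x, ENNReal.ofReal ((Ps t g x) ^ p) := by
        rw [ENNReal.ofReal_mul hA.le, ofReal_integral_eq_lintegral_ofReal hI3
          (Eventually.of_forall fun x => Real.rpow_nonneg (by rw [← hRe]; exact (hre x).le) _)]
    _ = _ := by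
        congr 1
        refine lintegral_congr fun x => ?_
        have := hre x
        rw [hRe] at this
        rw [ENNReal.ofReal_rpow_of_nonneg (abs_nonneg _) hp0.le, abs_of_pos this]

lemma hs_pos {p : ℝ} (hp : 1 < p) (hp2 : p ≤ 2) : ∃ A : ℝ, 0 < A ∧ ∀ g : ℝ → ℝ, Nice g →
    (∀ y, 0 ≤ g y) → ∀ j : ℤ,
    ∫⁻ x, ENNReal.ofReal |Hs ((2:ℝ)^j) g x| ^ p ≤ ENNReal.ofReal A * ∫⁻ x, ENNReal.ofReal |g x| ^ p := by
  obtain ⟨A, hA, h⟩ := hs_pos_int hp hp2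
  obtain ⟨C, hC, hM⟩ := MF_strong (volume : Measure ℝ) p hp
  have hp0 : 0 < p := by linarith
  refine ⟨A * (32 ^ p * C), by positivity, fun g hg h0 j => (h g hg h0 _ (by positivity)).trans ?_⟩
  rw [ENNReal.ofReal_mul hA.le, mul_assoc]
  gcongr
  calc ∫⁻ x, ENNReal.ofReal |Ps ((2:ℝ)^j) g x| ^ p
      ≤ ∫⁻ x, ENNReal.ofReal (32 ^ p) * MF volume (fun y => ENNReal.ofReal |g y|) x ^ p := by
        refine lintegral_mono fun x => ?_
        rw [← ENNReal.ofReal_rpow_of_nonneg (by norm_num) hp0.le, ← ENNReal.mul_rpow_of_nonneg _ _ hp0.le]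
        gcongr
        refine (Ps_MF hg.1 x j).trans (le_of_eq ?_)
        rw [← mul_assoc]; congr 1
        rw [show (16:ℝ≥0∞) = ENNReal.ofReal 16 by norm_num, ← ENNReal.ofReal_mul (by norm_num)]; norm_num
    _ = ENNReal.ofReal (32 ^ p) * ∫⁻ x, MF volume (fun y => ENNReal.ofReal |g y|) x ^ p := by
        rw [lintegral_const_mul' _ _ ENNReal.ofReal_ne_top]
    _ ≤ ENNReal.ofReal (32 ^ p) * (ENNReal.ofReal C * ∫⁻ x, ENNReal.ofReal |g x| ^ p) := by
        gcongr
        refine hM _ ?_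
        have := hg.1
        fun_prop
    _ = _ := by rw [ENNReal.ofReal_mul (by positivity), mul_assoc]


lemma Nice.comp_bdd {E : Type*} [NormedAddCommGroup E] [MeasurableSpace E] {g h : E → ℝ} (hg : Nice g)
    (hm : Measurable h) (hb : ∀ y, |h y| ≤ |g y|) : Nice h := by
  obtain ⟨_, B, R, hB, hR, h1, h2⟩ := hg
  refine ⟨hm, B, R, hB, hR, fun y => (hb y).trans (h1 y), fun y hy => ?_⟩
  have := hb y
  rw [h2 y hy, abs_zero] at this
  exact abs_eq_zero.1 (le_antisymm this (abs_nonneg _))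

lemma hs_low {p : ℝ} (hp : 1 < p) (hp2 : p ≤ 2) : ∃ A : ℝ, 0 < A ∧ ∀ g : ℝ → ℝ, Nice g →
    ∀ j : ℤ,
    ∫⁻ x, ENNReal.ofReal |Hs ((2:ℝ)^j) g x| ^ p ≤ ENNReal.ofReal A * ∫⁻ x, ENNReal.ofReal |g x| ^ p := by
  obtain ⟨A, hA, h⟩ := hs_pos hp hp2
  have hp0 : 0 < p := by linarith
  refine ⟨2 ^ (p-1) * (2 * A), by positivity, fun g hg j => ?_⟩
  set t : ℝ := (2:ℝ)^j with ht
  have ht0 : 0 < t := by positivity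
  have hgm := hg.1
  have n1 : Nice (fun y => max (g y) 0) := hg.comp_bdd (by fun_prop) (fun y => by
    rw [abs_of_nonneg (le_max_right _ _)]; exact max_le (le_abs_self _) (abs_nonneg _))
  have n2 : Nice (fun y => max (-g y) 0) := hg.comp_bdd (by fun_prop) (fun y => by
    rw [abs_of_nonneg (le_max_right _ _)]; exact max_le (neg_le_abs _) (abs_nonneg _))
  have e : ∀ x, Hs t g x = Hs t (fun y => max (g y) 0) x - Hs t (fun y => max (-g y) 0) x := by
    intro x
    unfold Hs
    rw [← integral_sub (Hs_integrable n1 ht0 x) (Hs_integrable n2 ht0 x)]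
    congr 1; funext y
    rw [← mul_sub]
    congr 1
    rcases le_total 0 (g y) with h | h
    · rw [max_eq_left h, max_eq_right (by linarith)]; ring
    · rw [max_eq_right h, max_eq_left (by linarith)]; ring
  have hc := continuous_Hs n1 ht0
  calc ∫⁻ x, ENNReal.ofReal |Hs t g x| ^ p
      ≤ ∫⁻ x, ENNReal.ofReal (2 ^ (p-1)) * (ENNReal.ofReal |Hs t (fun y => max (g y) 0) x| ^ p
          + ENNReal.ofReal |Hs t (fun y => max (-g y) 0) x| ^ p) := by
        refine lintegral_mono fun x => ?_
        rw [e x]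
        have := ENNReal.rpow_add_le_mul_rpow_add_rpow (ENNReal.ofReal |Hs t (fun y => max (g y) 0) x|)
          (ENNReal.ofReal |Hs t (fun y => max (-g y) 0) x|) hp.le
        rw [← ENNReal.ofReal_rpow_of_pos two_pos, ENNReal.ofReal_ofNat]
        refine le_trans ?_ this
        gcongr
        rw [← ENNReal.ofReal_add (abs_nonneg _) (abs_nonneg _)]
        exact ENNReal.ofReal_le_ofReal (abs_sub _ _)
    _ = ENNReal.ofReal (2 ^ (p-1)) * ((∫⁻ x, ENNReal.ofReal |Hs t (fun y => max (g y) 0) x| ^ p)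
          + ∫⁻ x, ENNReal.ofReal |Hs t (fun y => max (-g y) 0) x| ^ p) := by
        rw [lintegral_const_mul' _ _ ENNReal.ofReal_ne_top, lintegral_add_left]
        have := hc.measurable
        fun_prop
    _ ≤ ENNReal.ofReal (2 ^ (p-1)) * (ENNReal.ofReal A * (∫⁻ x, ENNReal.ofReal |g x| ^ p)
          + ENNReal.ofReal A * ∫⁻ x, ENNReal.ofReal |g x| ^ p) := by
        gcongr
        · refine (h _ n1 (fun y => le_max_right _ _) j).trans ?_
          gcongr ENNReal.ofReal A * (∫⁻ x, ENNReal.ofReal ?_ ^ p) with x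
          rw [abs_of_nonneg (le_max_right _ _)]; exact max_le (le_abs_self _) (abs_nonneg _)
        · refine (h _ n2 (fun y => le_max_right _ _) j).trans ?_
          gcongr ENNReal.ofReal A * (∫⁻ x, ENNReal.ofReal ?_ ^ p) with x
          rw [abs_of_nonneg (le_max_right _ _)]; exact max_le (neg_le_abs _) (abs_nonneg _)
    _ = _ := by
        rw [← two_mul, ENNReal.ofReal_mul (by positivity), ENNReal.ofReal_mul (by positivity), ENNReal.ofReal_ofNat]
        ring

lemma hs_adj {g h : ℝ → ℝ} (hg : Nice g) (hh : Nice h) {t : ℝ} (ht : 0 < t) :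
    ∫ x, Hs t g x * h x = - ∫ y, g y * Hs t h y := by
  have hI : Integrable (Function.uncurry fun x y : ℝ => ((x - y) / ((x-y)^2 + t^2)) * (h x * g y))
      (volume.prod volume) := by
    have h1 : Integrable (fun z : ℝ × ℝ => h z.1 * g z.2) (volume.prod volume) :=
      (hh.integrable volume).mul_prod (hg.integrable volume)
    refine Integrable.bdd_mul (c := 1/t) h1 ?_ ?_
    · exact Measurable.aestronglyMeasurable (by fun_prop)
    · refine Eventually.of_forall fun z => ?_
      rw [norm_div, Real.norm_of_nonneg (show 0 ≤ (z.1-z.2)^2+t^2 by positivity), Real.norm_eq_abs, div_le_div_iff₀ (by positivity) (by positivity)]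
      nlinarith [sq_nonneg (|z.1-z.2| - t), sq_abs (z.1-z.2)]
  have := integral_integral_swap hI
  have e1 : ∀ x, Hs t g x * h x = ∫ y, ((x - y) / ((x-y)^2 + t^2)) * (h x * g y) := by
    intro x
    unfold Hs
    rw [← integral_mul_const]
    congr 1; funext y; ring
  have e2 : ∀ y, -(g y * Hs t h y) = ∫ x, ((x - y) / ((x-y)^2 + t^2)) * (h x * g y) := by
    intro y
    unfold Hs
    rw [← integral_const_mul, ← integral_neg]
    congr 1; funext x
    rw [show (y - x)^2 = (x-y)^2 by ring]
    ring
  rw [← integral_neg]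
  simp_rw [e1, e2]
  exact this

lemma hs_high {p : ℝ} (hp : 2 < p) : ∃ A : ℝ, 0 < A ∧ ∀ g : ℝ → ℝ, Nice g →
    ∀ j : ℤ,
    ∫⁻ x, ENNReal.ofReal |Hs ((2:ℝ)^j) g x| ^ p ≤ ENNReal.ofReal A * ∫⁻ x, ENNReal.ofReal |g x| ^ p := by
  set q := p / (p-1) with hq
  have hpq : p.HolderConjugate q := by
    rw [hq]; exact Real.HolderConjugate.conjExponent (by linarith)
  have hq1 : 1 < q := hpq.symm.lt
  have hq2 : q ≤ 2 := by rw [hq, div_le_iff₀ (by linarith)]; linarith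
  obtain ⟨A, hA, h⟩ := hs_low hq1 hq2
  have hp0 : 0 < p := by linarith
  have hq0 : 0 < q := by linarith
  refine ⟨A ^ (p/q), by positivity, fun g hg j => ?_⟩
  set t : ℝ := (2:ℝ)^j with ht
  have ht0 : 0 < t := by positivity
  set F := Hs t g with hF
  have hFc : Continuous F := continuous_Hs hg ht0
  obtain ⟨M, hM⟩ : ∃ M : ℝ, ∀ x, |F x| ≤ M := by
    refine ⟨∫ y, (1/t) * |g y|, fun x => ?_⟩
    rw [hF]; unfold Hs
    rw [← Real.norm_eq_abs]
    refine norm_integral_le_of_norm_le ((hg.integrable volume).abs.const_mul _) (Eventually.of_forall fun y => ?_)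
    rw [norm_mul, Real.norm_eq_abs (g y)]
    refine mul_le_mul_of_nonneg_right ?_ (abs_nonneg _)
    rw [norm_div, Real.norm_of_nonneg (show 0 ≤ (x-y)^2+t^2 by positivity), Real.norm_eq_abs, div_le_div_iff₀ (by positivity) (by positivity)]
    nlinarith [sq_nonneg (|x-y| - t), sq_abs (x-y)]
  have hM0 : 0 ≤ M := (abs_nonneg _).trans (hM 0)
  have key : ∀ N : ℕ, ∫⁻ x, (closedBall (0:ℝ) N).indicator (fun x => ENNReal.ofReal |F x| ^ p) x ≤
      ENNReal.ofReal (A ^ (p/q)) * ∫⁻ x, ENNReal.ofReal |g x| ^ p := by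
    intro N
    set S : Set ℝ := closedBall (0:ℝ) N with hS
    set k : ℝ → ℝ := S.indicator (fun x => |F x| ^ (p-2) * F x) with hk
    have hkn : Nice k := by
      refine ⟨?_, M ^ (p-2) * M + 1, N + 1, by positivity, by positivity, fun y => ?_, fun y hy => ?_⟩
      · refine Measurable.indicator ?_ measurableSet_closedBall
        have := hFc.measurable
        fun_prop
      · rw [hk]
        by_cases hy : y ∈ S
        · rw [Set.indicator_of_mem hy, abs_mul, abs_of_nonneg (by positivity : (0:ℝ) ≤ |F y| ^ (p-2))]
          have := Real.rpow_le_rpow (abs_nonneg _) (hM y) (by linarith : 0 ≤ p-2)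
          have := mul_le_mul this (hM y) (abs_nonneg _) (by positivity)
          linarith
        · rw [Set.indicator_of_notMem hy]; simp; positivity
      · rw [hk, Set.indicator_of_notMem]
        rw [hS, mem_closedBall_zero_iff]; linarith
    have hFk : ∀ x, F x * k x = S.indicator (fun x => |F x| ^ p) x := by
      intro x
      by_cases hx : x ∈ S
      · rw [hk, Set.indicator_of_mem hx, Set.indicator_of_mem hx]
        by_cases h0 : F x = 0
        · rw [h0]; simp [hp0.ne']
        · rw [show F x * (|F x| ^ (p-2) * F x) = |F x| ^ (p-2) * |F x|^2 by rw [sq_abs]; ring,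
            ← Real.rpow_natCast |F x| 2, ← Real.rpow_add (abs_pos.2 h0)]
          congr 1; push_cast; ring
      · simp [hk, Set.indicator_of_notMem hx]
    have hkq : ∀ x, ENNReal.ofReal |k x| ^ q = S.indicator (fun x => ENNReal.ofReal |F x| ^ p) x := by
      intro x
      by_cases hx : x ∈ S
      · rw [hk, Set.indicator_of_mem hx, Set.indicator_of_mem hx, abs_mul, abs_of_nonneg (by positivity : (0:ℝ) ≤ |F x| ^ (p-2)),
          ENNReal.ofReal_rpow_of_nonneg (by positivity) hq0.le, ENNReal.ofReal_rpow_of_nonneg (by positivity) hp0.le]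
        congr 1
        by_cases h0 : F x = 0
        · rw [h0]; simp [hp0.ne', hq0.ne']
        · have : |F x| ^ (p-2) * |F x| = |F x| ^ (p-1) := by
            rw [← Real.rpow_add_one (abs_pos.2 h0).ne']; congr 1; ring
          rw [this, ← Real.rpow_mul (abs_nonneg _)]
          congr 1
          rw [hq]; field_simp [show p - 1 ≠ 0 by linarith]
      · rw [hk, Set.indicator_of_notMem hx, Set.indicator_of_notMem hx]; simp [hq0]
    set I := ∫⁻ x, S.indicator (fun x => ENNReal.ofReal |F x| ^ p) x with hI
    have hIfin : I ≠ ∞ := by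
      rw [hI, lintegral_indicator measurableSet_closedBall]
      refine (lt_of_le_of_lt (setLIntegral_mono measurable_const (g := fun _ => ENNReal.ofReal M ^ p) ?_) ?_).ne
      · intro x _
        gcongr; exact hM x
      · rw [setLIntegral_const]
        exact ENNReal.mul_lt_top (ENNReal.rpow_lt_top_of_nonneg hp0.le ENNReal.ofReal_ne_top) measure_closedBall_lt_top
    have hint : Integrable (fun x => S.indicator (fun x => |F x| ^ p) x) := by
      have : Integrable (fun x => F x * k x) := by
        refine Integrable.bdd_mul (c := M) (hkn.integrable volume) hFc.aestronglyMeasurable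
          (Eventually.of_forall fun x => hM x)
      exact this.congr (Eventually.of_forall hFk)
    have hI2 : I = ENNReal.ofReal (∫ x, F x * k x) := by
      simp_rw [hFk]
      rw [ofReal_integral_eq_lintegral_ofReal hint
        (Eventually.of_forall fun x => Set.indicator_nonneg (fun _ _ => by positivity) _), hI]
      refine lintegral_congr fun x => ?_
      by_cases hx : x ∈ S
      · rw [Set.indicator_of_mem hx, Set.indicator_of_mem hx, ENNReal.ofReal_rpow_of_nonneg (abs_nonneg _) hp0.le]
      · rw [Set.indicator_of_notMem hx, Set.indicator_of_notMem hx]; simp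
    have hgm := hg.1
    have hkc := (continuous_Hs hkn ht0).measurable
    set G := ∫⁻ x, ENNReal.ofReal |g x| ^ p with hG
    have step : I ≤ G ^ (1/p) * (ENNReal.ofReal A * I) ^ (1/q) := by
      calc I = ENNReal.ofReal (∫ x, F x * k x) := hI2
        _ ≤ ∫⁻ y, ENNReal.ofReal |g y| * ENNReal.ofReal |Hs t k y| := by
            rw [hs_adj hg hkn ht0]
            refine (ENNReal.ofReal_le_ofReal (neg_le_abs _)).trans ?_
            have := enorm_integral_le_lintegral_enorm (μ := volume) (fun y => g y * Hs t k y)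
            simpa only [← ofReal_norm_eq_enorm, Real.norm_eq_abs, abs_mul, ENNReal.ofReal_mul (abs_nonneg _)] using this
        _ ≤ G ^ (1/p) * (∫⁻ y, ENNReal.ofReal |Hs t k y| ^ q) ^ (1/q) := by
            exact ENNReal.lintegral_mul_le_Lp_mul_Lq volume hpq (by fun_prop) (by fun_prop)
        _ ≤ _ := by
            gcongr
            refine (h k hkn j).trans ?_
            simp_rw [hkq]; exact le_rfl
    by_cases hI0 : I = 0
    · rw [hI0]; exact zero_le
    have e1 : I ^ (1/p) * I ^ (1/q) = I := by
      rw [← ENNReal.rpow_add _ _ hI0 hIfin]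
      have := hpq.inv_add_inv_eq_one
      rw [one_div, one_div, this, ENNReal.rpow_one]
    have s2 : I ^ (1/p) ≤ G ^ (1/p) * ENNReal.ofReal A ^ (1/q) := by
      rw [ENNReal.mul_rpow_of_nonneg _ _ (by positivity), ← mul_assoc] at step
      nth_rw 1 [← e1] at step
      refine (ENNReal.mul_le_mul_iff_left ?_ ?_).1 step
      · exact (ENNReal.rpow_pos (pos_iff_ne_zero.2 hI0) hIfin).ne'
      · exact (ENNReal.rpow_lt_top_of_nonneg (by positivity) hIfin).ne
    have s3 := ENNReal.rpow_le_rpow s2 hp0.le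
    rw [ENNReal.mul_rpow_of_nonneg _ _ hp0.le, ← ENNReal.rpow_mul, ← ENNReal.rpow_mul, ← ENNReal.rpow_mul,
      one_div_mul_cancel hp0.ne', ENNReal.rpow_one, ENNReal.rpow_one] at s3
    refine s3.trans (le_of_eq ?_)
    rw [mul_comm, ENNReal.ofReal_rpow_of_nonneg hA.le (by positivity)]
    congr 3; ring
  have hmono : Monotone fun (N : ℕ) => (closedBall (0:ℝ) N).indicator (fun x => ENNReal.ofReal |F x| ^ p) := by
    intro N N' hN
    refine Set.indicator_le_indicator_of_subset (closedBall_subset_closedBall (by exact_mod_cast hN)) (fun _ => zero_le)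
  have hsup : ∀ x, ⨆ N : ℕ, (closedBall (0:ℝ) N).indicator (fun x => ENNReal.ofReal |F x| ^ p) x = ENNReal.ofReal |F x| ^ p := by
    intro x
    apply le_antisymm
    · exact iSup_le fun N => Set.indicator_le_self _ _ _
    · obtain ⟨N, hN⟩ := exists_nat_ge ‖x‖
      refine le_trans ?_ (le_iSup _ N)
      rw [Set.indicator_of_mem (by simpa using hN)]
  calc _ = ∫⁻ x, ⨆ N : ℕ, (closedBall (0:ℝ) N).indicator (fun x => ENNReal.ofReal |F x| ^ p) x := by
        simp_rw [hsup]
    _ = ⨆ N : ℕ, ∫⁻ x, (closedBall (0:ℝ) N).indicator (fun x => ENNReal.ofReal |F x| ^ p) x := by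
        refine lintegral_iSup (fun N => Measurable.indicator ?_ measurableSet_closedBall) hmono
        have := hFc.measurable
        fun_prop
    _ ≤ _ := iSup_le key

lemma hs_all {p : ℝ} (hp : 1 < p) : ∃ A : ℝ, 0 < A ∧ ∀ g : ℝ → ℝ, Nice g →
    ∀ j : ℤ,
    ∫⁻ x, ENNReal.ofReal |Hs ((2:ℝ)^j) g x| ^ p ≤ ENNReal.ofReal A * ∫⁻ x, ENNReal.ofReal |g x| ^ p := by
  rcases le_or_gt p 2 with h | h
  · exact hs_low hp h
  · exact hs_high h


lemma integral_poisson1 {s : ℝ} (hs : 0 < s) (x : ℝ) : ∫ y : ℝ, s / ((x-y)^2 + s^2) = π := by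
  have h := integral_univ_inv_one_add_sq
  have h2 := Measure.integral_comp_mul_left (fun y : ℝ => (1 + y^2)⁻¹) (s⁻¹)
  have h3 : ∫ y : ℝ, s / ((x-y)^2+s^2) = ∫ y : ℝ, s / (y^2+s^2) :=
    integral_sub_left_eq_self (fun y : ℝ => s / (y^2+s^2)) volume x
  rw [h3]
  have e : ∀ y : ℝ, s / (y^2+s^2) = s⁻¹ * (1 + (s⁻¹ * y)^2)⁻¹ := by
    intro y; field_simp; ring
  simp_rw [e]
  rw [integral_const_mul, h2, h]
  simp
  rw [abs_of_pos hs]; field_simp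

lemma integrable_poisson1 {s : ℝ} (hs : 0 < s) (x : ℝ) : Integrable (fun y : ℝ => s / ((x-y)^2 + s^2)) := by
  by_contra h
  have := integral_poisson1 hs x
  rw [integral_undef h] at this
  exact Real.pi_pos.ne this

lemma CF_repro {g : ℝ → ℝ} (hg : Nice g) {t s : ℝ} (ht : 0 < t) (hs : t ≤ s) (x : ℝ) :
    ∫ y : ℝ, ((s / ((x-y)^2 + s^2) : ℝ) : ℂ) * CF g (y + t * Complex.I) =
      π * CF g (x + (t + s : ℝ) * Complex.I) := by
  have hs0 : 0 < s := by linarith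
  set w : ℂ := x + (t + s : ℝ) * Complex.I with hw
  set w' : ℂ := x + (t - s : ℝ) * Complex.I with hw'
  have hwim : w.im = t + s := by simp [hw]
  have hw'im : w'.im = t - s := by simp [hw']
  have hwU : {z : ℂ | 0 < z.im} ∈ 𝓝 w := by
    apply (isOpen_lt continuous_const Complex.continuous_im).mem_nhds
    show 0 < w.im
    rw [hwim]; linarith
  obtain ⟨C, hC, hCb⟩ := CF_bound hg ht
  have hne' : ∀ z : ℂ, 0 < z.im → z - w' ≠ 0 := by
    intro z hz h
    have := congrArg Complex.im h
    rw [Complex.sub_im, hw'im] at this; simp at this; linarith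
  have h0 := contour_zero (fun z => dslope (CF g) w z * (z - w')⁻¹) (t := t) (q := 2)
    (C := 4 * (C + ‖CF g w‖)) (R₀ := 2 * ‖w‖ + 2 * ‖w'‖ + 1) (by
      refine DifferentiableOn.mul ((Complex.differentiableOn_dslope hwU).2 (CF_diff hg)) ?_
      refine DifferentiableOn.inv (by fun_prop) fun z hz => hne' z hz) ht (by norm_num) (by
      intro z hz hzn
      have n1 : 1 ≤ ‖z‖ := by linarith [norm_nonneg w, norm_nonneg w']
      have hzw : z ≠ w := by rintro rfl; linarith [norm_nonneg w']
      have n2 : ‖z‖/2 ≤ ‖z - w‖ := by linarith [norm_sub_norm_le z w, norm_nonneg w']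
      have n3 : ‖z‖/2 ≤ ‖z - w'‖ := by linarith [norm_sub_norm_le z w', norm_nonneg w]
      have n4 : ‖CF g z - CF g w‖ ≤ C + ‖CF g w‖ := by
        refine (norm_sub_le _ _).trans (add_le_add_left ((hCb z hz).trans ?_) _)
        exact mul_le_of_le_one_right hC (inv_le_one_of_one_le₀ n1)
      rw [dslope_of_ne _ hzw, slope_def_field, norm_mul, norm_div, norm_inv]
      have e : 4 * (C + ‖CF g w‖) * ‖z‖ ^ (-2:ℝ) = (C + ‖CF g w‖) / (‖z‖/2) * (‖z‖/2)⁻¹ := by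
        rw [Real.rpow_neg (norm_nonneg _)]
        rw [show ‖z‖ ^ (2:ℝ) = ‖z‖^2 by exact_mod_cast Real.rpow_natCast ‖z‖ 2]
        field_simp
        ring
      rw [e]
      gcongr)
  have e1 : ∀ y : ℝ, dslope (CF g) w (y + t * Complex.I) * ((y + t * Complex.I : ℂ) - w')⁻¹ =
      ((s:ℂ)⁻¹) * (((s / ((x-y)^2 + s^2) : ℝ) : ℂ) * CF g (y + t * Complex.I) - ((s / ((x-y)^2 + s^2) : ℝ) : ℂ) * CF g w) := by
    intro y
    have hyw : (y + t * Complex.I : ℂ) ≠ w := by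
      intro h
      have := congrArg Complex.im h
      rw [hwim] at this; simp at this; linarith
    have a1 := sub_ne_zero.2 hyw
    have a2 := hne' (y + t * Complex.I) (by simpa using ht)
    have a3 : ((y + t * Complex.I : ℂ) - w) * ((y + t * Complex.I : ℂ) - w') = (((x-y)^2 + s^2 : ℝ) : ℂ) := by
      rw [hw, hw']; push_cast
      linear_combination (-(s:ℂ)^2) * Complex.I_sq
    have a4 : (s:ℂ) ≠ 0 := by exact_mod_cast hs0.ne'
    rw [dslope_of_ne _ hyw, slope_def_field, Complex.ofReal_div, ← a3]
    field_simp
  simp only [e1] at h0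
  have i1 : Integrable (fun y : ℝ => ((s / ((x-y)^2 + s^2) : ℝ) : ℂ)) := (integrable_poisson1 hs0 x).ofReal
  have i2 : Integrable (fun y : ℝ => ((s / ((x-y)^2 + s^2) : ℝ) : ℂ) * CF g (y + t * Complex.I)) := by
    have : Integrable (fun y : ℝ => CF g (y + t * Complex.I) * ((s / ((x-y)^2 + s^2) : ℝ) : ℂ)) := by
      refine Integrable.bdd_mul (c := C * t⁻¹) i1 (continuous_CF_line hg ht).aestronglyMeasurable
        (Eventually.of_forall fun y => (hCb _ (by simp)).trans ?_)
      gcongr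
      refine le_trans ?_ (Complex.abs_im_le_norm _)
      simp [abs_of_pos ht]
    simpa only [mul_comm] using this
  rw [integral_const_mul, integral_sub i2 (i1.mul_const _), integral_mul_const, integral_complex_ofReal,
    integral_poisson1 hs0] at h0
  have a4 : (s:ℂ)⁻¹ ≠ 0 := inv_ne_zero (by exact_mod_cast hs0.ne')
  exact sub_eq_zero.1 ((mul_eq_zero.1 h0).resolve_left a4)

lemma Hs_repro {g : ℝ → ℝ} (hg : Nice g) {t s : ℝ} (ht : 0 < t) (hs : t ≤ s) (x : ℝ) :
    Hs (t + s) g x = ∫ y : ℝ, (π⁻¹ * (s / ((x-y)^2 + s^2))) * Hs t g y := by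
  have hs0 : 0 < s := by linarith
  have h := CF_repro hg ht hs x
  have i1 : Integrable (fun y : ℝ => ((s / ((x-y)^2 + s^2) : ℝ) : ℂ)) := (integrable_poisson1 hs0 x).ofReal
  obtain ⟨C, hC, hCb⟩ := CF_bound hg ht
  have i2 : Integrable (fun y : ℝ => ((s / ((x-y)^2 + s^2) : ℝ) : ℂ) * CF g (y + t * Complex.I)) := by
    have : Integrable (fun y : ℝ => CF g (y + t * Complex.I) * ((s / ((x-y)^2 + s^2) : ℝ) : ℂ)) := by
      refine Integrable.bdd_mul (c := C * t⁻¹) i1 (continuous_CF_line hg ht).aestronglyMeasurable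
        (Eventually.of_forall fun y => (hCb _ (by simp)).trans ?_)
      gcongr
      refine le_trans ?_ (Complex.abs_im_le_norm _)
      simp [abs_of_pos ht]
    simpa only [mul_comm] using this
  have h2 := congrArg Complex.im h
  have h3 : (∫ y : ℝ, ((s / ((x-y)^2 + s^2) : ℝ) : ℂ) * CF g (y + t * Complex.I)).im =
      ∫ y : ℝ, (s / ((x-y)^2 + s^2)) * Hs t g y := by
    have : ∫ y : ℝ, RCLike.im (((s / ((x-y)^2 + s^2) : ℝ) : ℂ) * CF g (y + t * Complex.I)) = (∫ y : ℝ, ((s / ((x-y)^2 + s^2) : ℝ) : ℂ) * CF g (y + t * Complex.I)).im := integral_im i2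
    rw [← this]
    congr 1; funext y
    simp [CF_eq hg ht, -Complex.ofReal_div]
  rw [h3, Complex.im_ofReal_mul, CF_eq hg (by linarith : 0 < t + s)] at h2
  simp at h2
  simp_rw [mul_assoc]
  rw [integral_const_mul, h2]
  field_simp

lemma Hs_MF {g : ℝ → ℝ} (hg : Nice g) {i j : ℤ} (hij : j < i) (x : ℝ) :
    ENNReal.ofReal |Hs ((2:ℝ)^i) g x| ≤ ENNReal.ofReal 8 * (16 * MF volume (fun y => ENNReal.ofReal |Hs ((2:ℝ)^j) g y|) x) := by
  set t := (2:ℝ)^j with ht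
  have ht0 : 0 < t := by positivity
  have hi : 2 * t ≤ (2:ℝ)^i := by
    rw [ht, ← zpow_one_add₀ (by norm_num)]
    exact zpow_le_zpow_right₀ (by norm_num) (by omega)
  set T := (2:ℝ)^i with hT
  have := Hs_repro hg ht0 (s := T - t) (by linarith) x
  rw [add_sub_cancel] at this
  rw [this]
  refine ker_MF (continuous_Hs hg ht0).measurable (by norm_num) x i fun y => ?_
  have hs : 0 < T - t := by linarith
  have hTpos : 0 < T := by linarith
  rw [abs_of_nonneg (by positivity)]
  have hpi : π⁻¹ ≤ 1 := inv_le_one_of_one_le₀ (by linarith [Real.pi_gt_three])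
  have hr := abs_nonneg (x-y)
  calc π⁻¹ * ((T-t) / ((x-y)^2 + (T-t)^2)) ≤ (T-t) / (|x-y|^2 + (T-t)^2) := by
        rw [sq_abs]; exact mul_le_of_le_one_left (by positivity) hpi
    _ ≤ 2 * wt 1 (T-t) |x-y| := wt_one _ _ hs hr
    _ ≤ 8 * wt 1 T |x-y| := by
        unfold wt
        rw [← mul_div_assoc, ← mul_div_assoc, div_le_div_iff₀ (by positivity) (by positivity)]
        have a : T + |x-y| ≤ 2 * ((T-t) + |x-y|) := by linarith
        have b : (T + |x-y|)^(1+1) ≤ 4 * ((T-t) + |x-y|)^(1+1) := by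
          have := pow_le_pow_left₀ (by positivity) a 2
          norm_num at this ⊢
          nlinarith
        calc 2 * (T-t) * (T + |x-y|)^(1+1) ≤ 2 * T * (4 * ((T-t) + |x-y|)^(1+1)) := by
              gcongr; linarith
          _ = _ := by ring

/-- truncated Hilbert transform -/
def Ht (j : ℤ) (g : ℝ → ℝ) (x : ℝ) : ℝ :=
  ∫ y : ℝ, (if (2:ℝ)^j < |x - y| then (x-y)⁻¹ else 0) * g y

lemma Ht_integrable {g : ℝ → ℝ} (hg : Nice g) (j : ℤ) (x : ℝ) :
    Integrable (fun y => (if (2:ℝ)^j < |x - y| then (x-y)⁻¹ else 0) * g y) := by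
  refine Integrable.bdd_mul (c := ((2:ℝ)^j)⁻¹) (hg.integrable volume) ?_ ?_
  · refine Measurable.aestronglyMeasurable (Measurable.ite ?_ (by fun_prop) (by fun_prop))
    exact measurableSet_lt measurable_const (by fun_prop)
  · refine Eventually.of_forall fun y => ?_
    split_ifs with h
    · rw [norm_inv, Real.norm_eq_abs]; gcongr
    · simp; positivity

lemma Ht_le {g : ℝ → ℝ} (hg : Nice g) (j : ℤ) (x : ℝ) :
    ENNReal.ofReal |Ht j g x| ≤ ENNReal.ofReal |Hs ((2:ℝ)^j) g x| +
      ENNReal.ofReal 2 * (16 * MF volume (fun y => ENNReal.ofReal |g y|) x) := by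
  set t := (2:ℝ)^j with ht
  have ht0 : 0 < t := by positivity
  have e : Ht j g x = Hs t g x + ∫ y, ((if t < |x - y| then (x-y)⁻¹ else 0) - ((x - y) / ((x-y)^2 + t^2))) * g y := by
    simp_rw [sub_mul]
    rw [integral_sub (Ht_integrable hg j x) (Hs_integrable hg ht0 x)]
    unfold Ht Hs; ring
  rw [e]
  refine (ENNReal.ofReal_le_ofReal (abs_add_le _ _)).trans ?_
  rw [ENNReal.ofReal_add (abs_nonneg _) (abs_nonneg _)]
  gcongr
  refine ker_MF hg.1 (by norm_num) x j fun y => ?_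
  refine le_trans ?_ (wt_one t |x-y| ht0 (abs_nonneg _))
  set r := x - y
  rw [sq_abs]
  split_ifs with h
  · have hr : r ≠ 0 := abs_pos.1 (ht0.trans h)
    have : r⁻¹ - r / (r^2+t^2) = t^2 / (r * (r^2+t^2)) := by field_simp; ring
    rw [this, abs_div, abs_mul, abs_of_pos (by positivity : 0 < r^2+t^2), abs_of_nonneg (by positivity : 0 ≤ t^2)]
    rw [← div_div]
    gcongr
    rw [div_le_iff₀ (by positivity)]
    nlinarith
  · rw [zero_sub, abs_neg, abs_div, abs_of_pos (by positivity : 0 < r^2+t^2)]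
    gcongr
    linarith

lemma iSup_Hs_bound {p : ℝ} (hp : 1 < p) : ∃ A : ℝ, 0 < A ∧ ∀ g : ℝ → ℝ, Nice g →
    ∫⁻ x, (⨆ j : ℤ, ENNReal.ofReal |Hs ((2:ℝ)^j) g x|) ^ p ≤ ENNReal.ofReal A * ∫⁻ x, ENNReal.ofReal |g x| ^ p := by
  obtain ⟨A, hA, h⟩ := hs_all hp
  obtain ⟨C, hC, hM⟩ := MF_strong (volume : Measure ℝ) p hp
  have hp0 : 0 < p := by linarith
  refine ⟨128 ^ p * (C * A), by positivity, fun g hg => ?_⟩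
  have hm : ∀ j : ℤ, Measurable (fun x => ENNReal.ofReal |Hs ((2:ℝ)^j) g x|) := fun j => by
    have := (continuous_Hs hg (t := (2:ℝ)^j) (by positivity)).measurable
    fun_prop
  set S : ℕ → ℝ → ℝ≥0∞ := fun N x => (⨆ i : {i : ℤ // -(N:ℤ) < i}, ENNReal.ofReal |Hs ((2:ℝ)^(i:ℤ)) g x|) ^ p with hS
  have hSm : ∀ N, Measurable (S N) := fun N => (Measurable.iSup fun i : {i : ℤ // -(N:ℤ) < i} => hm i).pow_const p
  have hmono : Monotone S := by
    intro N N' hN x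
    simp only [hS]
    gcongr
    refine iSup_le fun i => le_iSup (fun i : {i : ℤ // -(N':ℤ) < i} => ENNReal.ofReal |Hs ((2:ℝ)^(i:ℤ)) g x|) ⟨i, ?_⟩
    have := i.2; have : (N:ℤ) ≤ N' := by exact_mod_cast hN
    omega
  have hsup : ∀ x, (⨆ j : ℤ, ENNReal.ofReal |Hs ((2:ℝ)^j) g x|) ^ p ≤ ⨆ N, S N x := by
    intro x
    have e : (⨆ j : ℤ, ENNReal.ofReal |Hs ((2:ℝ)^j) g x|) ≤ (⨆ N, S N x) ^ (1/p) := by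
      refine iSup_le fun j => ?_
      rw [one_div, ENNReal.le_rpow_inv_iff hp0]
      refine le_trans ?_ (le_iSup _ (j.natAbs + 1))
      simp only [hS]
      gcongr
      exact le_iSup (fun i : {i : ℤ // -((j.natAbs + 1 : ℕ):ℤ) < i} => ENNReal.ofReal |Hs ((2:ℝ)^(i:ℤ)) g x|) ⟨j, by omega⟩
    rw [one_div] at e; exact (ENNReal.le_rpow_inv_iff hp0).1 e
  refine (lintegral_mono hsup).trans ?_
  rw [lintegral_iSup hSm hmono]
  refine iSup_le fun N => ?_
  calc ∫⁻ x, S N x ≤ ∫⁻ x, ENNReal.ofReal (128 ^ p) * MF volume (fun y => ENNReal.ofReal |Hs ((2:ℝ)^(-(N:ℤ))) g y|) x ^ p := by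
        refine lintegral_mono fun x => ?_
        rw [← ENNReal.ofReal_rpow_of_nonneg (by norm_num) hp0.le, ← ENNReal.mul_rpow_of_nonneg _ _ hp0.le]
        simp only [hS]
        gcongr
        refine iSup_le fun i => (Hs_MF hg i.2 x).trans (le_of_eq ?_)
        rw [← mul_assoc]; congr 1
        rw [show (16:ℝ≥0∞) = ENNReal.ofReal 16 by norm_num, ← ENNReal.ofReal_mul (by norm_num)]; norm_num
    _ = ENNReal.ofReal (128 ^ p) * ∫⁻ x, MF volume (fun y => ENNReal.ofReal |Hs ((2:ℝ)^(-(N:ℤ))) g y|) x ^ p := by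
        rw [lintegral_const_mul' _ _ ENNReal.ofReal_ne_top]
    _ ≤ ENNReal.ofReal (128 ^ p) * (ENNReal.ofReal C * (ENNReal.ofReal A * ∫⁻ x, ENNReal.ofReal |g x| ^ p)) := by
        gcongr
        refine (hM _ (hm _)).trans ?_
        gcongr
        exact h g hg _
    _ = _ := by rw [ENNReal.ofReal_mul (by positivity), ENNReal.ofReal_mul (by positivity)]; ring

theorem Ht_bound {p : ℝ} (hp : 1 < p) : ∃ A : ℝ, 0 < A ∧ ∀ g : ℝ → ℝ, Nice g →
    ∫⁻ x, (⨆ j : ℤ, ENNReal.ofReal |Ht j g x|) ^ p ≤ ENNReal.ofReal A * ∫⁻ x, ENNReal.ofReal |g x| ^ p := by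
  obtain ⟨A, hA, h⟩ := iSup_Hs_bound hp
  obtain ⟨C, hC, hM⟩ := MF_strong (volume : Measure ℝ) p hp
  have hp0 : 0 < p := by linarith
  refine ⟨2^(p-1) * (A + 32^p * C), by positivity, fun g hg => ?_⟩
  have hgm := hg.1
  have hm : ∀ j : ℤ, Measurable (fun x => ENNReal.ofReal |Hs ((2:ℝ)^j) g x|) := fun j => by
    have := (continuous_Hs hg (t := (2:ℝ)^j) (by positivity)).measurable
    fun_prop
  calc ∫⁻ x, (⨆ j : ℤ, ENNReal.ofReal |Ht j g x|) ^ p ≤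
      ∫⁻ x, ENNReal.ofReal (2 ^ (p-1)) * ((⨆ j : ℤ, ENNReal.ofReal |Hs ((2:ℝ)^j) g x|) ^ p +
        ENNReal.ofReal (32 ^ p) * MF volume (fun y => ENNReal.ofReal |g y|) x ^ p) := by
        refine lintegral_mono fun x => ?_
        have := ENNReal.rpow_add_le_mul_rpow_add_rpow (⨆ j : ℤ, ENNReal.ofReal |Hs ((2:ℝ)^j) g x|)
          (ENNReal.ofReal 32 * MF volume (fun y => ENNReal.ofReal |g y|) x) hp.le
        rw [ENNReal.mul_rpow_of_nonneg _ _ hp0.le, ENNReal.ofReal_rpow_of_nonneg (by norm_num) hp0.le] at this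
        rw [← ENNReal.ofReal_rpow_of_pos two_pos, ENNReal.ofReal_ofNat]
        refine le_trans ?_ this
        gcongr
        refine iSup_le fun j => (Ht_le hg j x).trans ?_
        refine add_le_add (le_iSup (fun j : ℤ => ENNReal.ofReal |Hs ((2:ℝ)^j) g x|) j) (le_of_eq ?_)
        rw [← mul_assoc]; congr 1
        rw [show (16:ℝ≥0∞) = ENNReal.ofReal 16 by norm_num, ← ENNReal.ofReal_mul (by norm_num)]; norm_num
    _ = ENNReal.ofReal (2 ^ (p-1)) * ((∫⁻ x, (⨆ j : ℤ, ENNReal.ofReal |Hs ((2:ℝ)^j) g x|) ^ p) +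
        ENNReal.ofReal (32 ^ p) * ∫⁻ x, MF volume (fun y => ENNReal.ofReal |g y|) x ^ p) := by
        rw [lintegral_const_mul' _ _ ENNReal.ofReal_ne_top, lintegral_add_left, lintegral_const_mul' _ _ ENNReal.ofReal_ne_top]
        exact (Measurable.iSup fun i => hm i).pow_const p
    _ ≤ ENNReal.ofReal (2 ^ (p-1)) * ((ENNReal.ofReal A * ∫⁻ x, ENNReal.ofReal |g x| ^ p) +
        ENNReal.ofReal (32 ^ p) * (ENNReal.ofReal C * ∫⁻ x, ENNReal.ofReal |g x| ^ p)) := by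
        gcongr
        · exact h g hg
        · exact hM _ (by fun_prop)
    _ = _ := by
        rw [ENNReal.ofReal_mul (by positivity), ENNReal.ofReal_add (by positivity) (by positivity), ENNReal.ofReal_mul (by positivity)]
        ring


section Rot
variable {V : Type*} [NormedAddCommGroup V] [InnerProductSpace ℝ V] [FiniteDimensional ℝ V]
  [MeasurableSpace V] [BorelSpace V]

/-- truncated 1/s -/
def ks (j : ℤ) (s : ℝ) : ℝ := if (2:ℝ)^j < |s| then s⁻¹ else 0

lemma measurable_ks (j : ℤ) : Measurable (ks j) :=
  Measurable.ite (measurableSet_lt measurable_const (by fun_prop)) (by fun_prop) (by fun_prop)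

lemma abs_ks_le (j : ℤ) (s : ℝ) : |ks j s| ≤ ((2:ℝ)^j)⁻¹ := by
  unfold ks
  split_ifs with h
  · rw [abs_inv]; gcongr
  · simp; positivity

/-- directional truncated Hilbert transform -/
def dirH (j : ℤ) (w : V) (g : V → ℝ) (x : V) : ℝ := ∫ s : ℝ, ks j s * g (x - s • w)

lemma nice_line {g : V → ℝ} (hg : Nice g) (x : V) {w : V} (hw : w ≠ 0) :
    Nice (fun σ : ℝ => g (x + σ • w)) := by
  obtain ⟨hm, B, R, hB, hR, h1, h2⟩ := hg
  have hw' : 0 < ‖w‖ := norm_pos_iff.2 hw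
  refine ⟨by fun_prop, B, (R + ‖x‖) / ‖w‖ , hB, by positivity, fun y => h1 _, fun y hy => h2 _ ?_⟩
  rw [div_lt_iff₀ hw'] at hy
  have := norm_sub_norm_le (y • w) (-x)
  rw [norm_smul, norm_neg, sub_neg_eq_add, add_comm] at this
  linarith

lemma dirH_line {g : V → ℝ} (j : ℤ) (x w : V) (σ : ℝ) :
    dirH j w g (x + σ • w) = Ht j (fun σ : ℝ => g (x + σ • w)) σ := by
  unfold dirH Ht
  rw [← integral_sub_left_eq_self _ volume σ]
  congr 1; funext s
  simp only [ks]
  congr 2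
  rw [sub_smul]; abel

lemma measurable_dirH {g : V → ℝ} (hg : Measurable g) (j : ℤ) :
    Measurable (fun z : V × V => dirH j z.2 g z.1) := by
  unfold dirH
  have hm : StronglyMeasurable (fun q : (V × V) × ℝ => ks j q.2 * g (q.1.1 - q.2 • q.1.2)) := by
    apply Measurable.stronglyMeasurable
    have := measurable_ks j
    fun_prop
  exact (hm.integral_prod_right (ν := volume)).measurable

lemma strip_integral {w : V} (hw : w ≠ 0) (Φ : V → ℝ≥0∞) (hΦ : Measurable Φ) :
    ∫⁻ x, ({x : V | 0 ≤ inner ℝ w x ∧ inner ℝ w x < ‖w‖^2}.indicator (fun x => ∫⁻ σ : ℝ, Φ (x + σ • w)) x) = ∫⁻ x, Φ x := by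
  set S : Set V := {x : V | 0 ≤ inner ℝ w x ∧ inner ℝ w x < ‖w‖^2} with hS
  have hSm : MeasurableSet S := by
    have hi : Measurable (fun x : V => (inner ℝ w x : ℝ)) := (by fun_prop : Continuous (fun x : V => (inner ℝ w x : ℝ))).measurable
    exact (measurableSet_le measurable_const hi).inter (measurableSet_lt hi measurable_const)
  have hwn : 0 < ‖w‖^2 := by have := norm_pos_iff.2 hw; positivity
  calc _ = ∫⁻ x, ∫⁻ σ : ℝ, S.indicator 1 x * Φ (x + σ • w) := by
        refine lintegral_congr fun x => ?_
        by_cases hx : x ∈ S <;> simp [hx]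
    _ = ∫⁻ σ : ℝ, ∫⁻ x, S.indicator 1 x * Φ (x + σ • w) := by
        refine lintegral_lintegral_swap ?_
        apply Measurable.aemeasurable
        have : Measurable (S.indicator (1 : V → ℝ≥0∞)) := measurable_one.indicator hSm
        simp only [Function.uncurry_def]
        fun_prop
    _ = ∫⁻ σ : ℝ, ∫⁻ x, S.indicator 1 (x - σ • w) * Φ x := by
        refine lintegral_congr fun σ => ?_
        rw [← lintegral_add_right_eq_self (fun x => S.indicator 1 (x - σ • w) * Φ x) (σ • w)]
        simp
    _ = ∫⁻ x, ∫⁻ σ : ℝ, S.indicator 1 (x - σ • w) * Φ x := by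
        refine lintegral_lintegral_swap ?_
        apply Measurable.aemeasurable
        have : Measurable (S.indicator (1 : V → ℝ≥0∞)) := measurable_one.indicator hSm
        simp only [Function.uncurry_def]
        fun_prop
    _ = ∫⁻ x, Φ x := by
        refine lintegral_congr fun x => ?_
        have hm : Measurable fun σ : ℝ => S.indicator (1 : V → ℝ≥0∞) (x - σ • w) := by
          have : Measurable (S.indicator (1 : V → ℝ≥0∞)) := measurable_one.indicator hSm
          fun_prop
        rw [lintegral_mul_const _ hm]
        have e : (fun σ : ℝ => S.indicator (1 : V → ℝ≥0∞) (x - σ • w)) =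
            (Set.Ioc (inner ℝ w x / ‖w‖^2 - 1) (inner ℝ w x / ‖w‖^2)).indicator 1 := by
          funext σ
          have : (x - σ • w ∈ S) ↔ σ ∈ Set.Ioc (inner ℝ w x / ‖w‖^2 - 1) (inner ℝ w x / ‖w‖^2) := by
            simp only [hS, Set.mem_setOf_eq, Set.mem_Ioc, inner_sub_right, inner_smul_right,
              real_inner_self_eq_norm_sq]
            rw [le_div_iff₀ hwn, sub_lt_iff_lt_add (c := (1:ℝ)), div_lt_iff₀ hwn]
            constructor <;> rintro ⟨h1, h2⟩ <;> constructor <;> linarith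
          by_cases h : x - σ • w ∈ S
          · rw [Set.indicator_of_mem h, Set.indicator_of_mem (this.1 h)]; rfl
          · rw [Set.indicator_of_notMem h, Set.indicator_of_notMem (fun h' => h (this.2 h'))]
        rw [e, lintegral_indicator_one measurableSet_Ioc]
        simp

lemma dir_bound {p : ℝ} (hp : 1 < p) : ∃ A : ℝ, 0 < A ∧ ∀ g : V → ℝ, Nice g → ∀ w : V, w ≠ 0 →
    ∫⁻ x, (⨆ j : ℤ, ENNReal.ofReal |dirH j w g x|) ^ p ≤ ENNReal.ofReal A * ∫⁻ x, ENNReal.ofReal |g x| ^ p := by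
  obtain ⟨A, hA, h⟩ := Ht_bound hp
  refine ⟨A, hA, fun g hg w hw => ?_⟩
  have hgm := hg.1
  have hm : Measurable (fun x => (⨆ j : ℤ, ENNReal.ofReal |dirH j w g x|) ^ p) := by
    refine (Measurable.iSup fun j => ?_).pow_const p
    have : Measurable (fun x => dirH j w g x) := (measurable_dirH hgm j).comp (measurable_id.prodMk measurable_const)
    fun_prop
  rw [← strip_integral hw _ hm, ← strip_integral hw (fun x => ENNReal.ofReal |g x| ^ p) (by fun_prop)]
  rw [← lintegral_const_mul' _ _ ENNReal.ofReal_ne_top]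
  refine lintegral_mono fun x => ?_
  rw [← Set.indicator_const_mul]
  refine Set.indicator_le_indicator ?_
  simp only [dirH_line]
  exact h _ (nice_line hg x hw)

end Rot


section Rot2
variable {V : Type*} [NormedAddCommGroup V] [InnerProductSpace ℝ V] [FiniteDimensional ℝ V]
  [MeasurableSpace V] [BorelSpace V]

/-- odd kernels, homogeneous of degree minus the dimension -/
structure OddK (K : V → ℝ) : Prop where
  meas : Measurable K
  hom : ∀ (s : ℝ) (y : V), 0 < s → K (s • y) = (s ^ (Module.finrank ℝ V))⁻¹ * K y
  odd : ∀ y, K (-y) = - K y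
  bd : ∃ C : ℝ, 0 < C ∧ ∀ y, |K y| * ‖y‖ ^ (Module.finrank ℝ V) ≤ C

lemma OddK.inv_smul {K : V → ℝ} (hK : OddK K) {s : ℝ} (hs : s ≠ 0) (y : V) :
    K (s⁻¹ • y) = SignType.sign s * |s| ^ (Module.finrank ℝ V) * K y := by
  rcases lt_or_gt_of_ne hs with h | h
  · have e : s⁻¹ • y = -(((-s)⁻¹) • y) := by rw [inv_neg, neg_smul, neg_neg]
    rw [e, hK.odd, hK.hom _ _ (inv_pos.2 (by linarith)), inv_pow, inv_inv, sign_neg h, abs_of_neg h]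
    simp
  · rw [hK.hom _ _ (inv_pos.2 h), inv_pow, inv_inv, sign_pos h, abs_of_pos h]
    simp

/-- annular part of the kernel -/
def psiK (K : V → ℝ) (w : V) : ℝ := if 1 ≤ ‖w‖ ∧ ‖w‖ ≤ 2 then K w else 0

/-- radial profile -/
def Lam (j : ℤ) (r : ℝ) : ℝ := ∫ s : ℝ, if |s| ≤ r ∧ r ≤ 2 * |s| then |ks j s| else 0

lemma measurable_psiK {K : V → ℝ} (hK : OddK K) : Measurable (psiK K) := by
  refine Measurable.ite ?_ hK.meas measurable_const
  exact (measurableSet_le measurable_const measurable_norm).inter (measurableSet_le measurable_norm measurable_const)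

lemma psiK_bd {K : V → ℝ} (hK : OddK K) : ∃ C : ℝ, 0 < C ∧ ∀ w, |psiK K w| ≤ C := by
  obtain ⟨C, hC, h⟩ := hK.bd
  refine ⟨C, hC, fun w => ?_⟩
  unfold psiK
  split_ifs with hw
  · refine le_trans ?_ (h w)
    exact le_mul_of_one_le_right (abs_nonneg _) (one_le_pow₀ hw.1)
  · simpa using hC.le

lemma integrable_bdd_supp {f : V × ℝ → ℝ} (hf : Measurable f) {B R R' : ℝ} (hb : ∀ q, |f q| ≤ B)
    (hs : ∀ q, f q ≠ 0 → ‖q.1‖ ≤ R ∧ |q.2| ≤ R') :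
    Integrable f ((volume : Measure V).prod (volume : Measure ℝ)) := by
  have : Integrable ((closedBall (0:V) R ×ˢ closedBall (0:ℝ) R').indicator (fun _ => B))
      ((volume : Measure V).prod (volume : Measure ℝ)) := by
    rw [integrable_indicator_iff (measurableSet_closedBall.prod measurableSet_closedBall)]
    refine integrableOn_const ?_
    rw [Measure.prod_prod]
    exact (ENNReal.mul_lt_top measure_closedBall_lt_top measure_closedBall_lt_top).ne
  refine this.mono' hf.aestronglyMeasurable (Eventually.of_forall fun q => ?_)
  by_cases hq : f q = 0
  · rw [hq, norm_zero]
    exact Set.indicator_nonneg (fun _ _ => (abs_nonneg _).trans (hb q)) _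
  · rw [Set.indicator_of_mem (by simpa using hs q hq)]
    exact hb q

lemma rot_formula {K : V → ℝ} (hK : OddK K) {g : V → ℝ} (hg : Nice g) (j : ℤ) (x : V) :
    ∫ y, K y * Lam j ‖y‖ * g (x - y) = ∫ w, psiK K w * dirH j w g x := by
  obtain ⟨hm, B, R, hB, hR, h1, h2⟩ := id hg
  obtain ⟨C, hC, hKb⟩ := hK.bd
  obtain ⟨C', hC', hpb⟩ := psiK_bd hK
  have hkm := measurable_ks j
  have hpm := measurable_psiK hK
  have hKm := hK.meas
  have supp : ∀ y, g (x - y) ≠ 0 → ‖y‖ ≤ R + ‖x‖ := by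
    intro y hy
    by_contra h
    apply hy
    apply h2
    have := norm_sub_norm_le y x
    rw [norm_sub_rev] at this
    linarith
  set f1 : V × ℝ → ℝ := fun q => psiK K q.1 * (ks j q.2 * g (x - q.2 • q.1)) with hf1
  have i1 : Integrable f1 ((volume : Measure V).prod volume) := by
    refine integrable_bdd_supp (B := C' * (((2:ℝ)^j)⁻¹ * B)) (R := 2) (R' := R + ‖x‖) (by rw [hf1]; fun_prop) ?_ ?_
    · intro q
      rw [hf1]; simp only [abs_mul]
      gcongr
      · exact hpb _
      · exact abs_ks_le j _
      · exact h1 _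
    · intro q hq
      simp only [hf1, mul_ne_zero_iff] at hq
      obtain ⟨a1, a2, a3⟩ := hq
      have hq1 : 1 ≤ ‖q.1‖ ∧ ‖q.1‖ ≤ 2 := by
        by_contra h; apply a1; simp [psiK, h]
      refine ⟨hq1.2, ?_⟩
      have := supp _ a3
      rw [norm_smul, Real.norm_eq_abs] at this
      exact (le_mul_of_one_le_right (abs_nonneg _) hq1.1).trans this
  set f2 : V × ℝ → ℝ := fun q => (if |q.2| ≤ ‖q.1‖ ∧ ‖q.1‖ ≤ 2 * |q.2| then |ks j q.2| else 0) * (K q.1 * g (x - q.1)) with hf2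
  have i2 : Integrable f2 ((volume : Measure V).prod volume) := by
    refine integrable_bdd_supp (B := ((2:ℝ)^j)⁻¹ * (C * (((2:ℝ)^j)^Module.finrank ℝ V)⁻¹ * B)) (R := R + ‖x‖) (R' := R + ‖x‖) ?_ ?_ ?_
    · rw [hf2]
      refine Measurable.mul (Measurable.ite ?_ (by fun_prop) measurable_const) (by fun_prop)
      have m1 : Measurable (fun q : V × ℝ => |q.2|) := by fun_prop
      have m2 : Measurable (fun q : V × ℝ => ‖q.1‖) := by fun_prop
      exact (measurableSet_le m1 m2).inter (measurableSet_le m2 (m1.const_mul 2))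
    · intro q
      rw [hf2]; simp only [abs_mul]
      by_cases hc : (|q.2| ≤ ‖q.1‖ ∧ ‖q.1‖ ≤ 2 * |q.2|) ∧ (2:ℝ)^j < |q.2|
      · rw [if_pos hc.1, abs_abs]
        gcongr
        · exact abs_ks_le j _
        · rw [← div_eq_mul_inv, le_div_iff₀ (by positivity)]
          refine le_trans ?_ (hKb q.1)
          gcongr
          linarith [hc.1.1, hc.2]
        · exact h1 _
      · have : (if |q.2| ≤ ‖q.1‖ ∧ ‖q.1‖ ≤ 2 * |q.2| then |ks j q.2| else 0) = 0 := by
          by_cases hc1 : (|q.2| ≤ ‖q.1‖ ∧ ‖q.1‖ ≤ 2 * |q.2|)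
          · rw [if_pos hc1]
            have : ¬ (2:ℝ)^j < |q.2| := fun h => hc ⟨hc1, h⟩
            simp [ks, this]
          · rw [if_neg hc1]
        rw [this]; simp; positivity
    · intro q hq
      simp only [hf2, mul_ne_zero_iff] at hq
      obtain ⟨a1, a2, a3⟩ := hq
      have := supp _ a3
      have hc : (|q.2| ≤ ‖q.1‖ ∧ ‖q.1‖ ≤ 2 * |q.2|) := by
        by_contra h; exact a1 (if_neg h)
      exact ⟨this, hc.1.trans this⟩
  have key : ∀ s : ℝ, ∫ w, f1 (w, s) = ∫ y, f2 (y, s) := by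
    intro s
    by_cases hs : (2:ℝ)^j < |s|
    swap
    · have : ks j s = 0 := by simp [ks, hs]
      simp [hf1, hf2, this]
    have hs0 : s ≠ 0 := by
      have : 0 < |s| := lt_trans (by positivity) hs
      exact abs_pos.1 this
    have hsp : 0 < |s| := abs_pos.2 hs0
    have e : (fun w => f1 (w, s)) = fun w => (fun y => psiK K (s⁻¹ • y) * (ks j s * g (x - y))) (s • w) := by
      funext w
      simp only [hf1]
      rw [inv_smul_smul₀ hs0]
    rw [e, Measure.integral_comp_smul volume (fun y => psiK K (s⁻¹ • y) * (ks j s * g (x - y))) s, ← integral_smul]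
    congr 1; funext y
    simp only [hf2, smul_eq_mul]
    have hn : ‖s⁻¹ • y‖ = ‖y‖ / |s| := by rw [norm_smul, norm_inv, Real.norm_eq_abs]; field_simp
    unfold psiK
    simp only [hn, one_le_div hsp, div_le_iff₀ hsp]
    split_ifs with hc
    · rw [hK.inv_smul hs0]
      have : ks j s = s⁻¹ := by simp [ks, hs]
      rw [this, abs_inv, abs_inv, abs_pow]
      have hsg : (SignType.sign s : ℝ) * s⁻¹ = |s|⁻¹ := by
        rcases lt_or_gt_of_ne hs0 with h | h
        · rw [sign_neg h, abs_of_neg h, inv_neg]; simp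
        · rw [sign_pos h, abs_of_pos h]; simp
      rw [← hsg]
      field_simp
    · simp
  calc ∫ y, K y * Lam j ‖y‖ * g (x - y) = ∫ y, ∫ s, f2 (y, s) := by
        congr 1; funext y
        simp only [hf2]
        rw [integral_mul_const]
        unfold Lam; ring
    _ = ∫ s, ∫ y, f2 (y, s) := integral_integral_swap i2
    _ = ∫ s, ∫ w, f1 (w, s) := by simp_rw [key]
    _ = ∫ w, ∫ s, f1 (w, s) := (integral_integral_swap i1).symm
    _ = _ := by
        congr 1; funext w
        simp only [hf1]
        rw [integral_const_mul]; rfl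

lemma rot_bound {K : V → ℝ} (hK : OddK K) {p : ℝ} (hp : 1 < p) : ∃ A : ℝ, 0 < A ∧ ∀ g : V → ℝ, Nice g →
    ∃ W : V → ℝ≥0∞, Measurable W ∧ (∀ j x, ENNReal.ofReal |∫ y, K y * Lam j ‖y‖ * g (x - y)| ≤ W x) ∧
    ∫⁻ x, W x ^ p ≤ ENNReal.ofReal A * ∫⁻ x, ENNReal.ofReal |g x| ^ p := by
  classical
  obtain ⟨A, hA, h⟩ := dir_bound (V := V) hp
  obtain ⟨C', hC', hpb⟩ := psiK_bd hK
  have hp0 : 0 < p := by linarith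
  have hpm := measurable_psiK hK
  -- total mass
  set D : Set V := closedBall (0:V) 2 with hD
  set v : ℝ := (volume D).toReal with hv
  have hvD : volume D = ENNReal.ofReal v := (ENNReal.ofReal_toReal measure_closedBall_lt_top.ne).symm
  refine ⟨C' ^ p * (v ^ (p-1) * (v * A)) + 1, by positivity, fun g hg => ?_⟩
  have hgm := hg.1
  set M : V → V → ℝ≥0∞ := fun x w => if w = 0 then 0 else ⨆ j : ℤ, ENNReal.ofReal |dirH j w g x| with hM
  have hMm : Measurable (Function.uncurry M) := by
    refine Measurable.ite ?_ measurable_const (Measurable.iSup fun j => ?_)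
    · exact measurable_snd (measurableSet_singleton 0)
    · have := measurable_dirH hgm j
      fun_prop
  set W : V → ℝ≥0∞ := fun x => ENNReal.ofReal C' * ∫⁻ w in D, M x w with hW
  have hWm : Measurable W := (hMm.lintegral_prod_right' (ν := volume.restrict D)).const_mul _
  refine ⟨W, hWm, fun j x => ?_, ?_⟩
  · rw [rot_formula hK hg]
    calc _ ≤ ∫⁻ w, ENNReal.ofReal |psiK K w * dirH j w g x| := by
          have := enorm_integral_le_lintegral_enorm (μ := volume) (fun w => psiK K w * dirH j w g x)
          simpa only [← ofReal_norm_eq_enorm, Real.norm_eq_abs] using this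
      _ ≤ ∫⁻ w, D.indicator (fun w => ENNReal.ofReal C' * M x w) w := by
          refine lintegral_mono fun w => ?_
          by_cases hw : 1 ≤ ‖w‖ ∧ ‖w‖ ≤ 2
          · have hw0 : w ≠ 0 := by rintro rfl; simp at hw; linarith
            rw [Set.indicator_of_mem (by simpa [hD] using hw.2), abs_mul, ENNReal.ofReal_mul (abs_nonneg _)]
            gcongr
            · exact hpb w
            · simp only [hM, if_neg hw0]
              exact le_iSup (fun j : ℤ => ENNReal.ofReal |dirH j w g x|) j
          · simp [psiK, hw]
      _ = W x := by
          rw [lintegral_indicator measurableSet_closedBall, lintegral_const_mul' _ _ ENNReal.ofReal_ne_top]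
  · have hol : ∀ x, (∫⁻ w in D, M x w) ^ p ≤ ENNReal.ofReal (v ^ (p-1)) * ∫⁻ w in D, M x w ^ p := by
      intro x
      have hpq : p.HolderConjugate (p/(p-1)) := Real.HolderConjugate.conjExponent hp
      have hMx : Measurable (M x) := hMm.comp (measurable_const.prodMk measurable_id)
      have := ENNReal.lintegral_mul_le_Lp_mul_Lq (volume.restrict D) hpq hMx.aemeasurable (aemeasurable_const (b := (1:ℝ≥0∞)))
      simp only [Pi.mul_apply, mul_one, ENNReal.one_rpow, lintegral_const, one_mul, Measure.restrict_apply_univ] at this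
      have h2 := ENNReal.rpow_le_rpow this hp0.le
      refine h2.trans (le_of_eq ?_)
      rw [ENNReal.mul_rpow_of_nonneg _ _ hp0.le, ← ENNReal.rpow_mul, ← ENNReal.rpow_mul,
        one_div_mul_cancel hp0.ne', ENNReal.rpow_one, hvD, ENNReal.ofReal_rpow_of_nonneg ENNReal.toReal_nonneg (by
          have : 0 < p - 1 := by linarith
          positivity), mul_comm]
      congr 3
      have : p - 1 ≠ 0 := by linarith
      field_simp
    calc ∫⁻ x, W x ^ p ≤ ∫⁻ x, ENNReal.ofReal (C' ^ p * v ^ (p-1)) * ∫⁻ w in D, M x w ^ p := by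
          refine lintegral_mono fun x => ?_
          simp only [hW]
          rw [ENNReal.mul_rpow_of_nonneg _ _ hp0.le, ENNReal.ofReal_rpow_of_nonneg hC'.le hp0.le, ENNReal.ofReal_mul (by positivity), mul_assoc]
          gcongr
          exact hol x
      _ = ENNReal.ofReal (C' ^ p * v ^ (p-1)) * ∫⁻ w in D, ∫⁻ x, M x w ^ p := by
          rw [lintegral_const_mul' _ _ ENNReal.ofReal_ne_top, lintegral_lintegral_swap]
          exact (hMm.pow_const p).aemeasurable
      _ ≤ ENNReal.ofReal (C' ^ p * v ^ (p-1)) * ∫⁻ w in D, ENNReal.ofReal A * ∫⁻ x, ENNReal.ofReal |g x| ^ p := by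
          gcongr with w
          by_cases hw : w = 0
          · simp [hM, hw, hp0]
          · simp only [hM, if_neg hw]
            exact h g hg w hw
      _ = ENNReal.ofReal (C' ^ p * (v ^ (p-1) * (v * A))) * ∫⁻ x, ENNReal.ofReal |g x| ^ p := by
          rw [setLIntegral_const, hvD]
          have hv0 : 0 ≤ v := ENNReal.toReal_nonneg
          rw [← mul_assoc (C'^p), ENNReal.ofReal_mul (p := C' ^ p * v ^ (p-1)) (by positivity), ENNReal.ofReal_mul hv0]
          ring
      _ ≤ _ := by gcongr; linarith

end Rot2


/-- limiting value of the radial profile -/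
def LamInf : ℝ := ∫ s : ℝ, if |s| ≤ 1 ∧ 1 ≤ 2 * |s| then |s|⁻¹ else 0

lemma mset_shell (r : ℝ) : MeasurableSet {s : ℝ | |s| ≤ r ∧ r ≤ 2 * |s|} := by
  have m1 : Measurable (fun s : ℝ => |s|) := by fun_prop
  exact (measurableSet_le m1 measurable_const).inter (measurableSet_le measurable_const (m1.const_mul 2))

lemma shell_int {r : ℝ} (hr : 0 < r) :
    Integrable (fun s : ℝ => if |s| ≤ r ∧ r ≤ 2 * |s| then |s|⁻¹ else 0) := by
  have : Integrable ((closedBall (0:ℝ) r).indicator (fun _ => 2 / r)) volume := by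
    rw [integrable_indicator_iff measurableSet_closedBall]
    exact integrableOn_const measure_closedBall_lt_top.ne
  refine this.mono' (Measurable.aestronglyMeasurable ?_) (Eventually.of_forall fun s => ?_)
  · exact Measurable.ite (mset_shell r) (by fun_prop) measurable_const
  · by_cases h : |s| ≤ r ∧ r ≤ 2 * |s|
    · have hs : 0 < |s| := by linarith [h.2]
      rw [if_pos h, Set.indicator_of_mem (by simpa using h.1), norm_inv, norm_abs_eq_norm, norm_eq_abs,
        inv_le_comm₀ hs (by positivity), inv_div]
      linarith [h.2]
    · rw [if_neg h, norm_zero]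
      exact Set.indicator_nonneg (fun _ _ => by positivity) _

lemma shell_eq {r : ℝ} (hr : 0 < r) :
    ∫ s : ℝ, (if |s| ≤ r ∧ r ≤ 2 * |s| then |s|⁻¹ else 0) = LamInf := by
  have := Measure.integral_comp_mul_left (fun s : ℝ => if |s| ≤ r ∧ r ≤ 2 * |s| then |s|⁻¹ else 0) r
  rw [abs_of_pos (inv_pos.2 hr), smul_eq_mul, inv_mul_eq_div, eq_div_iff hr.ne'] at this
  rw [← this, ← integral_mul_const]
  unfold LamInf
  congr 1; funext s
  have e1 : |r * s| ≤ r ↔ |s| ≤ 1 := by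
    rw [abs_mul, abs_of_pos hr]; exact mul_le_iff_le_one_right hr
  have e2 : r ≤ 2 * |r * s| ↔ 1 ≤ 2 * |s| := by
    rw [abs_mul, abs_of_pos hr]
    constructor
    · intro h; by_contra h'; nlinarith
    · intro h; nlinarith
  simp only [e1, e2]
  split_ifs
  · rw [abs_mul, abs_of_pos hr]; field_simp
  · simp

lemma LamInf_pos : 0 < LamInf := by
  have h1 : (1/2 : ℝ) ≤ LamInf := by
    have e : ∫ s : ℝ, (Set.Icc (1/2:ℝ) 1).indicator (fun _ => (1:ℝ)) s = 1/2 := by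
      rw [integral_indicator measurableSet_Icc]; simp; norm_num
    rw [← e]
    refine integral_mono ?_ (shell_int one_pos) fun s => ?_
    · rw [integrable_indicator_iff measurableSet_Icc]
      exact integrableOn_const measure_Icc_lt_top.ne
    · by_cases hs : s ∈ Set.Icc (1/2:ℝ) 1
      · have : 0 < s := by linarith [hs.1]
        rw [Set.indicator_of_mem hs, abs_of_pos this, if_pos ⟨hs.2, by linarith [hs.1]⟩]
        exact (one_le_inv₀ this).2 hs.2
      · rw [Set.indicator_of_notMem hs]
        dsimp only
        split_ifs <;> positivity
  linarith

lemma Lam_eq {j : ℤ} {r : ℝ} (hr : 2 * (2:ℝ)^j < r) : Lam j r = LamInf := by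
  have h2 : (0:ℝ) < 2^j := by positivity
  rw [← shell_eq (r := r) (by linarith)]
  unfold Lam
  congr 1; funext s
  split_ifs with h
  · rw [ks, if_pos (by linarith [h.2]), abs_inv]
  · rfl

lemma Lam_zero {j : ℤ} {r : ℝ} (hr : r ≤ (2:ℝ)^j) : Lam j r = 0 := by
  unfold Lam
  refine integral_eq_zero_of_ae (Eventually.of_forall fun s => ?_)
  simp only [Pi.zero_apply]
  split_ifs with h
  · rw [ks, if_neg (by linarith [h.1]), abs_zero]
  · rfl

lemma Lam_nonneg (j : ℤ) (r : ℝ) : 0 ≤ Lam j r :=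
  integral_nonneg fun s => by dsimp only; split_ifs <;> simp

lemma Lam_le (j : ℤ) {r : ℝ} (hr : 0 < r) : Lam j r ≤ LamInf := by
  rw [← shell_eq hr]
  refine integral_mono_of_nonneg (Eventually.of_forall fun s => by dsimp only; split_ifs <;> simp)
    (shell_int hr) (Eventually.of_forall fun s => ?_)
  dsimp only
  split_ifs
  · unfold ks
    split_ifs
    · rw [abs_inv]
    · simp
  · rfl

lemma measurable_Lam (j : ℤ) : Measurable (Lam j) := by
  have m1 : Measurable (fun q : ℝ × ℝ => |q.2|) := by fun_prop
  have m2 := measurable_ks j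
  have : Measurable (fun q : ℝ × ℝ => if |q.2| ≤ q.1 ∧ q.1 ≤ 2 * |q.2| then |ks j q.2| else 0) := by
    refine Measurable.ite ?_ (by fun_prop) measurable_const
    exact (measurableSet_le m1 measurable_fst).inter (measurableSet_le measurable_fst (m1.const_mul 2))
  exact (this.stronglyMeasurable.integral_prod_right' (ν := volume)).measurable

section NT
variable {V : Type*} [NormedAddCommGroup V] [InnerProductSpace ℝ V] [FiniteDimensional ℝ V]
  [MeasurableSpace V] [BorelSpace V]

lemma KLam_bd {K : V → ℝ} {C : ℝ} (hC : 0 < C) (hK : ∀ y, |K y| * ‖y‖ ^ (Module.finrank ℝ V) ≤ C) (j : ℤ) (y : V) :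
    |LamInf⁻¹ * (K y * Lam j ‖y‖)| ≤ C * (((2:ℝ)^j) ^ (Module.finrank ℝ V))⁻¹ := by
  have h2 : (0:ℝ) < 2^j := by positivity
  by_cases h : ‖y‖ ≤ (2:ℝ)^j
  · rw [Lam_zero h]; simp; positivity
  · push Not at h
    have hy : 0 < ‖y‖ := h2.trans h
    have hL := LamInf_pos
    rw [abs_mul, abs_mul, abs_of_pos (inv_pos.2 hL), abs_of_nonneg (Lam_nonneg _ _)]
    calc _ ≤ LamInf⁻¹ * (|K y| * LamInf) := by gcongr; exact Lam_le j hy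
      _ = |K y| := by field_simp
      _ ≤ C * (‖y‖ ^ (Module.finrank ℝ V))⁻¹ := by
        rw [← div_eq_mul_inv, le_div_iff₀ (by positivity)]; exact hK y
      _ ≤ _ := by gcongr

lemma N1 {K : V → ℝ} (hK : OddK K) {p : ℝ} (hp : 1 < p) {κ C : ℝ} (hC : 0 < C) {F : V → ℝ → V → ℝ}
    (hFi : ∀ y t, 0 < t → ∀ g, Nice g → Integrable (fun z => F y t z * g z))
    (hF : ∀ (j : ℤ) x y t z, (2:ℝ)^j ≤ t → t < 2^(j+1) → dist x y < κ * t →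
      |F y t z - LamInf⁻¹ * (K (x - z) * Lam j ‖x - z‖)| ≤ C * wt (Module.finrank ℝ V) (2^j) ‖x - z‖) :
    ∃ A : ℝ, 0 < A ∧ ∀ g : V → ℝ, Nice g → ∃ W : V → ℝ≥0∞, Measurable W ∧
      (∀ x y t, 0 < t → dist x y < κ * t → ENNReal.ofReal |∫ z, F y t z * g z| ≤ W x) ∧
      ∫⁻ x, W x ^ p ≤ ENNReal.ofReal A * ∫⁻ x, ENNReal.ofReal |g x| ^ p := by
  obtain ⟨A1, hA1, h1⟩ := rot_bound hK hp
  obtain ⟨A2, hA2, h2⟩ := MF_strong (volume : Measure V) p hp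
  obtain ⟨CK, hCK, hKb⟩ := hK.bd
  have hp0 : 0 < p := by linarith
  have hL := LamInf_pos
  set m := Module.finrank ℝ V with hm
  obtain ⟨c, hc, hceq⟩ : ∃ c : ℝ, 0 ≤ c ∧ ENNReal.ofReal c = ENNReal.ofReal C * (ENNReal.ofReal (2 ^ (m + 2)) * volume (ball (0:V) 1)) := by
    refine ⟨_, ENNReal.toReal_nonneg, ENNReal.ofReal_toReal ?_⟩
    exact ENNReal.mul_ne_top ENNReal.ofReal_ne_top (ENNReal.mul_ne_top ENNReal.ofReal_ne_top measure_ball_lt_top.ne)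
  refine ⟨2^(p-1) * (LamInf⁻¹ ^ p * A1 + c ^ p * A2), by positivity, fun g hg => ?_⟩
  obtain ⟨W, hWm, hW, hWp⟩ := h1 g hg
  have hgm := hg.1
  have hKm := hK.meas
  have hhm : Measurable (fun x => ENNReal.ofReal |g x|) := by fun_prop
  set M := MF volume (fun x => ENNReal.ofReal |g x|) with hM
  have hMm : Measurable M := measurable_MF volume hhm
  refine ⟨fun x => ENNReal.ofReal LamInf⁻¹ * W x + ENNReal.ofReal c * M x, by fun_prop, ?_, ?_⟩
  · intro x y t ht hd
    obtain ⟨j, hj1, hj2⟩ := exists_mem_Ico_zpow (y := (2:ℝ)) ht one_lt_two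
    have hLm := measurable_Lam j
    have i1 := hFi y t ht g hg
    have i2 : Integrable (fun z => LamInf⁻¹ * (K (x - z) * Lam j ‖x - z‖) * g z) := by
      refine Integrable.bdd_mul (c := CK * (((2:ℝ)^j)^m)⁻¹) (hg.integrable volume) ?_ ?_
      · refine Measurable.aestronglyMeasurable ?_
        fun_prop
      · exact Eventually.of_forall fun z => KLam_bd hCK hKb j (x - z)
    have e2 : ∫ z, LamInf⁻¹ * (K (x - z) * Lam j ‖x - z‖) * g z = LamInf⁻¹ * ∫ y, K y * Lam j ‖y‖ * g (x - y) := by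
      rw [← integral_sub_left_eq_self (fun y => K y * Lam j ‖y‖ * g (x - y)) volume x, ← integral_const_mul]
      congr 1; funext z
      rw [sub_sub_cancel]; ring
    have e3 : ∫ z, F y t z * g z = LamInf⁻¹ * (∫ y, K y * Lam j ‖y‖ * g (x - y)) +
        ∫ z, (F y t z - LamInf⁻¹ * (K (x - z) * Lam j ‖x - z‖)) * g z := by
      rw [← e2, ← integral_add i2]
      · congr 1; funext z; ring
      · refine (i1.sub i2).congr (Eventually.of_forall fun z => ?_)
        simp only [Pi.sub_apply]; ring
    rw [e3]
    refine (ENNReal.ofReal_le_ofReal (abs_add_le _ _)).trans ?_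
    rw [ENNReal.ofReal_add (abs_nonneg _) (abs_nonneg _), abs_mul, abs_of_pos (inv_pos.2 hL), ENNReal.ofReal_mul (by positivity)]
    refine add_le_add (by gcongr; exact hW j x) ?_
    calc _ ≤ ∫⁻ z, ENNReal.ofReal |(F y t z - LamInf⁻¹ * (K (x - z) * Lam j ‖x - z‖)) * g z| := by
          have := enorm_integral_le_lintegral_enorm (μ := volume) (fun z => (F y t z - LamInf⁻¹ * (K (x - z) * Lam j ‖x - z‖)) * g z)
          simpa only [← ofReal_norm_eq_enorm, Real.norm_eq_abs] using this
      _ ≤ ∫⁻ z, ENNReal.ofReal C * (ENNReal.ofReal (wt m (2^j) ‖x - z‖) * ENNReal.ofReal |g z|) := by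
          refine lintegral_mono fun z => ?_
          rw [abs_mul, ENNReal.ofReal_mul (abs_nonneg _), ← mul_assoc (ENNReal.ofReal C), ← ENNReal.ofReal_mul hC.le]
          gcongr
          exact hF j x y t z hj1 hj2 hd
      _ ≤ ENNReal.ofReal C * (ENNReal.ofReal (2 ^ (m + 2)) * volume (ball (0:V) 1) * M x) := by
          rw [lintegral_const_mul' _ _ ENNReal.ofReal_ne_top]
          gcongr
          exact wt_MF volume _ hhm x j
      _ = _ := by rw [hceq]; ring
  · calc _ ≤ ∫⁻ x, (2:ℝ≥0∞)^(p-1) * ((ENNReal.ofReal LamInf⁻¹ * W x)^p + (ENNReal.ofReal c * M x)^p) := by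
          gcongr with x
          exact ENNReal.rpow_add_le_mul_rpow_add_rpow _ _ hp.le
      _ = (2:ℝ≥0∞)^(p-1) * (ENNReal.ofReal (LamInf⁻¹^p) * (∫⁻ x, W x ^ p) + ENNReal.ofReal (c^p) * ∫⁻ x, M x ^ p) := by
          simp only [ENNReal.mul_rpow_of_nonneg _ _ hp0.le, ENNReal.ofReal_rpow_of_nonneg (inv_pos.2 hL).le hp0.le, ENNReal.ofReal_rpow_of_nonneg hc hp0.le]
          rw [lintegral_const_mul _ (by fun_prop), lintegral_add_left (by fun_prop), lintegral_const_mul _ (by fun_prop), lintegral_const_mul _ (by fun_prop)]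
      _ ≤ (2:ℝ≥0∞)^(p-1) * (ENNReal.ofReal (LamInf⁻¹^p) * (ENNReal.ofReal A1 * ∫⁻ x, ENNReal.ofReal |g x| ^ p) + ENNReal.ofReal (c^p) * (ENNReal.ofReal A2 * ∫⁻ x, ENNReal.ofReal |g x| ^ p)) := by
          gcongr
          exact h2 _ hhm
      _ = _ := by
          have e : (2:ℝ≥0∞)^(p-1) = ENNReal.ofReal (2^(p-1)) := by
            rw [← ENNReal.ofReal_rpow_of_pos two_pos, ENNReal.ofReal_ofNat]
          rw [e, ENNReal.ofReal_mul (by positivity), ENNReal.ofReal_add (by positivity) (by positivity),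
            ENNReal.ofReal_mul (by positivity), ENNReal.ofReal_mul (by positivity)]
          ring

end NT


section NT2
variable {V : Type*} [NormedAddCommGroup V] [InnerProductSpace ℝ V] [FiniteDimensional ℝ V]
  [MeasurableSpace V] [BorelSpace V]

lemma N2a {K : V → ℂ} (hK1 : OddK (fun y => (K y).re)) (hK2 : OddK (fun y => (K y).im))
    {p : ℝ} (hp : 1 < p) {κ C : ℝ} (hC : 0 < C) {F : V → ℝ → V → ℂ}
    (hFi : ∀ y t, 0 < t → ∀ g, Nice g → Integrable (fun z => F y t z * (g z : ℂ)))
    (hF : ∀ (j : ℤ) x y t z, (2:ℝ)^j ≤ t → t < 2^(j+1) → dist x y < κ * t →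
      ‖F y t z - (LamInf⁻¹ : ℝ) * (K (x - z) * (Lam j ‖x - z‖ : ℝ))‖ ≤ C * wt (Module.finrank ℝ V) (2^j) ‖x - z‖) :
    ∃ A : ℝ, 0 < A ∧ ∀ g : V → ℝ, Nice g → ∃ W : V → ℝ≥0∞, Measurable W ∧
      (∀ x y t, 0 < t → dist x y < κ * t → ‖∫ z, F y t z * (g z : ℂ)‖ₑ ≤ W x) ∧
      ∫⁻ x, W x ^ p ≤ ENNReal.ofReal A * ∫⁻ x, ENNReal.ofReal |g x| ^ p := by
  obtain ⟨A1, hA1, h1⟩ := N1 hK1 hp (κ := κ) hC (F := fun y t z => (F y t z).re)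
    (fun y t ht g hg => (hFi y t ht g hg).re.congr (Eventually.of_forall fun z => by simp))
    (fun j x y t z a b c => le_trans (by
      refine le_trans (le_of_eq ?_) (Complex.abs_re_le_norm _)
      simp) (hF j x y t z a b c))
  obtain ⟨A2, hA2, h2⟩ := N1 hK2 hp (κ := κ) hC (F := fun y t z => (F y t z).im)
    (fun y t ht g hg => (hFi y t ht g hg).im.congr (Eventually.of_forall fun z => by simp))
    (fun j x y t z a b c => le_trans (by
      refine le_trans (le_of_eq ?_) (Complex.abs_im_le_norm _)
      simp) (hF j x y t z a b c))
  refine ⟨2^(p-1) * (A1 + A2), by positivity, fun g hg => ?_⟩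
  obtain ⟨W1, m1, b1, i1⟩ := h1 g hg
  obtain ⟨W2, m2, b2, i2⟩ := h2 g hg
  refine ⟨fun x => W1 x + W2 x, m1.add m2, fun x y t ht hd => ?_, ?_⟩
  · refine le_trans ?_ (add_le_add (b1 x y t ht hd) (b2 x y t ht hd))
    rw [← ENNReal.ofReal_add (abs_nonneg _) (abs_nonneg _), ← ofReal_norm_eq_enorm]
    refine ENNReal.ofReal_le_ofReal ((Complex.norm_le_abs_re_add_abs_im _).trans (le_of_eq ?_))
    have e1 := integral_re (hFi y t ht g hg)
    have e2 := integral_im (hFi y t ht g hg)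
    simp only [RCLike.re_eq_complex_re, RCLike.im_eq_complex_im] at e1 e2
    rw [← e1, ← e2]
    simp
  · calc _ ≤ ∫⁻ x, (2:ℝ≥0∞)^(p-1) * (W1 x ^ p + W2 x ^ p) := by
          gcongr with x
          exact ENNReal.rpow_add_le_mul_rpow_add_rpow _ _ hp.le
      _ = (2:ℝ≥0∞)^(p-1) * ((∫⁻ x, W1 x ^ p) + ∫⁻ x, W2 x ^ p) := by
          rw [lintegral_const_mul _ (by fun_prop), lintegral_add_left (by fun_prop)]
      _ ≤ (2:ℝ≥0∞)^(p-1) * (ENNReal.ofReal A1 * (∫⁻ x, ENNReal.ofReal |g x| ^ p) + ENNReal.ofReal A2 * ∫⁻ x, ENNReal.ofReal |g x| ^ p) := by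
          gcongr
      _ = _ := by
          have e : (2:ℝ≥0∞)^(p-1) = ENNReal.ofReal (2^(p-1)) := by
            rw [← ENNReal.ofReal_rpow_of_pos two_pos, ENNReal.ofReal_ofNat]
          rw [e, ENNReal.ofReal_mul (by positivity), ENNReal.ofReal_add (by positivity) (by positivity)]
          ring

/-- truncation -/
def trunc (h : V → ℂ) (N : ℕ) (z : V) : ℂ := if ‖h z‖ ≤ N ∧ ‖z‖ ≤ N then h z else 0

lemma measurable_trunc {h : V → ℂ} (hh : Measurable h) (N : ℕ) : Measurable (trunc h N) :=
  Measurable.ite ((measurableSet_le hh.norm measurable_const).inter (measurableSet_le measurable_norm measurable_const))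
    hh measurable_const

lemma norm_trunc_le (h : V → ℂ) (N : ℕ) (z : V) : ‖trunc h N z‖ ≤ ‖h z‖ := by
  unfold trunc; split_ifs <;> simp

lemma nice_trunc {h : V → ℂ} (hh : Measurable h) (N : ℕ) {r : ℂ → ℝ} (hr : Measurable r) (hr0 : r 0 = 0)
    (hrb : ∀ w, |r w| ≤ ‖w‖) :
    Nice (fun z => r (trunc h N z)) := by
  refine ⟨hr.comp (measurable_trunc hh N), N + 1, N + 1, by positivity, by positivity, fun y => ?_, fun y hy => ?_⟩
  · refine (hrb _).trans ?_
    unfold trunc; split_ifs with h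
    · linarith [h.1]
    · rw [norm_zero]; positivity
  · dsimp only
    rw [trunc, if_neg (fun h => by linarith [h.2]), hr0]

lemma N2 {K : V → ℂ} (hK1 : OddK (fun y => (K y).re)) (hK2 : OddK (fun y => (K y).im))
    {p : ℝ} (hp : 1 < p) {κ C : ℝ} (hC : 0 < C) {F : V → ℝ → V → ℂ}
    (hFm : ∀ y t, 0 < t → Measurable (F y t))
    (hFi : ∀ y t, 0 < t → ∀ h : V → ℂ, Measurable h → ∫⁻ z, ‖h z‖ₑ ^ p < ∞ → Integrable (fun z => F y t z * h z))
    (hF : ∀ (j : ℤ) x y t z, (2:ℝ)^j ≤ t → t < 2^(j+1) → dist x y < κ * t →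
      ‖F y t z - (LamInf⁻¹ : ℝ) * (K (x - z) * (Lam j ‖x - z‖ : ℝ))‖ ≤ C * wt (Module.finrank ℝ V) (2^j) ‖x - z‖) :
    ∃ A : ℝ, 0 < A ∧ ∀ h : V → ℂ, Measurable h → ∫⁻ z, ‖h z‖ₑ ^ p < ∞ → ∃ W : V → ℝ≥0∞, Measurable W ∧
      (∀ x y t, 0 < t → dist x y < κ * t → ‖∫ z, F y t z * h z‖ₑ ≤ W x) ∧
      ∫⁻ x, W x ^ p ≤ ENNReal.ofReal A * ∫⁻ x, ‖h x‖ₑ ^ p := by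
  have hp0 : 0 < p := by linarith
  have nice_lp : ∀ g : V → ℝ, Nice g → ∫⁻ z, ‖(g z : ℂ)‖ₑ ^ p < ∞ := by
    intro g hg
    obtain ⟨hm, B, R, hB, hR, hb, hs⟩ := hg
    calc _ ≤ ∫⁻ z, (closedBall (0:V) R).indicator (fun _ => ENNReal.ofReal B ^ p) z := by
          refine lintegral_mono fun z => ?_
          by_cases hz : z ∈ closedBall (0:V) R
          · rw [Set.indicator_of_mem hz, ← ofReal_norm_eq_enorm]
            gcongr
            simpa using hb z
          · rw [hs z (by simpa using hz)]; simp [hp0]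
      _ < ∞ := by
          rw [lintegral_indicator measurableSet_closedBall, setLIntegral_const]
          exact ENNReal.mul_lt_top (ENNReal.rpow_lt_top_of_nonneg hp0.le ENNReal.ofReal_ne_top) measure_closedBall_lt_top
  obtain ⟨A, hA, hN⟩ := N2a hK1 hK2 hp (κ := κ) hC
    (fun y t ht g hg => hFi y t ht (fun z => g z) (Complex.measurable_ofReal.comp hg.1) (nice_lp g hg)) hF
  refine ⟨2^(p-1) * (A + A), by positivity, fun h hh hhp => ?_⟩
  have hn1 := fun N => nice_trunc hh N Complex.measurable_re rfl Complex.abs_re_le_norm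
  have hn2 := fun N => nice_trunc hh N Complex.measurable_im rfl Complex.abs_im_le_norm
  choose W1 m1 b1 i1 using fun N => hN _ (hn1 N)
  choose W2 m2 b2 i2 using fun N => hN _ (hn2 N)
  have le_h : ∀ (r : ℂ → ℝ) (hr : ∀ w, |r w| ≤ ‖w‖) N, ∫⁻ x, ENNReal.ofReal |r (trunc h N x)| ^ p ≤ ∫⁻ x, ‖h x‖ₑ ^ p := by
    intro r hr N
    gcongr with x
    rw [← ofReal_norm_eq_enorm]
    exact ENNReal.ofReal_le_ofReal ((hr _).trans (norm_trunc_le _ _ _))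
  set Q : ℕ → V → ℝ≥0∞ := fun N x => (W1 N x + W2 N x) ^ p with hQ
  have hQm : ∀ N, Measurable (Q N) := fun N => ((m1 N).add (m2 N)).pow_const p
  have hQi : ∀ N, ∫⁻ x, Q N x ≤ ENNReal.ofReal (2^(p-1) * (A + A)) * ∫⁻ x, ‖h x‖ₑ ^ p := by
    intro N
    calc _ ≤ ∫⁻ x, (2:ℝ≥0∞)^(p-1) * (W1 N x ^ p + W2 N x ^ p) := by
          refine lintegral_mono fun x => ?_
          exact ENNReal.rpow_add_le_mul_rpow_add_rpow _ _ hp.le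
      _ = (2:ℝ≥0∞)^(p-1) * ((∫⁻ x, W1 N x ^ p) + ∫⁻ x, W2 N x ^ p) := by
          have := m1 N; have := m2 N
          rw [lintegral_const_mul _ (by fun_prop), lintegral_add_left (by fun_prop)]
      _ ≤ (2:ℝ≥0∞)^(p-1) * (ENNReal.ofReal A * (∫⁻ x, ‖h x‖ₑ ^ p) + ENNReal.ofReal A * ∫⁻ x, ‖h x‖ₑ ^ p) := by
          gcongr
          · exact (i1 N).trans (mul_le_mul_right (le_h _ Complex.abs_re_le_norm N) _)
          · exact (i2 N).trans (mul_le_mul_right (le_h _ Complex.abs_im_le_norm N) _)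
      _ = _ := by
          have e : (2:ℝ≥0∞)^(p-1) = ENNReal.ofReal (2^(p-1)) := by
            rw [← ENNReal.ofReal_rpow_of_pos two_pos, ENNReal.ofReal_ofNat]
          rw [e, ENNReal.ofReal_mul (by positivity), ENNReal.ofReal_add (by positivity) (by positivity)]
          ring
  refine ⟨fun x => (liminf (fun N => Q N x) atTop) ^ p⁻¹, (Measurable.liminf hQm).pow_const _, fun x y t ht hd => ?_, ?_⟩
  · rw [ENNReal.le_rpow_inv_iff hp0]
    have lim : Tendsto (fun N => ∫ z, F y t z * trunc h N z) atTop (𝓝 (∫ z, F y t z * h z)) := by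
      refine tendsto_integral_of_dominated_convergence (fun z => ‖F y t z * h z‖) (fun N => ?_) (hFi y t ht h hh hhp).norm (fun N => ?_) ?_
      · exact ((hFm y t ht).mul (measurable_trunc hh N)).aestronglyMeasurable
      · refine Eventually.of_forall fun z => ?_
        rw [norm_mul, norm_mul]; gcongr; exact norm_trunc_le _ _ _
      · refine Eventually.of_forall fun z => ?_
        refine tendsto_const_nhds.congr' ?_
        obtain ⟨N1, hN1⟩ := exists_nat_ge ‖h z‖
        obtain ⟨N2, hN2⟩ := exists_nat_ge ‖z‖
        filter_upwards [eventually_ge_atTop N1, eventually_ge_atTop N2] with N a b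
        rw [trunc, if_pos ⟨hN1.trans (by exact_mod_cast a), hN2.trans (by exact_mod_cast b)⟩]
    have lim2 : Tendsto (fun N => ‖∫ z, F y t z * trunc h N z‖ₑ ^ p) atTop (𝓝 (‖∫ z, F y t z * h z‖ₑ ^ p)) :=
      (ENNReal.continuous_rpow_const.tendsto _).comp ((continuous_enorm.tendsto _).comp lim)
    rw [← lim2.liminf_eq]
    refine liminf_le_liminf (Eventually.of_forall fun N => ?_)
    refine ENNReal.rpow_le_rpow ?_ hp0.le
    have e : ∫ z, F y t z * trunc h N z = (∫ z, F y t z * ((trunc h N z).re : ℂ)) + (∫ z, F y t z * ((trunc h N z).im : ℂ)) * Complex.I := by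
      rw [← integral_mul_const, ← integral_add]
      · congr 1; funext z
        conv_lhs => rw [← Complex.re_add_im (trunc h N z)]
        ring
      · exact hFi y t ht _ (Complex.measurable_ofReal.comp (hn1 N).1) (nice_lp _ (hn1 N))
      · exact (hFi y t ht _ (Complex.measurable_ofReal.comp (hn2 N).1) (nice_lp _ (hn2 N))).mul_const _
    rw [e]
    refine (enorm_add_le _ _).trans (add_le_add (b1 N x y t ht hd) ?_)
    refine le_trans (le_of_eq ?_) (b2 N x y t ht hd)
    rw [← ofReal_norm_eq_enorm, ← ofReal_norm_eq_enorm, norm_mul, Complex.norm_I, mul_one]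
  · simp only [← ENNReal.rpow_mul, inv_mul_cancel₀ hp0.ne', ENNReal.rpow_one]
    refine (lintegral_liminf_le hQm).trans ?_
    refine (liminf_le_liminf (Eventually.of_forall hQi)).trans ?_
    rw [liminf_const]

end NT2


abbrev RV (n : ℕ) := EuclideanSpace ℝ (Fin (n - 1))
abbrev RX (n : ℕ) := EuclideanSpace ℝ (Fin n)

section Coord
variable {n : ℕ}

lemma toUp_finUp (x' : RV n) (t : ℝ) (i : Fin (n-1)) : toUp x' t (finUp i) = x' i := by
  simp [toUp, finUp]

lemma toUp_last (hn : 0 < n) (x' : RV n) (t : ℝ) : toUp x' t (lastIdx n hn) = t := by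
  simp [toUp, lastIdx]

lemma xlast_eq (hn : 0 < n) (x : RX n) : xlast x = x (lastIdx n hn) := by
  simp [xlast, lastIdx, hn]

lemma xinit_apply (x : RX n) (i : Fin (n-1)) : xinit x i = x (finUp i) := rfl

lemma idx_cases (hn : 0 < n) (i : Fin n) : i = lastIdx n hn ∨ ∃ j : Fin (n-1), i = finUp j := by
  by_cases h : (i : ℕ) < n - 1
  · exact Or.inr ⟨⟨i, h⟩, rfl⟩
  · exact Or.inl (Fin.ext (by simp [lastIdx]; omega))

lemma ext_up (hn : 0 < n) {x y : RX n} (h1 : ∀ j : Fin (n-1), x (finUp j) = y (finUp j))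
    (h2 : x (lastIdx n hn) = y (lastIdx n hn)) : x = y := by
  ext i
  rcases idx_cases hn i with rfl | ⟨j, rfl⟩
  · exact h2
  · exact h1 j

lemma sum_up (hn : 0 < n) {M : Type*} [AddCommMonoid M] (φ : Fin n → M) :
    ∑ i, φ i = (∑ j : Fin (n-1), φ (finUp j)) + φ (lastIdx n hn) := by
  obtain ⟨m, rfl⟩ : ∃ m, n = m + 1 := ⟨n - 1, by omega⟩
  exact Fin.sum_univ_castSucc φ

lemma toUp_norm_sq (hn : 0 < n) (y : RV n) (t : ℝ) : ‖toUp y t‖ ^ 2 = ‖y‖ ^ 2 + t ^ 2 := by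
  rw [EuclideanSpace.norm_sq_eq, EuclideanSpace.norm_sq_eq, sum_up hn, toUp_last]
  simp [toUp_finUp]

lemma toUp_eta (hn : 0 < n) (x : RX n) : toUp (xinit x) (xlast x) = x :=
  ext_up hn (fun j => by rw [toUp_finUp]; rfl) (by rw [toUp_last, xlast_eq hn])

lemma xlast_toUp (hn : 0 < n) (y : RV n) (t : ℝ) : xlast (toUp y t) = t := by rw [xlast_eq hn, toUp_last]

lemma xinit_toUp (y : RV n) (t : ℝ) : xinit (toUp y t) = y := by
  ext j; rw [xinit_apply, toUp_finUp]

/-- embedding of the boundary -/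
def J (n : ℕ) : RV n →L[ℝ] RX n :=
  LinearMap.toContinuousLinearMap
    { toFun := fun y => toUp y 0
      map_add' := fun y z => by
        ext i; simp only [toUp, PiLp.add_apply]; simp only [WithLp.equiv_symm_apply]; split_ifs <;> simp
      map_smul' := fun c y => by
        ext i; simp only [toUp, PiLp.smul_apply]; simp only [WithLp.equiv_symm_apply]; simp }

lemma J_apply (y : RV n) : J n y = toUp y 0 := rfl

lemma toUp_sub_J (hn : 0 < n) (x : RX n) (y : RV n) : toUp (xinit x - y) (xlast x) = x - J n y :=
  ext_up hn (fun j => by rw [toUp_finUp, J_apply, PiLp.sub_apply, PiLp.sub_apply, toUp_finUp]; rfl)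
    (by rw [toUp_last, J_apply, PiLp.sub_apply, toUp_last, sub_zero, xlast_eq hn])

lemma J_single (hn : 0 < n) (j : Fin (n-1)) : J n (EuclideanSpace.single j 1) = EuclideanSpace.single (finUp j) 1 := by
  refine ext_up hn (fun i => ?_) ?_
  · rw [J_apply, toUp_finUp]
    simp [finUp, Fin.ext_iff, Pi.single_apply]
  · rw [J_apply, toUp_last]
    have : lastIdx n hn ≠ finUp j := by
      intro h; have := congrArg Fin.val h; simp [lastIdx, finUp] at this; omega
    simp [this]

lemma norm_J (hn : 0 < n) (y : RV n) : ‖J n y‖ = ‖y‖ := by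
  have := toUp_norm_sq hn y 0
  rw [J_apply]
  nlinarith [norm_nonneg (toUp y 0), norm_nonneg y, sq_nonneg (‖toUp y 0‖ - ‖y‖)]

lemma xlast_sub_J (hn : 0 < n) (x : RX n) (y : RV n) : xlast (x - J n y) = xlast x := by
  rw [← toUp_sub_J hn, xlast_toUp hn]

lemma abs_xlast_le (hn : 0 < n) (x : RX n) : |xlast x| ≤ ‖x‖ := by
  rw [xlast_eq hn]; exact PiLp.norm_apply_le x _

lemma xlast_sub (hn : 0 < n) (x z : RX n) : xlast (x - z) = xlast x - xlast z := by
  simp only [xlast_eq hn]; rfl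

lemma sub_J_ne (hn : 0 < n) {x : RX n} (hx : 0 < xlast x) (y : RV n) : x - J n y ≠ 0 := by
  intro h
  have := xlast_sub_J hn x y
  rw [h, xlast_eq hn] at this
  simp at this; linarith

lemma continuous_xlast (hn : 0 < n) : Continuous (xlast : RX n → ℝ) := by
  have : (xlast : RX n → ℝ) = fun x => x (lastIdx n hn) := funext (xlast_eq hn)
  rw [this]; fun_prop

lemma isOpen_uhs (hn : 0 < n) : IsOpen (upperHalfSpace n) :=
  isOpen_lt continuous_const (continuous_xlast hn)

lemma finrank_RV : Module.finrank ℝ (RV n) = n - 1 := by simp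

end Coord

section Hom
variable {n : ℕ} {F : Type*} [NormedAddCommGroup F] [NormedSpace ℝ F]

/-- smooth off zero, homogeneous of degree `-a` -/
structure HomK (a : ℕ) (G : RX n → F) : Prop where
  smooth : ContDiffOn ℝ (⊤ : ℕ∞) G {0}ᶜ
  hom : ∀ (s : ℝ) (x : RX n), 0 < s → x ≠ 0 → G (s • x) = (s ^ a)⁻¹ • G x

lemma HomK.at {a : ℕ} {G : RX n → F} (h : HomK a G) {x : RX n} (hx : x ≠ 0) : ContDiffAt ℝ (⊤ : ℕ∞) G x :=
  h.smooth.contDiffAt (isOpen_compl_singleton.mem_nhds hx)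

lemma HomK.diff {a : ℕ} {G : RX n → F} (h : HomK a G) {x : RX n} (hx : x ≠ 0) : DifferentiableAt ℝ G x :=
  (h.at hx).differentiableAt (by simp)

lemma HomK.congr {a : ℕ} {G H : RX n → F} (h : HomK a G) (e : ∀ x, x ≠ 0 → G x = H x) : HomK a H :=
  ⟨h.smooth.congr fun x hx => (e x hx).symm, fun s x hs hx => by
    rw [← e _ (smul_ne_zero hs.ne' hx), ← e x hx, h.hom s x hs hx]⟩

lemma HomK.add {a : ℕ} {G H : RX n → F} (h : HomK a G) (h' : HomK a H) : HomK a (fun x => G x + H x) :=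
  ⟨h.smooth.add h'.smooth, fun s x hs hx => by simp only [h.hom s x hs hx, h'.hom s x hs hx, smul_add]⟩

lemma HomK.clm {a : ℕ} {G : RX n → F} {F' : Type*} [NormedAddCommGroup F'] [NormedSpace ℝ F'] (h : HomK a G)
    (L : F →L[ℝ] F') : HomK a (fun x => L (G x)) :=
  ⟨L.contDiff.comp_contDiffOn h.smooth, fun s x hs hx => by simp only [h.hom s x hs hx, map_smul]⟩

lemma HomK.fderiv {a : ℕ} {G : RX n → F} (h : HomK a G) : HomK (a+1) (_root_.fderiv ℝ G) := by
  refine ⟨h.smooth.fderiv_of_isOpen isOpen_compl_singleton (by simp), fun s x hs hx => ?_⟩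
  have hsx := smul_ne_zero hs.ne' hx
  have h1 : HasFDerivAt (fun y => G (s • y)) ((_root_.fderiv ℝ G (s • x)).comp (s • ContinuousLinearMap.id ℝ (RX n))) x := by
    have := (h.diff hsx).hasFDerivAt
    exact this.comp x ((hasFDerivAt_id x).const_smul s)
  have h2 : HasFDerivAt (fun y => G (s • y)) ((s^a)⁻¹ • _root_.fderiv ℝ G x) x := by
    refine ((h.diff hx).hasFDerivAt.const_smul ((s^a)⁻¹)).congr_of_eventuallyEq ?_
    filter_upwards [isOpen_compl_singleton.mem_nhds hx] with y hy
    exact h.hom s y hs hy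
  have := h1.unique h2
  rw [ContinuousLinearMap.comp_smul, ContinuousLinearMap.comp_id] at this
  rw [pow_succ, mul_inv_rev, mul_smul, ← this, inv_smul_smul₀ hs.ne']

lemma HomK.pd {a : ℕ} {G : RX n → F} (h : HomK a G) (i : Fin n) : HomK (a+1) (pd i G) :=
  h.fderiv.clm (ContinuousLinearMap.apply ℝ F (EuclideanSpace.single i 1))

lemma HomK.bound {a : ℕ} {G : RX n → F} (h : HomK a G) : ∃ C : ℝ, 0 < C ∧ ∀ x, x ≠ 0 → ‖G x‖ ≤ C * (‖x‖ ^ a)⁻¹ := by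
  have hc : IsCompact (sphere (0 : RX n) 1) := isCompact_sphere 0 1
  have hcont : ContinuousOn G (sphere (0 : RX n) 1) := h.smooth.continuousOn.mono fun x hx => by
    intro h0; simp at h0; simp [h0] at hx
  obtain ⟨C, hC⟩ := hc.exists_bound_of_continuousOn hcont
  refine ⟨|C| + 1, by positivity, fun x hx => ?_⟩
  have hx0 : 0 < ‖x‖ := norm_pos_iff.2 hx
  have hm : ‖x‖⁻¹ • x ∈ sphere (0 : RX n) 1 := by simp [norm_smul, hx0.ne']
  have := h.hom ‖x‖ (‖x‖⁻¹ • x) hx0 (by simp [hx])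
  rw [smul_inv_smul₀ hx0.ne'] at this
  rw [this, norm_smul, mul_comm, norm_inv, norm_pow, norm_norm]
  gcongr
  linarith [hC _ hm, le_abs_self C]

lemma pd_congr {G H : RX n → F} {x : RX n} (h : G =ᶠ[𝓝 x] H) (i : Fin n) : pd i G x = pd i H x := by
  unfold pd; rw [h.fderiv_eq]

lemma pd_comm {U : Set (RX n)} (hU : IsOpen U) {G : RX n → F} (h : ContDiffOn ℝ (⊤ : ℕ∞) G U) {x : RX n} (hx : x ∈ U)
    (i j : Fin n) : pd i (pd j G) x = pd j (pd i G) x := by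
  have hc : ContDiffAt ℝ (⊤ : ℕ∞) G x := h.contDiffAt (hU.mem_nhds hx)
  have hs : IsSymmSndFDerivAt ℝ G x := hc.isSymmSndFDerivAt (by simp only [minSmoothness_of_isRCLikeNormedField]; exact WithTop.coe_le_coe.2 (le_top : (2:ℕ∞) ≤ ⊤))
  have hd : DifferentiableAt ℝ (fderiv ℝ G) x := by
    have : ContDiffAt ℝ 1 (fderiv ℝ G) x := hc.fderiv_right (m := 1) (by exact WithTop.coe_le_coe.2 (le_top : (2:ℕ∞) ≤ ⊤))
    exact this.differentiableAt (by simp)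
  have key : ∀ i j : Fin n, pd i (pd j G) x = fderiv ℝ (fderiv ℝ G) x (EuclideanSpace.single i 1) (EuclideanSpace.single j 1) := by
    intro i j
    have := ((ContinuousLinearMap.apply ℝ F (EuclideanSpace.single j (1:ℝ))).hasFDerivAt.comp x hd.hasFDerivAt).fderiv
    change fderiv ℝ ((ContinuousLinearMap.apply ℝ F (EuclideanSpace.single j (1:ℝ))) ∘ (fderiv ℝ G)) x _ = _
    rw [this]; rfl
  rw [key, key, hs]

lemma mpd_zero (d : Fin 0 → Fin n) (u : RX n → F) (x : RX n) : mpd 0 d u x = u x := rfl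

lemma mpd_succ {U : Set (RX n)} (hU : IsOpen U) {u : RX n → F} (h : ContDiffOn ℝ (⊤ : ℕ∞) u U) {x : RX n} (hx : x ∈ U)
    (k : ℕ) (d : Fin (k+1) → Fin n) : mpd (k+1) d u x = pd (d 0) (mpd k (Fin.tail d) u) x := by
  have hc : ContDiffAt ℝ (⊤ : ℕ∞) u x := h.contDiffAt (hU.mem_nhds hx)
  have hd : DifferentiableAt ℝ (iteratedFDeriv ℝ k u) x :=
    (hc.of_le (show ((k+1 : ℕ) : WithTop ℕ∞) ≤ _ by exact_mod_cast le_top)).differentiableAt_iteratedFDeriv (by exact_mod_cast Nat.lt_succ_self k)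
  unfold mpd pd
  rw [iteratedFDeriv_succ_apply_left]
  have := ((ContinuousMultilinearMap.apply ℝ (fun _ : Fin k => RX n) F (fun i => EuclideanSpace.single (Fin.tail d i) (1:ℝ))).hasFDerivAt.comp x hd.hasFDerivAt).fderiv
  change _ = fderiv ℝ ((ContinuousMultilinearMap.apply ℝ (fun _ : Fin k => RX n) F (fun i => EuclideanSpace.single (Fin.tail d i) (1:ℝ))) ∘ (iteratedFDeriv ℝ k u)) x _
  rw [this]; rfl

end Hom


section Conv
variable {n : ℕ} {p : ℝ}

lemma HomK.dom {F : Type*} [NormedAddCommGroup F] [NormedSpace ℝ F] (hn : 0 < n) {a : ℕ} (ha : n - 1 ≤ a)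
    {G : RX n → F} (h : HomK a G) {x₀ : RX n} (hx₀ : 0 < xlast x₀) :
    ∃ C : ℝ, 0 < C ∧ ∀ x ∈ ball x₀ (xlast x₀ / 2), 0 < xlast x ∧ ∀ y : RV n,
      ‖G (x - J n y)‖ ≤ C * ((1 + ‖y‖) ^ (n-1))⁻¹ := by
  obtain ⟨C, hC, hb⟩ := h.bound
  set δ := xlast x₀ / 2 with hδ
  have hδ0 : 0 < δ := by positivity
  set L := 1 + (‖x₀‖ + δ + 1) / δ with hL
  have hL0 : 0 < L := by positivity
  refine ⟨C * (L ^ (n-1) * (δ ^ (a - (n-1)))⁻¹), by positivity, fun x hx => ?_⟩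
  have hx1 : δ ≤ xlast x := by
    have := abs_xlast_le hn (x - x₀)
    rw [xlast_sub hn] at this
    rw [mem_ball, dist_eq_norm] at hx
    have := neg_abs_le (xlast x - xlast x₀)
    linarith
  have hxp : 0 < xlast x := by linarith
  refine ⟨hxp, fun y => ?_⟩
  have hne := sub_J_ne hn hxp y
  have h1 : δ ≤ ‖x - J n y‖ := by
    have := abs_xlast_le hn (x - J n y)
    rw [xlast_sub_J hn, abs_of_pos hxp] at this
    linarith
  have h2 : 1 + ‖y‖ ≤ L * ‖x - J n y‖ := by
    have e1 : ‖y‖ - ‖x‖ ≤ ‖x - J n y‖ := by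
      rw [← norm_J hn y, norm_sub_rev]; exact norm_sub_norm_le _ _
    have e2 : ‖x‖ ≤ ‖x₀‖ + δ := by
      rw [mem_ball, dist_eq_norm] at hx
      have := norm_le_norm_add_norm_sub' x x₀
      linarith
    have e3 : ‖x₀‖ + δ + 1 ≤ (‖x₀‖ + δ + 1) / δ * ‖x - J n y‖ := by
      rw [div_mul_eq_mul_div, le_div_iff₀ hδ0]; gcongr
    rw [hL, add_mul]; linarith
  have hr : 0 < ‖x - J n y‖ := by linarith
  refine (hb _ hne).trans ?_
  rw [mul_assoc]
  gcongr
  have e : ‖x - J n y‖ ^ a = ‖x - J n y‖ ^ (n-1) * ‖x - J n y‖ ^ (a - (n-1)) := by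
    rw [← pow_add]; congr 1; omega
  rw [e, mul_inv]
  calc _ ≤ (L ^ (n-1) * ((1 + ‖y‖) ^ (n-1))⁻¹) * (δ ^ (a - (n-1)))⁻¹ := by
        gcongr
        rw [← div_eq_mul_inv, le_div_iff₀ (by positivity), inv_mul_eq_div, div_le_iff₀ (by positivity), ← mul_pow]
        gcongr
    _ = _ := by ring

lemma dec_int (hn : 2 ≤ n) (hp : 1 < p) {f : RV n → ℂ} (hf : MemLp f (ENNReal.ofReal p) volume) :
    Integrable (fun y => ((1 + ‖y‖) ^ (n-1))⁻¹ * ‖f y‖) := by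
  have hpq : p.HolderConjugate (p/(p-1)) := Real.HolderConjugate.conjExponent hp
  set q := p/(p-1) with hq
  have hq1 : 1 < q := hpq.symm.lt
  have hD : MemLp (fun y : RV n => ((1 + ‖y‖) ^ (n-1))⁻¹) (ENNReal.ofReal q) volume := by
    have hcont : Continuous (fun y : RV n => ((1 + ‖y‖) ^ (n-1))⁻¹) :=
      Continuous.inv₀ (by fun_prop) fun y => by positivity
    rw [← integrable_norm_rpow_iff hcont.aestronglyMeasurable (by simp; linarith) ENNReal.ofReal_ne_top,
      ENNReal.toReal_ofReal (by linarith)]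
    have h1 : (Module.finrank ℝ (RV n) : ℝ) < (n-1 : ℕ) * q := by
      rw [finrank_RV]
      have : (1:ℝ) ≤ (n-1 : ℕ) := by exact_mod_cast (by omega : 1 ≤ n - 1)
      nlinarith
    refine (integrable_one_add_norm h1).congr (Eventually.of_forall fun y => ?_)
    have hy : 0 < 1 + ‖y‖ := by positivity
    dsimp only
    rw [norm_inv, norm_pow, Real.norm_of_nonneg hy.le, Real.rpow_neg hy.le, Real.rpow_mul hy.le, Real.rpow_natCast,
      Real.inv_rpow (by positivity)]
  have : (ENNReal.ofReal q).HolderConjugate (ENNReal.ofReal p) := hpq.symm.ennrealOfReal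
  exact hD.integrable_mul hf.norm

/-- convolution with the kernel over the boundary -/
def convK (G : RX n → ℂ) (f : RV n → ℂ) (x : RX n) : ℂ := ∫ y, f y * G (x - J n y)

lemma HomK.cont_slice {F : Type*} [NormedAddCommGroup F] [NormedSpace ℝ F] (hn : 0 < n) {a : ℕ} {G : RX n → F}
    (h : HomK a G) {x : RX n} (hx : 0 < xlast x) : Continuous (fun y => G (x - J n y)) := by
  rw [continuous_iff_continuousAt]
  intro y
  exact ContinuousAt.comp (h.at (sub_J_ne hn hx y)).continuousAt (by fun_prop)

lemma convK_integrable (hn : 2 ≤ n) (hp : 1 < p) {a : ℕ} (ha : n - 1 ≤ a) {G : RX n → ℂ} (h : HomK a G)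
    {f : RV n → ℂ} (hf : MemLp f (ENNReal.ofReal p) volume) {x : RX n} (hx : 0 < xlast x) :
    Integrable (fun y => f y * G (x - J n y)) := by
  obtain ⟨C, hC, hb⟩ := h.dom (by omega) ha hx
  refine ((dec_int hn hp hf).const_mul C).mono' ?_ (Eventually.of_forall fun y => ?_)
  · exact hf.1.mul (h.cont_slice (by omega) hx).aestronglyMeasurable
  · rw [norm_mul]
    have := (hb x (mem_ball_self (by positivity))).2 y
    calc _ ≤ ‖f y‖ * (C * ((1 + ‖y‖) ^ (n-1))⁻¹) := by gcongr
      _ = _ := by ring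

lemma convK_hasFDerivAt (hn : 2 ≤ n) (hp : 1 < p) {a : ℕ} (ha : n - 1 ≤ a) {G : RX n → ℂ} (h : HomK a G)
    {f : RV n → ℂ} (hf : MemLp f (ENNReal.ofReal p) volume) {x : RX n} (hx : 0 < xlast x) :
    Integrable (fun y => f y • fderiv ℝ G (x - J n y)) ∧
    HasFDerivAt (convK G f) (∫ y, f y • fderiv ℝ G (x - J n y)) x := by
  have hn0 : 0 < n := by omega
  obtain ⟨C, hC, hb⟩ := h.fderiv.dom hn0 (ha.trans (Nat.le_succ a)) hx
  have hball := mem_ball_self (x := x) (half_pos hx)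
  have hpos : ∀ z ∈ ball x (xlast x / 2), 0 < xlast z := fun z hz => (hb z hz).1
  have bd : ∀ z ∈ ball x (xlast x / 2), ∀ y, ‖f y • fderiv ℝ G (z - J n y)‖ ≤ C * (((1 + ‖y‖) ^ (n-1))⁻¹ * ‖f y‖) := by
    intro z hz y
    rw [norm_smul]
    calc _ ≤ ‖f y‖ * (C * ((1 + ‖y‖) ^ (n-1))⁻¹) := by gcongr; exact (hb z hz).2 y
      _ = _ := by ring
  have hmeas : AEStronglyMeasurable (fun y => f y • fderiv ℝ G (x - J n y)) volume :=
    hf.1.smul (h.fderiv.cont_slice hn0 hx).aestronglyMeasurable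
  refine ⟨((dec_int hn hp hf).const_mul C).mono' hmeas (Eventually.of_forall fun y => bd x hball y), ?_⟩
  refine hasFDerivAt_integral_of_dominated_of_fderiv_le (F := fun z y => f y * G (z - J n y)) (F' := fun z y => f y • fderiv ℝ G (z - J n y))
    (bound := fun y => C * (((1 + ‖y‖) ^ (n-1))⁻¹ * ‖f y‖)) (ball_mem_nhds x (half_pos hx)) ?_
    (convK_integrable hn hp ha h hf hx) hmeas (Eventually.of_forall fun y z hz => bd z hz y) ((dec_int hn hp hf).const_mul C)
    (Eventually.of_forall fun y z hz => ?_)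
  · filter_upwards [ball_mem_nhds x (half_pos hx)] with z hz
    exact (convK_integrable hn hp ha h hf (hpos z hz)).1
  · have h1 := (h.diff (sub_J_ne hn0 (hpos z hz) y)).hasFDerivAt
    have h2 : HasFDerivAt (fun w => G (w - J n y)) (fderiv ℝ G (z - J n y)) z := by
      have := HasFDerivAt.comp z (f := fun w => w - J n y) h1 ((hasFDerivAt_id z).sub_const (J n y))
      rwa [ContinuousLinearMap.comp_id] at this
    exact h2.const_mul (f y)

lemma convK_pd (hn : 2 ≤ n) (hp : 1 < p) {a : ℕ} (ha : n - 1 ≤ a) {G : RX n → ℂ} (h : HomK a G)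
    {f : RV n → ℂ} (hf : MemLp f (ENNReal.ofReal p) volume) {x : RX n} (hx : 0 < xlast x) (i : Fin n) :
    pd i (convK G f) x = convK (pd i G) f x := by
  obtain ⟨hi, hd⟩ := convK_hasFDerivAt hn hp ha h hf hx
  unfold pd
  rw [hd.fderiv, ContinuousLinearMap.integral_apply hi]
  rfl

lemma fderiv_eq_sum (u : RX n → ℂ) (x : RX n) :
    fderiv ℝ u x = ∑ i, (ContinuousLinearMap.smulRightL ℝ (RX n) ℂ (EuclideanSpace.proj i : RX n →L[ℝ] ℝ)) (pd i u x) := by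
  ext v
  have hv : v = ∑ i, v i • EuclideanSpace.single i (1:ℝ) := by
    ext j; simp [Finset.sum_apply, Pi.single_apply]
  conv_lhs => rw [hv]
  simp [pd, map_sum]

lemma convK_smooth (hn : 2 ≤ n) (hp : 1 < p) {f : RV n → ℂ} (hf : MemLp f (ENNReal.ofReal p) volume) {a : ℕ} (ha : n - 1 ≤ a)
    {G : RX n → ℂ} (h : HomK a G) : ContDiffOn ℝ (⊤ : ℕ∞) (convK G f) (upperHalfSpace n) := by
  have hU := isOpen_uhs (n := n) (by omega)
  have key : ∀ k : ℕ, ∀ (a : ℕ), n - 1 ≤ a → ∀ G : RX n → ℂ, HomK a G → ContDiffOn ℝ (k : WithTop ℕ∞) (convK G f) (upperHalfSpace n) := by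
    intro k
    induction k with
    | zero =>
      intro a ha G h
      exact contDiffOn_zero.2 fun x hx => (convK_hasFDerivAt hn hp ha h hf hx).2.continuousAt.continuousWithinAt
    | succ k ih =>
      intro a ha G h
      push_cast
      rw [contDiffOn_succ_iff_fderiv_of_isOpen hU]
      refine ⟨fun x hx => (convK_hasFDerivAt hn hp ha h hf hx).2.differentiableAt.differentiableWithinAt, by simp, ?_⟩
      have : ContDiffOn ℝ (k : WithTop ℕ∞) (fun x => ∑ i, (ContinuousLinearMap.smulRightL ℝ (RX n) ℂ (EuclideanSpace.proj i : RX n →L[ℝ] ℝ)) (convK (pd i G) f x)) (upperHalfSpace n) := by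
        refine ContDiffOn.sum fun i _ => ?_
        exact ContinuousLinearMap.contDiff _ |>.comp_contDiffOn (ih (a+1) (ha.trans (Nat.le_succ a)) _ (h.pd i))
      refine this.congr fun x hx => ?_
      rw [fderiv_eq_sum]
      simp only [convK_pd hn hp ha h hf hx]
  exact contDiffOn_infty.2 fun k => key k a ha G h

end Conv


section NTB
variable {n : ℕ} {p : ℝ}

lemma memLp_iff' (hp : 1 < p) {h : RV n → ℂ} (hh : AEStronglyMeasurable h volume) :
    MemLp h (ENNReal.ofReal p) volume ↔ ∫⁻ z, ‖h z‖ₑ ^ p < ∞ := by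
  have h0 : ENNReal.ofReal p ≠ 0 := by simp; linarith
  have := eLpNorm_lt_top_iff_lintegral_rpow_enorm_lt_top (f := h) (μ := volume) h0 ENNReal.ofReal_ne_top
  rw [ENNReal.toReal_ofReal (by linarith)] at this
  rw [← this]
  exact ⟨fun h => h.2, fun h => ⟨hh, h⟩⟩

open Classical in
/-- boundary kernel -/
def bK (E : RX n → ℂ) (y : RV n) : ℂ := if y = 0 then 0 else E (J n y)

lemma J_ne (hn : 0 < n) {y : RV n} (hy : y ≠ 0) : J n y ≠ 0 := by
  rw [← norm_pos_iff, norm_J hn, norm_pos_iff]; exact hy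

lemma bK_odd (hn : 0 < n) {E : RX n → ℂ} (hE : HomK (n-1) E) (hodd : ∀ x, x ≠ 0 → E (-x) = - E x) (r : ℂ →L[ℝ] ℝ) :
    OddK (fun y : RV n => r (bK E y)) := by
  obtain ⟨C, hC, hb⟩ := hE.bound
  refine ⟨?_, fun s y hs => ?_, fun y => ?_, ⟨(‖r‖ + 1) * C, by positivity, fun y => ?_⟩⟩
  · refine r.continuous.measurable.comp (measurable_of_continuousOn_compl_singleton 0 ?_)
    have : ContinuousOn (fun y => E (J n y)) ({0}ᶜ : Set (RV n)) :=
      hE.smooth.continuousOn.comp (J n).continuous.continuousOn fun y hy => J_ne hn hy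
    exact this.congr fun y hy => if_neg hy
  · rw [finrank_RV]
    by_cases hy : y = 0
    · simp [bK, hy]
    · rw [bK, bK, if_neg (smul_ne_zero hs.ne' hy), if_neg hy, map_smul, hE.hom s _ hs (J_ne hn hy), map_smul, smul_eq_mul]
  · by_cases hy : y = 0
    · simp [bK, hy]
    · rw [bK, bK, if_neg (neg_ne_zero.2 hy), if_neg hy, map_neg, hodd _ (J_ne hn hy), map_neg]
  · rw [finrank_RV]
    by_cases hy : y = 0
    · simp [bK, hy]; positivity
    · have h1 := hb _ (J_ne hn hy)
      rw [norm_J hn] at h1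
      rw [bK, if_neg hy]
      have hy0 : 0 < ‖y‖ := norm_pos_iff.2 hy
      calc |r (E (J n y))| * ‖y‖ ^ (n-1) ≤ (‖r‖ * (C * (‖y‖ ^ (n-1))⁻¹)) * ‖y‖^(n-1) := by
            gcongr; exact (r.le_opNorm _).trans (by gcongr)
        _ = ‖r‖ * C := by field_simp
        _ ≤ _ := by nlinarith [norm_nonneg r]

lemma bK_compare (hn : 0 < n) {κ : ℝ} (hκ : 0 < κ) {E : RX n → ℂ} (hE : HomK (n-1) E) :
    ∃ C : ℝ, 0 < C ∧ ∀ (j : ℤ) (x y : RV n) (t : ℝ) (z : RV n), (2:ℝ)^j ≤ t → t < 2^(j+1) → dist x y < κ * t →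
      ‖E (toUp y t - J n z) - (LamInf⁻¹ : ℝ) * (bK E (x - z) * (Lam j ‖x - z‖ : ℝ))‖ ≤
        C * wt (Module.finrank ℝ (RV n)) (2^j) ‖x - z‖ := by
  obtain ⟨CE, hCE, hb⟩ := hE.bound
  obtain ⟨CD, hCD, hd⟩ := hE.fderiv.bound
  have hL := LamInf_pos
  set M := 4 * (κ + 1) with hM
  set C1 := 2 * CE * (1 + M) ^ (n - 1 + 1) with hC1
  set C2 := CD * 4 ^ (n-1+1) * (2 * (κ + 1)) with hC2
  have hC10 : 0 < C1 := by positivity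
  have hC20 : 0 < C2 := by positivity
  refine ⟨C1 + C2, by positivity, fun j x y t z h1 h2 hxy => ?_⟩
  rw [finrank_RV]
  set τ : ℝ := 2^j with hτ
  have hτ0 : 0 < τ := by positivity
  have h2' : t < 2 * τ := by rw [zpow_add_one₀ two_ne_zero] at h2; linarith
  have ht : 0 < t := by linarith
  set r := ‖x - z‖ with hr
  have hr0 : 0 ≤ r := norm_nonneg _
  set v := toUp y t - J n z with hv
  have hvt : t ≤ ‖v‖ := by
    have := abs_xlast_le hn v
    rwa [hv, xlast_sub_J hn, xlast_toUp hn, abs_of_pos ht] at this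
  have hv0 : v ≠ 0 := by rw [← norm_pos_iff]; linarith
  have hwt : 0 < wt (n-1) τ r := by unfold wt; positivity
  by_cases hc : r ≤ M * τ
  · have e1 : ‖E v‖ ≤ CE * (τ^(n-1))⁻¹ := (hb v hv0).trans (by gcongr; linarith)
    have e2 : ‖(LamInf⁻¹ : ℝ) * (bK E (x - z) * (Lam j r : ℝ))‖ ≤ CE * (τ^(n-1))⁻¹ := by
      have hK : ∀ y : RV n, |‖bK E y‖| * ‖y‖ ^ (Module.finrank ℝ (RV n)) ≤ CE := by
        intro y
        rw [finrank_RV, abs_norm]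
        by_cases hy : y = 0
        · simp [bK, hy]; positivity
        · have h1 := hb _ (J_ne hn hy)
          have hy0 : 0 < ‖y‖ := norm_pos_iff.2 hy
          rw [norm_J hn, ← div_eq_mul_inv, le_div_iff₀ (by positivity)] at h1
          rwa [bK, if_neg hy]
      have := KLam_bd (K := fun y => ‖bK E y‖) hCE hK j (x - z)
      rw [finrank_RV] at this
      refine le_trans (le_of_eq ?_) this
      simp [abs_mul, hr]
    have e3 : (τ^(n-1))⁻¹ ≤ (1 + M) ^ (n-1+1) * wt (n-1) τ r := by
      unfold wt
      calc (τ^(n-1))⁻¹ = (1 + M) ^ (n-1+1) * (τ / (τ + M * τ) ^ (n-1+1)) := by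
            rw [show τ + M * τ = (1 + M) * τ by ring, mul_pow]
            have : (0:ℝ) < 1 + M := by positivity
            field_simp
            exact pow_succ _ _
        _ ≤ _ := by gcongr
    calc _ ≤ ‖E v‖ + ‖(LamInf⁻¹ : ℝ) * (bK E (x - z) * (Lam j r : ℝ))‖ := norm_sub_le _ _
      _ ≤ 2 * CE * (τ^(n-1))⁻¹ := by linarith
      _ ≤ 2 * CE * ((1 + M) ^ (n-1+1) * wt (n-1) τ r) := by gcongr
      _ = C1 * wt (n-1) τ r := by rw [hC1]; ring
      _ ≤ _ := by gcongr; linarith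
  · push Not at hc
    have hrp : 0 < r := lt_trans (by positivity) hc
    have hxz : x - z ≠ 0 := norm_pos_iff.1 hrp
    rw [Lam_eq (by rw [← hτ]; nlinarith), bK, if_neg hxz]
    have e0 : ((LamInf⁻¹ : ℝ) : ℂ) * (E (J n (x - z)) * (LamInf : ℝ)) = E (J n (x-z)) := by
      have : (LamInf : ℂ) ≠ 0 := by exact_mod_cast hL.ne'
      push_cast
      field_simp
    rw [e0]
    set v0 := J n (x - z) with hv0'
    have hn0 : ‖v0‖ = r := norm_J hn _
    have hdiff : ‖v - v0‖ ≤ 2 * (κ + 1) * τ := by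
      have e : v - v0 = toUp (y - x) t := by
        have := toUp_sub_J hn (toUp y t) x
        rw [xinit_toUp, xlast_toUp hn] at this
        rw [this, hv, hv0', map_sub]; abel
      rw [e]
      have h3 := toUp_norm_sq hn (y - x) t
      have h4 : ‖toUp (y - x) t‖ ≤ ‖y - x‖ + t := by
        refine abs_le_of_sq_le_sq' ?_ (by positivity) |>.2
        nlinarith [norm_nonneg (y - x)]
      rw [dist_comm, dist_eq_norm] at hxy
      nlinarith
    have hw : ∀ w ∈ closedBall v0 (r/2), r/2 ≤ ‖w‖ := by
      intro w hw
      rw [mem_closedBall, dist_eq_norm] at hw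
      have := norm_sub_norm_le v0 w
      rw [norm_sub_rev] at this
      linarith
    have hw0 : ∀ w ∈ closedBall v0 (r/2), w ≠ 0 := fun w h => norm_pos_iff.1 (by linarith [hw w h])
    have mv := Convex.norm_image_sub_le_of_norm_fderiv_le (𝕜 := ℝ) (f := E) (C := CD * ((r/2)^(n-1+1))⁻¹) (s := closedBall v0 (r/2)) (x := v0) (y := v)
      (fun w h => hE.diff (hw0 w h)) (fun w h => (hd w (hw0 w h)).trans (by gcongr; exact hw w h)) (convex_closedBall _ _)
      (mem_closedBall_self (by positivity)) (by rw [mem_closedBall, dist_eq_norm]; nlinarith)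
    calc _ ≤ _ := mv
      _ ≤ CD * (4 ^ (n-1+1) * ((τ + r)^(n-1+1))⁻¹) * (2 * (κ + 1) * τ) := by
          gcongr
          rw [← div_eq_mul_inv, le_div_iff₀ (by positivity), inv_mul_eq_div, div_le_iff₀ (by positivity), ← mul_pow]
          gcongr
          nlinarith
      _ = C2 * wt (n-1) τ r := by rw [hC2, wt]; ring
      _ ≤ _ := by gcongr; linarith

lemma nt_base (hn : 2 ≤ n) (hp : 1 < p) {κ : ℝ} (hκ : 0 < κ) {E : RX n → ℂ} (hE : HomK (n-1) E)
    (hodd : ∀ x, x ≠ 0 → E (-x) = - E x) : ∃ A : ℝ, 0 < A ∧ ∀ h : RV n → ℂ, MemLp h (ENNReal.ofReal p) volume →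
      ∃ W : RV n → ℝ≥0∞, Measurable W ∧
      (∀ x y t, 0 < t → dist x y < κ * t → ‖convK E h (toUp y t)‖ₑ ≤ W x) ∧
      ∫⁻ x, W x ^ p ≤ ENNReal.ofReal A * ∫⁻ x, ‖h x‖ₑ ^ p := by
  have hn0 : 0 < n := by omega
  obtain ⟨C, hC, hcmp⟩ := bK_compare hn0 hκ hE
  have hl : ∀ (y : RV n) (t : ℝ), 0 < t → 0 < xlast (toUp y t) := fun y t ht => by rwa [xlast_toUp hn0]
  obtain ⟨A, hA, h1⟩ := N2 (bK_odd hn0 hE hodd Complex.reCLM) (bK_odd hn0 hE hodd Complex.imCLM) hp (κ := κ) hC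
    (F := fun y t z => E (toUp y t - J n z)) (fun y t ht => (hE.cont_slice hn0 (hl y t ht)).measurable)
    (fun y t ht h hm hi => by
      have := convK_integrable hn hp le_rfl hE ((memLp_iff' hp hm.aestronglyMeasurable).2 hi) (hl y t ht)
      simpa only [mul_comm] using this)
    hcmp
  refine ⟨A, hA, fun h hh => ?_⟩
  obtain ⟨h', hm, he⟩ : ∃ h' : RV n → ℂ, Measurable h' ∧ h =ᵐ[volume] h' :=
    ⟨hh.1.mk h, hh.1.stronglyMeasurable_mk.measurable, hh.1.ae_eq_mk⟩
  have hi : ∫⁻ x, ‖h x‖ₑ ^ p = ∫⁻ x, ‖h' x‖ₑ ^ p := lintegral_congr_ae (he.mono fun x hx => by simp only [hx])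
  obtain ⟨W, hW, hb, hWi⟩ := h1 h' hm (by rw [← hi]; exact (memLp_iff' hp hh.1).1 hh)
  refine ⟨W, hW, fun x y t ht hd => ?_, by rw [hi]; exact hWi⟩
  refine le_trans (le_of_eq ?_) (hb x y t ht hd)
  congr 1
  refine integral_congr_ae (he.mono fun z hz => ?_)
  simp only [hz, mul_comm]

end NTB


section IBP
variable {n : ℕ} {p : ℝ}

lemma ibp_gen {m : ℕ} {ψ : EuclideanSpace ℝ (Fin m) → ℝ} (hψ : ContDiff ℝ (⊤ : ℕ∞) ψ) {D : EuclideanSpace ℝ (Fin m) → ℝ} {j : Fin m}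
    (b0 : ∀ y, |ψ y| ≤ D y) (b1 : ∀ y, |fderiv ℝ ψ y (EuclideanSpace.single j 1)| ≤ D y) {f g : EuclideanSpace ℝ (Fin m) → ℂ}
    (hf : AEStronglyMeasurable f volume) (hg : AEStronglyMeasurable g volume)
    (fi : Integrable (fun y => D y * ‖f y‖)) (gi : Integrable (fun y => D y * ‖g y‖))
    (hw : IsWeakDeriv 1 (fun _ => j) f g) :
    ∫ y, (fderiv ℝ ψ y (EuclideanSpace.single j 1)) • f y = - ∫ y, ψ y • g y := by
  set e : EuclideanSpace ℝ (Fin m) := EuclideanSpace.single j 1 with he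
  let η : ContDiffBump (0 : EuclideanSpace ℝ (Fin m)) := ⟨1, 2, one_pos, one_lt_two⟩
  have hη : ContDiff ℝ (⊤ : ℕ∞) (η : EuclideanSpace ℝ (Fin m) → ℝ) := η.contDiff
  have hη1 : Continuous (fun y => fderiv ℝ η y e) := (hη.continuous_fderiv (by simp)).clm_apply continuous_const
  have hηc : HasCompactSupport (fun y => fderiv ℝ η y e) := η.hasCompactSupport.fderiv_apply ℝ e
  obtain ⟨B, hB⟩ := hη1.bounded_above_of_compact_support hηc
  have hB0 : 0 ≤ B := (norm_nonneg _).trans (hB 0)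
  set c : ℕ → ℝ := fun N => ((N:ℝ) + 1)⁻¹ with hc
  have hc0 : ∀ N, 0 < c N := fun N => by positivity
  have hc1 : ∀ N, c N ≤ 1 := fun N => inv_le_one_of_one_le₀ (by linarith [(Nat.cast_nonneg N : (0:ℝ) ≤ N)])
  have hct : Tendsto c atTop (𝓝 0) := by
    have := tendsto_one_div_add_atTop_nhds_zero_nat (𝕜 := ℝ)
    simpa [hc] using this
  set φ : ℕ → EuclideanSpace ℝ (Fin m) → ℝ := fun N y => ψ y * η (c N • y) with hφ
  have hφs : ∀ N, ContDiff ℝ (⊤ : ℕ∞) (φ N) := fun N => hψ.mul (hη.comp (contDiff_const_smul (c N)))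
  have hφc : ∀ N, HasCompactSupport (φ N) := by
    intro N
    exact (η.hasCompactSupport.comp_smul (hc0 N).ne').mul_left
  have hφd : ∀ N y, mpd 1 (fun _ => j) (φ N) y = fderiv ℝ ψ y e * η (c N • y) + ψ y * (c N * fderiv ℝ η (c N • y) e) := by
    intro N y
    have h1 : HasFDerivAt ψ (fderiv ℝ ψ y) y := (hψ.differentiable (by simp) y).hasFDerivAt
    have h2 : HasFDerivAt (fun y => η (c N • y)) ((fderiv ℝ η (c N • y)).comp (c N • ContinuousLinearMap.id ℝ _)) y :=
      HasFDerivAt.comp y (g := (η : EuclideanSpace ℝ (Fin m) → ℝ)) (f := fun y => c N • y) (hη.differentiable (by simp) _).hasFDerivAt ((hasFDerivAt_id y).const_smul (c N))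
    have h3 := (h1.mul h2).fderiv
    unfold mpd
    rw [iteratedFDeriv_one_apply]
    change fderiv ℝ (fun y => ψ y * η (c N • y)) y e = _
    rw [show (fun y => ψ y * η (c N • y)) = ψ * (fun y => η (c N • y)) from rfl, h3]
    simp; ring
  have hηb : ∀ y, |η y| ≤ 1 := fun y => by rw [abs_of_nonneg η.nonneg]; exact η.le_one
  have hη0 : η 0 = 1 := η.one_of_mem_closedBall (mem_closedBall_self (by norm_num))
  have key : ∀ N, ∫ y, (fderiv ℝ ψ y e * η (c N • y) + ψ y * (c N * fderiv ℝ η (c N • y) e)) • f y = - ∫ y, φ N y • g y := by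
    intro N
    have := hw (φ N) (hφs N) (hφc N)
    simp only [hφd] at this
    rw [this]; simp
  have lη : ∀ y, Tendsto (fun N => η (c N • y)) atTop (𝓝 1) := by
    intro y
    rw [← hη0]
    refine (hη.continuous.tendsto 0).comp ?_
    simpa using hct.smul_const y
  have c1 : Continuous (fun y => fderiv ℝ ψ y e) := (hψ.continuous_fderiv (by simp)).clm_apply continuous_const
  have c2 := hψ.continuous
  have c3 := hη.continuous
  have lim1 : Tendsto (fun N => ∫ y, (fderiv ℝ ψ y e * η (c N • y) + ψ y * (c N * fderiv ℝ η (c N • y) e)) • f y) atTop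
      (𝓝 (∫ y, (fderiv ℝ ψ y e) • f y)) := by
    refine tendsto_integral_of_dominated_convergence (fun y => (1 + B) * (D y * ‖f y‖)) (fun N => ?_) (fi.const_mul _) (fun N => ?_) ?_
    · have this := hη1.comp (continuous_const_smul (c N) : Continuous fun y : EuclideanSpace ℝ (Fin m) => c N • y)
      have h4 : Continuous (fun y => fderiv ℝ η (c N • y) e) := this
      have h5 : Continuous (fun y => (fderiv ℝ ψ y e * η (c N • y) + ψ y * (c N * fderiv ℝ η (c N • y) e))) := by fun_prop
      exact h5.aestronglyMeasurable.smul hf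
    · refine Eventually.of_forall fun y => ?_
      rw [norm_smul, ← mul_assoc (1 + B)]
      gcongr
      have hD : 0 ≤ D y := (abs_nonneg _).trans (b0 y)
      calc _ ≤ |fderiv ℝ ψ y e * η (c N • y)| + |ψ y * (c N * fderiv ℝ η (c N • y) e)| := abs_add_le _ _
        _ ≤ D y * 1 + D y * (1 * B) := by
            rw [abs_mul, abs_mul, abs_mul, abs_of_pos (hc0 N)]
            gcongr
            · exact b1 y
            · exact hηb _
            · exact b0 y
            · exact hc1 N
            · exact hB _
        _ = _ := by ring
    · refine Eventually.of_forall fun y => ?_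
      have h5 : Tendsto (fun N => c N * fderiv ℝ η (c N • y) e) atTop (𝓝 0) := by
        refine squeeze_zero_norm (a := fun N => c N * B) (fun N => ?_) (by simpa using hct.mul_const B)
        rw [norm_mul, Real.norm_of_nonneg (hc0 N).le]
        exact mul_le_mul_of_nonneg_left (hB _) (hc0 N).le
      have h6 := (((lη y).const_mul (fderiv ℝ ψ y e)).add (h5.const_mul (ψ y))).smul_const (f y)
      simpa using h6
  have lim2 : Tendsto (fun N => ∫ y, φ N y • g y) atTop (𝓝 (∫ y, ψ y • g y)) := by
    refine tendsto_integral_of_dominated_convergence (fun y => D y * ‖g y‖) (fun N => ?_) gi (fun N => ?_) ?_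
    · exact AEStronglyMeasurable.smul (hφs N).continuous.aestronglyMeasurable hg
    · refine Eventually.of_forall fun y => ?_
      rw [norm_smul]
      gcongr
      rw [hφ, Real.norm_eq_abs]; simp only [abs_mul]
      calc _ ≤ D y * 1 := by
            gcongr
            · exact (abs_nonneg _).trans (b0 y)
            · exact b0 y
            · exact hηb _
        _ = _ := mul_one _
    · refine Eventually.of_forall fun y => ?_
      have h6 := ((lη y).const_mul (ψ y)).smul_const (g y)
      simpa [hφ] using h6
  simp only [key] at lim1
  exact tendsto_nhds_unique lim1 lim2.neg

lemma convK_ibp (hn : 2 ≤ n) (hp : 1 < p) {a : ℕ} (ha : n - 1 ≤ a) {H : RX n → ℂ} (h : HomK a H)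
    {f g : RV n → ℂ} (hf : MemLp f (ENNReal.ofReal p) volume) (hg : MemLp g (ENNReal.ofReal p) volume) {j : Fin (n-1)}
    (hw : IsWeakDeriv 1 (fun _ => j) f g) {x : RX n} (hx : 0 < xlast x) :
    convK (pd (finUp j) H) f x = convK H g x := by
  have hn0 : 0 < n := by omega
  obtain ⟨C0, hC0, d0⟩ := h.dom hn0 ha hx
  obtain ⟨C1, hC1, d1⟩ := (h.pd (finUp j)).dom hn0 (ha.trans (Nat.le_succ a)) hx
  have hball := mem_ball_self (x := x) (half_pos hx)
  have key : ∀ r : ℂ →L[ℝ] ℝ, ∫ y, r (pd (finUp j) H (x - J n y)) • f y = ∫ y, r (H (x - J n y)) • g y := by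
    intro r
    have hs : ContDiff ℝ (⊤ : ℕ∞) (fun y => r (H (x - J n y))) := by
      refine r.contDiff.comp (contDiff_iff_contDiffAt.2 fun y => ?_)
      exact (h.at (sub_J_ne hn0 hx y)).comp y (contDiffAt_const.sub (J n).contDiff.contDiffAt)
    have hd : ∀ y, fderiv ℝ (fun y => r (H (x - J n y))) y (EuclideanSpace.single j 1) = - r (pd (finUp j) H (x - J n y)) := by
      intro y
      have h1 := (h.diff (sub_J_ne hn0 hx y)).hasFDerivAt
      have h2 : HasFDerivAt (fun y => H (x - J n y)) ((fderiv ℝ H (x - J n y)).comp (-(J n))) y :=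
        HasFDerivAt.comp y (f := fun y => x - J n y) h1 ((J n).hasFDerivAt.const_sub x)
      have h3 : HasFDerivAt (fun y => r (H (x - J n y))) (r.comp ((fderiv ℝ H (x - J n y)).comp (-(J n)))) y :=
        HasFDerivAt.comp y r.hasFDerivAt h2
      rw [h3.fderiv]
      simp only [ContinuousLinearMap.comp_apply, ContinuousLinearMap.neg_apply, J_single hn0, map_neg]
      rfl
    have := ibp_gen hs (D := fun y => (‖r‖ * (C0 + C1)) * ((1 + ‖y‖) ^ (n-1))⁻¹) (j := j) (f := f) (g := g) (fun y => ?_) (fun y => ?_) hf.1 hg.1 ?_ ?_ hw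
    · simp only [hd, neg_smul, integral_neg] at this
      exact neg_injective this
    · refine (r.le_opNorm _).trans ?_
      rw [mul_assoc]
      gcongr
      refine ((d0 x hball).2 y).trans ?_
      gcongr; linarith
    · rw [hd, abs_neg]
      refine (r.le_opNorm _).trans ?_
      rw [mul_assoc]
      gcongr
      refine ((d1 x hball).2 y).trans ?_
      gcongr; linarith
    · simpa only [mul_assoc] using (dec_int hn hp hf).const_mul (‖r‖ * (C0 + C1))
    · simpa only [mul_assoc] using (dec_int hn hp hg).const_mul (‖r‖ * (C0 + C1))
  have comb : ∀ {b : ℕ} {G : RX n → ℂ} (hb : n - 1 ≤ b) (hG : HomK b G) {f : RV n → ℂ} (hf : MemLp f (ENNReal.ofReal p) volume),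
      convK G f x = (∫ y, Complex.reCLM (G (x - J n y)) • f y) + Complex.I * ∫ y, Complex.imCLM (G (x - J n y)) • f y := by
    intro b G hb hG f hf
    have hGc := hG.cont_slice hn0 hx
    have hi := convK_integrable hn hp hb hG hf hx
    have hr : ∀ r : ℂ →L[ℝ] ℝ, (∀ w, |r w| ≤ ‖w‖) → Integrable (fun y => r (G (x - J n y)) • f y) := by
      intro r hr
      refine hi.mono ((r.continuous.comp hGc).aestronglyMeasurable.smul hf.1) (Eventually.of_forall fun y => ?_)
      rw [norm_smul, norm_mul, mul_comm]
      gcongr; exact hr _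
    rw [← integral_const_mul, ← integral_add (hr _ Complex.abs_re_le_norm) ((hr _ Complex.abs_im_le_norm).const_mul _)]
    unfold convK
    congr 1; funext y
    conv_lhs => rw [← Complex.re_add_im (G (x - J n y))]
    simp only [Complex.reCLM_apply, Complex.imCLM_apply, Complex.real_smul]
    ring
  rw [comb (ha.trans (Nat.le_succ a)) (h.pd (finUp j)) hf, comb ha h hg, key, key]

lemma IsWeakDeriv.shift {m k : ℕ} {j : Fin m} {d : Fin k → Fin m} {f g1 g : EuclideanSpace ℝ (Fin m) → ℂ}
    (h1 : IsWeakDeriv 1 (fun _ => j) f g1) (h : IsWeakDeriv (k+1) (Fin.cons j d) f g) : IsWeakDeriv k d g1 g := by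
  intro φ hφ hc
  have hs : ContDiff ℝ (⊤ : ℕ∞) (mpd k d φ) := by
    have : ContDiff ℝ (⊤ : ℕ∞) (iteratedFDeriv ℝ k φ) := hφ.iteratedFDeriv_right (by exact_mod_cast le_top)
    exact (ContinuousMultilinearMap.apply ℝ (fun _ : Fin k => EuclideanSpace ℝ (Fin m)) ℝ (fun i => EuclideanSpace.single (d i) (1:ℝ))).contDiff.comp this
  have hsc : HasCompactSupport (mpd k d φ) := by
    have := hc.iteratedFDeriv (𝕜 := ℝ) k
    exact this.comp_left (g := fun L => L (fun i => EuclideanSpace.single (d i) (1:ℝ))) rfl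
  have e := h1 _ hs hsc
  have e2 := h φ hφ hc
  have e3 : ∀ x, mpd (k+1) (Fin.cons j d) φ x = mpd 1 (fun _ => j) (mpd k d φ) x := by
    intro x
    rw [mpd_succ isOpen_univ hφ.contDiffOn (Set.mem_univ x) k, mpd_succ isOpen_univ hs.contDiffOn (Set.mem_univ x) 0]
    rfl
  simp only [e3] at e2
  rw [e2, pow_succ, mul_smul] at e
  have e' : (-1:ℝ)^k • ((-1:ℝ) • ∫ x', φ x' • g x') = (-1:ℝ) • ∫ x', mpd k d φ x' • g1 x' := by rw [e]; simp
  rw [smul_comm] at e'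
  exact ((smul_right_injective ℂ (by norm_num : (-1:ℝ) ≠ 0)) e').symm

end IBP


section TKsec
variable {n : ℕ} {p : ℝ}

inductive TK (E : Fin n → RX n → ℂ) : ℕ → (RX n → ℂ) → Prop
  | base (s : Fin n) : TK E 0 (E s)
  | der {k : ℕ} {H : RX n → ℂ} (j : Fin (n-1)) : TK E k H → TK E (k+1) (pd (finUp j) H)
  | add {k : ℕ} {H H' : RX n → ℂ} : TK E k H → TK E k H' → TK E k (fun x => H x + H' x)
  | smul {k : ℕ} {H : RX n → ℂ} (c : ℂ) : TK E k H → TK E k (fun x => c * H x)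
  | congr {k : ℕ} {H H' : RX n → ℂ} : TK E k H → (∀ x, x ≠ 0 → H x = H' x) → TK E k H'

lemma HomK.cmul {a : ℕ} {H : RX n → ℂ} (h : HomK a H) (c : ℂ) : HomK a (fun x => c * H x) :=
  h.clm ((ContinuousLinearMap.mul ℝ ℂ) c)

lemma TK.homK {E : Fin n → RX n → ℂ} (hE : ∀ s, HomK (n-1) (E s)) {k : ℕ} {H : RX n → ℂ} (h : TK E k H) : HomK (n-1+k) H := by
  induction h with
  | base s => exact hE s
  | der j _ ih => exact ih.pd _
  | add _ _ i1 i2 => exact i1.add i2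
  | smul c _ ih => exact ih.cmul c
  | congr _ e ih => exact ih.congr e

lemma pd_add {H H' : RX n → ℂ} {x : RX n} (h : DifferentiableAt ℝ H x) (h' : DifferentiableAt ℝ H' x) (i : Fin n) :
    pd i (fun x => H x + H' x) x = pd i H x + pd i H' x := by
  unfold pd; rw [fderiv_fun_add h h']; rfl

lemma pd_cmul {H : RX n → ℂ} {x : RX n} (h : DifferentiableAt ℝ H x) (c : ℂ) (i : Fin n) :
    pd i (fun x => c * H x) x = c * pd i H x := by
  unfold pd; rw [fderiv_const_mul h]; rfl

lemma ne_nhds {x : RX n} (hx : x ≠ 0) : ∀ᶠ z in 𝓝 x, z ≠ 0 := isOpen_compl_singleton.mem_nhds hx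

lemma TK.der_all {E : Fin n → RX n → ℂ} (hE : ∀ s, HomK (n-1) (E s)) (hb : ∀ i s, TK E 1 (pd i (E s)))
    {k : ℕ} {H : RX n → ℂ} (h : TK E k H) (i : Fin n) : TK E (k+1) (pd i H) := by
  induction h with
  | base s => exact hb i s
  | der j h ih =>
    refine (ih.der j).congr fun x hx => ?_
    exact pd_comm isOpen_compl_singleton (h.homK hE).smooth hx _ _
  | add h h' i1 i2 =>
    exact (i1.add i2).congr fun x hx => (pd_add ((h.homK hE).diff hx) ((h'.homK hE).diff hx) i).symm
  | smul c h ih => exact (ih.smul c).congr fun x hx => (pd_cmul ((h.homK hE).diff hx) c i).symm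
  | congr h e ih =>
    exact ih.congr fun x hx => pd_congr ((ne_nhds hx).mono fun z hz => e z hz) i

def itpd : (k : ℕ) → (Fin k → Fin n) → (RX n → ℂ) → RX n → ℂ
  | 0, _, G => G
  | k+1, d, G => pd (d 0) (itpd k (Fin.tail d) G)

lemma TK.itpd {E : Fin n → RX n → ℂ} (hE : ∀ s, HomK (n-1) (E s)) (hb : ∀ i s, TK E 1 (pd i (E s)))
    {G : RX n → ℂ} (h : TK E 0 G) : ∀ (k : ℕ) (d : Fin k → Fin n), TK E k (itpd k d G)
  | 0, _ => h
  | k+1, d => (TK.itpd hE hb h k (Fin.tail d)).der_all hE hb (d 0)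

lemma mpd_convK (hn : 2 ≤ n) (hp : 1 < p) {E : Fin n → RX n → ℂ} (hE : ∀ s, HomK (n-1) (E s)) (hb : ∀ i s, TK E 1 (pd i (E s)))
    {G : RX n → ℂ} (h : TK E 0 G) {f : RV n → ℂ} (hf : MemLp f (ENNReal.ofReal p) volume) :
    ∀ (k : ℕ) (d : Fin k → Fin n) (x : RX n), 0 < xlast x → mpd k d (convK G f) x = convK (itpd k d G) f x
  | 0, _, x, _ => rfl
  | k+1, d, x, hx => by
    rw [mpd_succ (isOpen_uhs (by omega)) (convK_smooth hn hp hf le_rfl (h.homK hE)) hx]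
    have : mpd k (Fin.tail d) (convK G f) =ᶠ[𝓝 x] convK (itpd k (Fin.tail d) G) f :=
      Filter.mem_of_superset ((isOpen_uhs (by omega)).mem_nhds hx) fun z hz => mpd_convK hn hp hE hb h hf k _ z hz
    rw [pd_congr this, convK_pd hn hp (Nat.le_add_right _ _) ((h.itpd hE hb k _).homK hE) hf hx]
    rfl

def PK (n : ℕ) (p κ : ℝ) (k : ℕ) (H : RX n → ℂ) : Prop :=
  ∃ A : ℝ, 0 < A ∧ ∀ (f : RV n → ℂ) (g : (i : ℕ) → (Fin i → Fin (n-1)) → RV n → ℂ) (S : ℝ≥0∞),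
    MemLp f (ENNReal.ofReal p) volume →
    (∀ i ≤ k, ∀ d, MemLp (g i d) (ENNReal.ofReal p) volume ∧ IsWeakDeriv i d f (g i d)) →
    (∫⁻ x, ‖f x‖ₑ ^ p ≤ S) → (∀ i ≤ k, ∀ d, ∫⁻ x, ‖g i d x‖ₑ ^ p ≤ S) →
    ∃ W : RV n → ℝ≥0∞, Measurable W ∧
      (∀ x y t, 0 < t → dist x y < κ * t → ‖convK H f (toUp y t)‖ₑ ≤ W x) ∧
      ∫⁻ x, W x ^ p ≤ ENNReal.ofReal A * S

lemma TK.pk (hn : 2 ≤ n) (hp : 1 < p) {κ : ℝ} (hκ : 0 < κ) {E : Fin n → RX n → ℂ} (hE : ∀ s, HomK (n-1) (E s))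
    (hodd : ∀ s x, x ≠ 0 → E s (-x) = - E s x) {k : ℕ} {H : RX n → ℂ} (h : TK E k H) : PK n p κ k H := by
  have hn0 : 0 < n := by omega
  have hxl : ∀ (y : RV n) {t : ℝ}, 0 < t → 0 < xlast (toUp y t) := fun y t ht => by rwa [xlast_toUp hn0]
  induction h with
  | base s =>
    obtain ⟨A, hA, h⟩ := nt_base hn hp hκ (hE s) (hodd s)
    refine ⟨A, hA, fun f g S hf _ hS _ => ?_⟩
    obtain ⟨W, hW, h1, h2⟩ := h f hf
    exact ⟨W, hW, h1, h2.trans (by gcongr)⟩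
  | @der k H j h ih =>
    obtain ⟨A, hA, ih⟩ := ih
    refine ⟨A, hA, fun f g S hf hg hS hgS => ?_⟩
    obtain ⟨W, hW, h1, h2⟩ := ih (g 1 (fun _ => j)) (fun i d => g (i+1) (Fin.cons j d)) S (hg 1 (by omega) _).1
      (fun i hi d => ⟨(hg (i+1) (by omega) _).1, (hg 1 (by omega) _).2.shift (hg (i+1) (by omega) _).2⟩)
      (hgS 1 (by omega) _) (fun i hi d => hgS (i+1) (by omega) _)
    refine ⟨W, hW, fun x y t ht hd => ?_, h2⟩
    rw [convK_ibp hn hp (Nat.le_add_right _ _) (h.homK hE) hf (hg 1 (by omega) _).1 (hg 1 (by omega) _).2 (hxl y ht)]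
    exact h1 x y t ht hd
  | @add k H H' h h' i1 i2 =>
    obtain ⟨A, hA, i1⟩ := i1
    obtain ⟨B, hB, i2⟩ := i2
    refine ⟨2 ^ (p-1) * (A + B), by positivity, fun f g S hf hg hS hgS => ?_⟩
    obtain ⟨W, hW, h1, h2⟩ := i1 f g S hf hg hS hgS
    obtain ⟨V, hV, h3, h4⟩ := i2 f g S hf hg hS hgS
    refine ⟨fun x => W x + V x, hW.add hV, fun x y t ht hd => ?_, ?_⟩
    · have : convK (fun x => H x + H' x) f (toUp y t) = convK H f (toUp y t) + convK H' f (toUp y t) := by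
        unfold convK
        simp only [mul_add]
        exact integral_add (convK_integrable hn hp (Nat.le_add_right _ _) (h.homK hE) hf (hxl y ht))
          (convK_integrable hn hp (Nat.le_add_right _ _) (h'.homK hE) hf (hxl y ht))
      rw [this]
      exact (enorm_add_le _ _).trans (add_le_add (h1 x y t ht hd) (h3 x y t ht hd))
    · calc _ ≤ ∫⁻ x, 2 ^ (p-1) * (W x ^ p + V x ^ p) := lintegral_mono fun x => ENNReal.rpow_add_le_mul_rpow_add_rpow _ _ hp.le
        _ = 2 ^ (p-1) * ((∫⁻ x, W x ^ p) + ∫⁻ x, V x ^ p) := by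
            rw [lintegral_const_mul _ (by fun_prop), lintegral_add_left (by fun_prop)]
        _ ≤ 2 ^ (p-1) * (ENNReal.ofReal A * S + ENNReal.ofReal B * S) := by gcongr
        _ = _ := by
            rw [ENNReal.ofReal_mul (by positivity), ENNReal.ofReal_add hA.le hB.le, ← ENNReal.ofReal_rpow_of_pos two_pos]
            simp; ring
  | @smul k H c h ih =>
    obtain ⟨A, hA, ih⟩ := ih
    refine ⟨(‖c‖+1) ^ p * A, by positivity, fun f g S hf hg hS hgS => ?_⟩
    obtain ⟨W, hW, h1, h2⟩ := ih f g S hf hg hS hgS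
    refine ⟨fun x => ENNReal.ofReal (‖c‖+1) * W x, hW.const_mul _, fun x y t ht hd => ?_, ?_⟩
    · have : convK (fun x => c * H x) f (toUp y t) = c * convK H f (toUp y t) := by
        unfold convK
        rw [← integral_const_mul]; congr 1; funext z; ring
      rw [this, enorm_mul]
      refine mul_le_mul' ?_ (h1 x y t ht hd)
      rw [← ofReal_norm]
      exact ENNReal.ofReal_le_ofReal (by linarith)
    · simp only [ENNReal.mul_rpow_of_nonneg _ _ (by linarith : 0 ≤ p)]
      rw [lintegral_const_mul _ (by fun_prop), ENNReal.ofReal_mul (by positivity), ENNReal.ofReal_rpow_of_pos (by positivity), mul_assoc]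
      gcongr
  | @congr k H H' h e ih =>
    obtain ⟨A, hA, ih⟩ := ih
    refine ⟨A, hA, fun f g S hf hg hS hgS => ?_⟩
    obtain ⟨W, hW, h1, h2⟩ := ih f g S hf hg hS hgS
    refine ⟨W, hW, fun x y t ht hd => ?_, h2⟩
    have : convK H' f (toUp y t) = convK H f (toUp y t) := by
      unfold convK
      congr 1; funext z
      rw [e _ (sub_J_ne hn0 (hxl y ht) z)]
    rw [this]; exact h1 x y t ht hd

end TKsec


section Kern
variable {n : ℕ}

def qf (B : Matrix (Fin n) (Fin n) ℂ) (x : RX n) : ℂ := ∑ r, ∑ s, B r s * ((x r : ℝ) : ℂ) * ((x s : ℝ) : ℂ)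
def bv (B : Matrix (Fin n) (Fin n) ℂ) (s : Fin n) (x : RX n) : ℂ := ∑ r, B s r * ((x r : ℝ) : ℂ)
def Ek (B : Matrix (Fin n) (Fin n) ℂ) (s : Fin n) (x : RX n) : ℂ := bv B s x * qf B x ^ (-(n:ℂ)/2)

def crd (r : Fin n) : RX n →L[ℝ] ℂ := Complex.ofRealCLM.comp (EuclideanSpace.proj r)

lemma crd_apply (r : Fin n) (x : RX n) : crd r x = ((x r : ℝ) : ℂ) := rfl

lemma crd_single (r i : Fin n) : crd r (EuclideanSpace.single i (1:ℝ)) = if r = i then 1 else 0 := by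
  rw [crd_apply]; by_cases h : r = i <;> simp [h]

variable {B : Matrix (Fin n) (Fin n) ℂ}

lemma bv_eq_clm (s : Fin n) : ∃ L : RX n →L[ℝ] ℂ, (∀ x, L x = bv B s x) ∧ ∀ i, L (EuclideanSpace.single i (1:ℝ)) = B s i := by
  refine ⟨∑ r, ((ContinuousLinearMap.mul ℝ ℂ) (B s r)).comp (crd r), fun x => ?_, fun i => ?_⟩
  · rw [ContinuousLinearMap.sum_apply]; rfl
  · rw [ContinuousLinearMap.sum_apply]; simp [crd_single]

lemma hasFDerivAt_bv (s : Fin n) (x : RX n) : ∃ L : RX n →L[ℝ] ℂ, HasFDerivAt (bv B s) L x ∧ ∀ i, L (EuclideanSpace.single i (1:ℝ)) = B s i := by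
  obtain ⟨L, h1, h2⟩ := bv_eq_clm (B := B) s
  refine ⟨L, ?_, h2⟩
  have : bv B s = L := funext fun x => (h1 x).symm
  rw [this]; exact L.hasFDerivAt

lemma qf_eq (x : RX n) : qf B x = ∑ r, crd r x * bv B r x := by
  unfold qf bv
  refine Finset.sum_congr rfl fun r _ => ?_
  rw [Finset.mul_sum]
  refine Finset.sum_congr rfl fun s _ => ?_
  rw [crd_apply]; ring

lemma contDiff_bv (s : Fin n) : ContDiff ℝ (⊤ : ℕ∞) (bv B s) := by
  obtain ⟨L, h1, _⟩ := bv_eq_clm (B := B) s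
  have : bv B s = L := funext fun x => (h1 x).symm
  rw [this]; exact L.contDiff

lemma contDiff_qf : ContDiff ℝ (⊤ : ℕ∞) (qf B) := by
  have : qf B = fun x => ∑ r, crd r x * bv B r x := funext qf_eq
  rw [this]
  exact ContDiff.sum fun r _ => (crd r).contDiff.mul (contDiff_bv r)

lemma hasFDerivAt_qf (hB : B.transpose = B) (x : RX n) :
    ∃ L : RX n →L[ℝ] ℂ, HasFDerivAt (qf B) L x ∧ ∀ i, L (EuclideanSpace.single i (1:ℝ)) = 2 * bv B i x := by
  choose L h1 h2 using fun s => hasFDerivAt_bv (B := B) s x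
  have h := HasFDerivAt.fun_sum (u := Finset.univ) fun r _ => ((crd r).hasFDerivAt (x := x)).mul (h1 r)
  have e : (fun x => ∑ r, crd r x * bv B r x) = qf B := funext fun x => (qf_eq x).symm
  refine ⟨_, (by rw [← e]; exact h), fun i => ?_⟩
  have hs : ∀ r s, B r s = B s r := fun r s => congrFun (congrFun hB s) r
  simp only [ContinuousLinearMap.sum_apply, ContinuousLinearMap.add_apply, ContinuousLinearMap.smul_apply, h2, crd_single, smul_eq_mul]
  rw [Finset.sum_add_distrib]
  simp only [mul_ite, mul_one, mul_zero, Finset.sum_ite_eq', Finset.mem_univ, if_true]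
  have : ∑ r, crd r x * B r i = bv B i x := by
    unfold bv
    exact Finset.sum_congr rfl fun r _ => by rw [hs i r, crd_apply, mul_comm]
  rw [this]; ring

lemma slit (hre : ∀ x : RX n, x ≠ 0 → 0 < (qf B x).re) {x : RX n} (hx : x ≠ 0) : qf B x ∈ Complex.slitPlane :=
  Or.inl (hre x hx)

lemma qf_ne (hre : ∀ x : RX n, x ≠ 0 → 0 < (qf B x).re) {x : RX n} (hx : x ≠ 0) : qf B x ≠ 0 :=
  Complex.slitPlane_ne_zero (slit hre hx)

lemma bv_smul (s : Fin n) (c : ℝ) (x : RX n) : bv B s (c • x) = c * bv B s x := by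
  obtain ⟨L, h1, _⟩ := bv_eq_clm (B := B) s
  rw [← h1, ← h1, map_smul, Complex.real_smul]

lemma qf_smul (c : ℝ) (x : RX n) : qf B (c • x) = ((c^2 : ℝ) : ℂ) * qf B x := by
  rw [qf_eq, qf_eq, Finset.mul_sum]
  refine Finset.sum_congr rfl fun r _ => ?_
  rw [bv_smul, map_smul, Complex.real_smul]; push_cast; ring

lemma qpow_smul (hre : ∀ x : RX n, x ≠ 0 → 0 < (qf B x).re) {x : RX n} (hx : x ≠ 0) {c : ℝ} (hc : 0 < c) :
    qf B (c • x) ^ (-(n:ℂ)/2) = ((c^n)⁻¹ : ℝ) * qf B x ^ (-(n:ℂ)/2) := by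
  rw [qf_smul, Complex.cpow_def_of_ne_zero (mul_ne_zero (by exact_mod_cast (by positivity : c^2 ≠ 0)) (qf_ne hre hx)),
    Complex.cpow_def_of_ne_zero (qf_ne hre hx), Complex.log_ofReal_mul (by positivity) (qf_ne hre hx), add_mul, Complex.exp_add]
  congr 1
  rw [Real.log_pow]
  have : (c^n)⁻¹ = Real.exp (-(n * Real.log c)) := by
    rw [Real.exp_neg, ← Real.log_pow, Real.exp_log (by positivity)]
  rw [this]; push_cast; congr 1; ring

lemma contDiffAt_qpow (hre : ∀ x : RX n, x ≠ 0 → 0 < (qf B x).re) {x : RX n} (hx : x ≠ 0) (c : ℂ) :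
    ContDiffAt ℝ (⊤ : ℕ∞) (fun x => qf B x ^ c) x := by
  have h1 : ContDiffAt ℝ (⊤ : ℕ∞) (fun x => Complex.exp (Complex.log (qf B x) * c)) x := by
    have hl : ContDiffAt ℝ (⊤ : ℕ∞) (fun x => Complex.log (qf B x)) x :=
      ((Complex.contDiffAt_log (slit hre hx)).restrict_scalars ℝ).comp x contDiff_qf.contDiffAt
    exact (ContDiffAt.restrict_scalars ℝ (𝕜' := ℂ) Complex.contDiff_exp.contDiffAt).comp x (hl.mul contDiffAt_const)
  refine h1.congr_of_eventuallyEq ((ne_nhds hx).mono fun z hz => ?_)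
  exact Complex.cpow_def_of_ne_zero (qf_ne hre hz) c

lemma Ek_homK (hn : 0 < n) (hre : ∀ x : RX n, x ≠ 0 → 0 < (qf B x).re) (s : Fin n) : HomK (n-1) (Ek B s) := by
  refine ⟨fun x hx => ((contDiff_bv s).contDiffAt.mul (contDiffAt_qpow hre hx _)).contDiffWithinAt, fun c x hc hx => ?_⟩
  unfold Ek
  rw [bv_smul, qpow_smul hre hx hc, Complex.real_smul]
  have : (c^n) = c * c^(n-1) := by rw [← pow_succ', Nat.sub_add_cancel hn]
  rw [this]; push_cast
  have : (c:ℂ) ≠ 0 := by exact_mod_cast hc.ne'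
  field_simp

lemma Ek_odd (s : Fin n) (x : RX n) : Ek B s (-x) = - Ek B s x := by
  unfold Ek
  rw [show -x = (-1:ℝ) • x by simp, bv_smul, qf_smul]; simp

lemma Ek_pd (hB : B.transpose = B) (hre : ∀ x : RX n, x ≠ 0 → 0 < (qf B x).re) {x : RX n} (hx : x ≠ 0) (i s : Fin n) :
    pd i (Ek B s) x = B s i * qf B x ^ (-(n:ℂ)/2) - n * (bv B s x * bv B i x) * qf B x ^ (-(n:ℂ)/2 - 1) := by
  obtain ⟨L, h1, h2⟩ := hasFDerivAt_bv (B := B) s x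
  obtain ⟨M, h3, h4⟩ := hasFDerivAt_qf hB x
  have h5 : HasDerivAt (fun z : ℂ => z ^ (-(n:ℂ)/2)) _ (qf B x) := (Complex.hasStrictDerivAt_cpow_const (slit hre hx)).hasDerivAt
  have h6 := (h5.hasFDerivAt.restrictScalars ℝ).comp x h3
  have h7 := h1.mul h6
  have h8 : fderiv ℝ (Ek B s) x = _ := h7.fderiv
  unfold pd
  rw [h8]
  simp [h2, h4]
  ring

lemma sum_symm {A Asym S : Matrix (Fin n) (Fin n) ℂ} (hAs : Asym = ((1 : ℂ) / 2) • (A + A.transpose)) (hS : ∀ r s, S r s = S s r) :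
    ∑ r, ∑ s, A r s * S r s = ∑ r, ∑ s, Asym r s * S r s := by
  have h1 : ∑ r, ∑ s, A s r * S r s = ∑ r, ∑ s, A r s * S r s := by
    rw [Finset.sum_comm]
    exact Finset.sum_congr rfl fun r _ => Finset.sum_congr rfl fun s _ => by rw [hS]
  have h2 : ∑ r, ∑ s, Asym r s * S r s = (1/2) * (∑ r, ∑ s, A r s * S r s + ∑ r, ∑ s, A s r * S r s) := by
    rw [← Finset.sum_add_distrib, Finset.mul_sum]
    refine Finset.sum_congr rfl fun r _ => ?_
    rw [← Finset.sum_add_distrib, Finset.mul_sum]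
    refine Finset.sum_congr rfl fun s _ => ?_
    rw [hAs]; simp; ring
  rw [h2, h1]; ring

lemma Asym_bv {Asym : Matrix (Fin n) (Fin n) ℂ} (hinv : Asym * B = 1) (r : Fin n) (x : RX n) :
    ∑ s, Asym r s * bv B s x = ((x r : ℝ) : ℂ) := by
  unfold bv
  simp only [Finset.mul_sum]
  rw [Finset.sum_comm]
  have : ∀ t, ∑ s, Asym r s * (B s t * ((x t : ℝ):ℂ)) = (1 : Matrix (Fin n) (Fin n) ℂ) r t * ((x t : ℝ):ℂ) := by
    intro t
    rw [← hinv, Matrix.mul_apply, Finset.sum_mul]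
    exact Finset.sum_congr rfl fun s _ => by ring
  simp [this, Matrix.one_apply]

lemma Ek_div {A Asym : Matrix (Fin n) (Fin n) ℂ} (hAs : Asym = ((1 : ℂ) / 2) • (A + A.transpose)) (hinv : Asym * B = 1)
    (hB : B.transpose = B) (hre : ∀ x : RX n, x ≠ 0 → 0 < (qf B x).re) {x : RX n} (hx : x ≠ 0) :
    ∑ r, ∑ s, A r s * pd r (Ek B s) x = 0 := by
  have hs : ∀ r s, B r s = B s r := fun r s => congrFun (congrFun hB s) r
  simp only [Ek_pd hB hre hx]
  rw [sum_symm (S := fun r s => _) hAs (fun r s => by rw [hs]; ring)]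
  have e1 : ∑ r, ∑ s, Asym r s * B s r = n := by
    have : Matrix.trace (Asym * B) = n := by rw [hinv]; simp
    rw [← this]; rfl
  have e2 : ∑ r, ∑ s, Asym r s * (bv B s x * bv B r x) = qf B x := by
    rw [qf_eq]
    refine Finset.sum_congr rfl fun r _ => ?_
    rw [crd_apply, ← Asym_bv hinv r x, Finset.sum_mul]
    exact Finset.sum_congr rfl fun s _ => by ring
  have e3 : qf B x ^ (-(n:ℂ)/2) = qf B x * qf B x ^ (-(n:ℂ)/2 - 1) := by
    rw [Complex.cpow_sub _ _ (qf_ne hre hx), Complex.cpow_one]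
    field_simp [qf_ne hre hx]
  calc _ = (∑ r, ∑ s, Asym r s * B s r) * qf B x ^ (-(n:ℂ)/2) - n * (∑ r, ∑ s, Asym r s * (bv B s x * bv B r x)) * qf B x ^ (-(n:ℂ)/2 - 1) := by
        rw [Finset.sum_mul, Finset.mul_sum, Finset.sum_mul, ← Finset.sum_sub_distrib]
        refine Finset.sum_congr rfl fun r _ => ?_
        rw [Finset.sum_mul, Finset.mul_sum, Finset.sum_mul, ← Finset.sum_sub_distrib]
        exact Finset.sum_congr rfl fun s _ => by ring
    _ = 0 := by rw [e1, e2, e3]; ring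

end Kern


section Kern2
variable {n : ℕ} {B A Asym : Matrix (Fin n) (Fin n) ℂ}

lemma TK.sum (hn : 0 < n) {E : Fin n → RX n → ℂ} {k : ℕ} {ι : Type*} (t : Finset ι) (H : ι → RX n → ℂ) (h0 : ∃ H0, TK E k H0)
    (h : ∀ i, TK E k (H i)) : TK E k (fun x => ∑ i ∈ t, H i x) := by
  classical
  induction t using Finset.induction_on with
  | empty => obtain ⟨H0, h0⟩ := h0; exact (h0.smul 0).congr fun x _ => by simp
  | insert a t ha ih => exact ((h a).add ih).congr fun x _ => by rw [Finset.sum_insert ha]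

structure KD (B A Asym : Matrix (Fin n) (Fin n) ℂ) : Prop where
  hAs : Asym = ((1 : ℂ) / 2) • (A + A.transpose)
  hinv : Asym * B = 1
  hB : B.transpose = B
  hre : ∀ x : RX n, x ≠ 0 → 0 < (qf B x).re
  hA : ∀ i, A i i ≠ 0

lemma KD.symm (h : KD B A Asym) {x : RX n} (hx : x ≠ 0) (i s : Fin n) : pd i (Ek B s) x = pd s (Ek B i) x := by
  rw [Ek_pd h.hB h.hre hx, Ek_pd h.hB h.hre hx, show B s i = B i s from congrFun (congrFun h.hB i) s]; ring

lemma KD.hbase (hn : 2 ≤ n) (h : KD B A Asym) (i s : Fin n) : TK (Ek B) 1 (pd i (Ek B s)) := by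
  have hn0 : 0 < n := by omega
  have h1 : ∀ j s, TK (Ek B) 1 (pd (finUp j) (Ek B s)) := fun j s => (TK.base s).der j
  have h2 : ∀ i j, TK (Ek B) 1 (pd i (Ek B (finUp j))) := fun i j => (h1 j i).congr fun x hx => h.symm hx _ _
  have h0 : ∃ H0, TK (Ek B) 1 H0 := ⟨_, h1 ⟨0, by omega⟩ i⟩
  rcases idx_cases hn0 i with rfl | ⟨j, rfl⟩
  · rcases idx_cases hn0 s with rfl | ⟨j, rfl⟩
    · set l := lastIdx n hn0
      have h3 : TK (Ek B) 1 (fun x => (-(A l l)⁻¹) * ((∑ j : Fin (n-1), ∑ s, A (finUp j) s * pd (finUp j) (Ek B s) x) +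
          ∑ j : Fin (n-1), A l (finUp j) * pd l (Ek B (finUp j)) x)) := by
        refine TK.smul _ (TK.add (TK.sum hn0 _ _ h0 fun j => TK.sum hn0 _ _ h0 fun s => (h1 j s).smul _)
          (TK.sum hn0 _ _ h0 fun j => (h2 l j).smul _))
      refine h3.congr fun x hx => ?_
      have e := Ek_div h.hAs h.hinv h.hB h.hre hx
      rw [sum_up hn0, sum_up hn0 (fun s => A l s * _)] at e
      have hl := h.hA l
      rw [← add_assoc] at e
      rw [eq_neg_of_add_eq_zero_left e]
      field_simp
      rfl
    · exact h2 _ j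
  · exact h1 j s

def Gn (B : Matrix (Fin n) (Fin n) ℂ) (x : RX n) : ℂ := (xlast x : ℂ) * qf B x ^ (-(n:ℂ)/2)

lemma KD.Gn_eq (hn : 0 < n) (h : KD B A Asym) (x : RX n) : Gn B x = ∑ s, Asym (lastIdx n hn) s * Ek B s x := by
  unfold Gn Ek
  rw [xlast_eq hn, ← Asym_bv h.hinv, Finset.sum_mul]
  simp only [mul_assoc]

lemma KD.Gn_TK (hn : 0 < n) (h : KD B A Asym) : TK (Ek B) 0 (Gn B) :=
  (TK.sum hn _ _ ⟨_, TK.base (lastIdx n hn)⟩ fun s => (TK.base s).smul _).congr fun x _ => (h.Gn_eq hn x).symm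

lemma pd_sum {ι : Type*} (t : Finset ι) {H : ι → RX n → ℂ} {c : ι → ℂ} {x : RX n} (h : ∀ i ∈ t, DifferentiableAt ℝ (H i) x) (i : Fin n) :
    pd i (fun x => ∑ a ∈ t, c a * H a x) x = ∑ a ∈ t, c a * pd i (H a) x := by
  have : ∀ a, pd i (H a) x = fderiv ℝ (H a) x (EuclideanSpace.single i 1) := fun _ => rfl
  unfold pd
  rw [fderiv_fun_sum fun a ha => (h a ha).const_mul _, ContinuousLinearMap.sum_apply]
  refine Finset.sum_congr rfl fun a ha => ?_
  rw [fderiv_const_mul (h a ha)]; rfl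

lemma KD.pde (hn : 0 < n) (h : KD B A Asym) {x : RX n} (hx : x ≠ 0) : ∑ r, ∑ s, A r s * pd r (pd s (Gn B)) x = 0 := by
  have hE := Ek_homK hn h.hre
  have hU : IsOpen ({0}ᶜ : Set (RX n)) := isOpen_compl_singleton
  set l := lastIdx n hn
  have e1 : ∀ s, ∀ z : RX n, z ≠ 0 → pd s (Gn B) z = ∑ σ, Asym l σ * pd s (Ek B σ) z := fun s z hz => by
    rw [← pd_sum _ (fun a _ => (hE a).diff hz)]
    congr 1; funext w; exact h.Gn_eq hn w
  have e2 : ∀ r s, pd r (pd s (Gn B)) x = ∑ σ, Asym l σ * pd σ (pd r (Ek B s)) x := fun r s => by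
    rw [pd_congr ((ne_nhds hx).mono fun z hz => e1 s z hz) r, pd_sum _ (fun a _ => ((hE a).pd s).diff hx)]
    refine Finset.sum_congr rfl fun σ _ => ?_
    rw [pd_congr ((ne_nhds hx).mono fun z hz => h.symm hz s σ) r, pd_comm hU (hE s).smooth hx]
  have e3 : ∀ σ, ∑ r, ∑ s, A r s * pd σ (pd r (Ek B s)) x = 0 := fun σ => by
    have : pd σ (fun z => ∑ q : Fin n × Fin n, A q.1 q.2 * pd q.1 (Ek B q.2) z) x = 0 := by
      rw [pd_congr (H := fun _ => (0:ℂ)) ((ne_nhds hx).mono fun z hz => ?_) σ]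
      · unfold pd; simp
      · simp only [Fintype.sum_prod_type]; exact Ek_div h.hAs h.hinv h.hB h.hre hz
    rw [pd_sum _ (fun a _ => ((hE a.2).pd a.1).diff hx), Fintype.sum_prod_type] at this
    exact this
  calc _ = ∑ r, ∑ s, ∑ σ, Asym l σ * (A r s * pd σ (pd r (Ek B s)) x) := by
        refine Finset.sum_congr rfl fun r _ => Finset.sum_congr rfl fun s _ => ?_
        rw [e2, Finset.mul_sum]
        exact Finset.sum_congr rfl fun σ _ => by ring
    _ = ∑ σ, Asym l σ * ∑ r, ∑ s, A r s * pd σ (pd r (Ek B s)) x := by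
        simp only [Finset.mul_sum]
        rw [Finset.sum_comm' (t' := Finset.univ) (s' := fun _ => Finset.univ) (by simp)]
        rw [show (∑ σ, ∑ r, ∑ s, Asym l σ * (A r s * pd σ (pd r (Ek B s)) x)) = ∑ r, ∑ σ, ∑ s, Asym l σ * (A r s * pd σ (pd r (Ek B s)) x) from Finset.sum_comm]
        rw [Finset.sum_comm]
        exact Finset.sum_congr rfl fun σ _ => Finset.sum_comm
    _ = 0 := by simp [e3]

lemma KD.pde_conv (hn : 2 ≤ n) {p : ℝ} (hp : 1 < p) (h : KD B A Asym) {f : RV n → ℂ} (hf : MemLp f (ENNReal.ofReal p) volume)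
    {x : RX n} (hx : 0 < xlast x) (c : ℂ) : ∑ r, ∑ s, A r s * pd r (pd s (fun x => c * convK (Gn B) f x)) x = 0 := by
  have hn0 : 0 < n := by omega
  have hG : HomK (n-1) (Gn B) := (h.Gn_TK hn0).homK (Ek_homK hn0 h.hre)
  have hU := (isOpen_uhs hn0).mem_nhds hx
  have hd : ∀ {a : ℕ} {H : RX n → ℂ}, n - 1 ≤ a → HomK a H → ∀ z, 0 < xlast z → DifferentiableAt ℝ (convK H f) z :=
    fun ha hH z hz => (convK_hasFDerivAt hn hp ha hH hf hz).2.differentiableAt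
  have e : ∀ r s, pd r (pd s (fun x => c * convK (Gn B) f x)) x = c * convK (pd r (pd s (Gn B))) f x := by
    intro r s
    rw [pd_congr (H := fun x => c * convK (pd s (Gn B)) f x) (Filter.mem_of_superset hU fun z hz => ?_) r]
    · rw [pd_cmul (hd (Nat.le_succ _) (hG.pd s) x hx), convK_pd hn hp (Nat.le_succ _) (hG.pd s) hf hx]
    · exact (pd_cmul (hd le_rfl hG z hz) c s).trans (by rw [convK_pd hn hp le_rfl hG hf hz])
  simp only [e]
  have hi : ∀ r s, Integrable (fun y => f y * (pd r (pd s (Gn B))) (x - J n y)) := fun r s =>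
    convK_integrable hn hp (by omega) ((hG.pd s).pd r) hf hx
  calc _ = c * ∑ r, ∑ s, A r s * convK (pd r (pd s (Gn B))) f x := by
        simp only [Finset.mul_sum]
        exact Finset.sum_congr rfl fun r _ => Finset.sum_congr rfl fun s _ => by ring
    _ = c * ∫ y, ∑ r, ∑ s, A r s * (f y * (pd r (pd s (Gn B))) (x - J n y)) := by
        congr 1
        have h1 : ∀ r s, Integrable (fun y => A r s * (f y * (pd r (pd s (Gn B))) (x - J n y))) := fun r s => (hi r s).const_mul _
        refine Eq.trans (Finset.sum_congr rfl fun r _ => ?_) (integral_finset_sum Finset.univ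
          (f := fun r y => ∑ s, A r s * (f y * (pd r (pd s (Gn B))) (x - J n y))) fun r _ => integrable_finset_sum _ fun s _ => h1 r s).symm
        refine Eq.trans (Finset.sum_congr rfl fun s _ => ?_) (integral_finset_sum Finset.univ
          (f := fun s y => A r s * (f y * (pd r (pd s (Gn B))) (x - J n y))) fun s _ => h1 r s).symm
        exact (integral_const_mul _ _).symm
    _ = c * ∫ y : RV n, 0 := by
        congr 2; funext y
        have := h.pde hn0 (sub_J_ne hn0 hx y)
        calc _ = f y * ∑ r, ∑ s, A r s * pd r (pd s (Gn B)) (x - J n y) := by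
              simp only [Finset.mul_sum]
              exact Finset.sum_congr rfl fun r _ => Finset.sum_congr rfl fun s _ => by ring
          _ = 0 := by rw [this, mul_zero]
    _ = 0 := by simp

end Kern2


section LinAlg
variable {n : ℕ} {A S : Matrix (Fin n) (Fin n) ℂ}

lemma herm_re (hS : S.transpose = S) (hpos : ∀ x : RX n, x ≠ 0 → 0 < (qf S x).re) {z : Fin n → ℂ} (hz : z ≠ 0) :
    0 < (∑ r, ∑ s, starRingEnd ℂ (z r) * S r s * z s).re := by
  have hs : ∀ r s, S r s = S s r := fun r s => congrFun (congrFun hS s) r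
  set a : RX n := WithLp.toLp 2 (fun r => (z r).re) with ha
  set b : RX n := WithLp.toLp 2 (fun r => (z r).im) with hb
  have hz' : ∀ r, z r = ((a r : ℝ):ℂ) + ((b r : ℝ):ℂ) * Complex.I := fun r => (Complex.re_add_im (z r)).symm
  have hc : ∑ r, ∑ s, S r s * (((a r : ℝ):ℂ) * ((b s : ℝ):ℂ)) = ∑ r, ∑ s, S r s * (((b r : ℝ):ℂ) * ((a s : ℝ):ℂ)) := by
    rw [Finset.sum_comm]
    exact Finset.sum_congr rfl fun r _ => Finset.sum_congr rfl fun s _ => by rw [hs]; ring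
  have e : ∑ r, ∑ s, starRingEnd ℂ (z r) * S r s * z s = qf S a + qf S b + Complex.I * (∑ r, ∑ s, S r s * (((a r : ℝ):ℂ) * ((b s : ℝ):ℂ)) - ∑ r, ∑ s, S r s * (((b r : ℝ):ℂ) * ((a s : ℝ):ℂ))) := by
    unfold qf
    simp only [← Finset.sum_add_distrib, ← Finset.sum_sub_distrib, Finset.mul_sum]
    refine Finset.sum_congr rfl fun r _ => Finset.sum_congr rfl fun s _ => ?_
    rw [hz' r, hz' s]
    simp only [map_add, map_mul, Complex.conj_ofReal, Complex.conj_I]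
    linear_combination (-(((b r : ℝ):ℂ) * S r s * ((b s : ℝ):ℂ))) * Complex.I_sq
  rw [e, hc, sub_self, mul_zero, add_zero, Complex.add_re]
  have h0 : ∀ x : RX n, 0 ≤ (qf S x).re := fun x => by
    by_cases hx : x = 0
    · simp [hx, qf]
    · exact (hpos x hx).le
  by_cases h : a = 0
  · have hb0 : b ≠ 0 := by
      intro hb0; apply hz; funext r; rw [hz' r, h, hb0]; simp
    linarith [h0 a, hpos b hb0]
  · linarith [h0 b, hpos a h]

lemma KD.mk' (hell : ∀ ξ : RX n, ξ ≠ 0 → 0 < (∑ r, ∑ s, A r s * (ξ r : ℂ) * (ξ s : ℂ)).re)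
    (hAs : S = ((1 : ℂ) / 2) • (A + A.transpose)) : KD S⁻¹ A S ∧ S.det ≠ 0 := by
  have hS : S.transpose = S := by
    rw [hAs, Matrix.transpose_smul, Matrix.transpose_add, Matrix.transpose_transpose, add_comm]
  have hpos : ∀ x : RX n, x ≠ 0 → 0 < (qf S x).re := fun x hx => by
    have := hell x hx
    have e := sum_symm (S := fun r s => ((x r : ℝ):ℂ) * ((x s : ℝ):ℂ)) hAs (fun r s => mul_comm _ _)
    simp only [← mul_assoc] at e
    rw [e] at this; exact this
  have hdet : S.det ≠ 0 := by
    intro h0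
    obtain ⟨v, hv, hv0⟩ := Matrix.exists_mulVec_eq_zero_iff.2 h0
    have := herm_re hS hpos hv
    have e : ∑ r, ∑ s, starRingEnd ℂ (v r) * S r s * v s = ∑ r, starRingEnd ℂ (v r) * (S.mulVec v) r := by
      refine Finset.sum_congr rfl fun r _ => ?_
      simp only [Matrix.mulVec, dotProduct, Finset.mul_sum, mul_assoc]
    rw [e, hv0] at this
    simp at this
  have hinv : S * S⁻¹ = 1 := Matrix.mul_nonsing_inv _ (isUnit_iff_ne_zero.2 hdet)
  refine ⟨⟨hAs, hinv, ?_, fun x hx => ?_, fun i => ?_⟩, hdet⟩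
  · rw [Matrix.transpose_nonsing_inv, hS]
  · have hz : (fun r => bv S⁻¹ r x) ≠ 0 := by
      intro h0
      apply hx
      ext r
      have := Asym_bv hinv r x
      have h1 : ∀ s, bv S⁻¹ s x = 0 := fun s => congrFun h0 s
      simp only [h1, mul_zero, Finset.sum_const_zero] at this
      exact_mod_cast this.symm
    have := herm_re hS hpos hz
    have e : ∑ r, ∑ s, starRingEnd ℂ (bv S⁻¹ r x) * S r s * bv S⁻¹ s x = starRingEnd ℂ (qf S⁻¹ x) := by
      rw [qf_eq, map_sum]
      refine Finset.sum_congr rfl fun r _ => ?_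
      simp only [mul_assoc]
      rw [← Finset.mul_sum, Asym_bv hinv, map_mul, crd_apply, Complex.conj_ofReal, mul_comm]
    rw [e, Complex.conj_re] at this
    exact this
  · intro h0
    have := hell (EuclideanSpace.single i 1) (by simp)
    rw [Finset.sum_eq_single i, Finset.sum_eq_single i] at this
    · simp [h0] at this
    · intro s _ hs; simp [hs]
    · simp
    · intro r _ hr; simp [hr]
    · simp

end LinAlg

section GammaC

lemma phi_int {q : ℂ} (hq : 0 < q.re) (k : ℕ) : IntegrableOn (fun t : ℝ => (t:ℂ)^k * Complex.exp (-q * (t:ℂ)^2)) (Set.Ioi 0) := by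
  have h := integrableOn_rpow_mul_exp_neg_mul_sq hq (s := k) (by linarith [(Nat.cast_nonneg k : (0:ℝ) ≤ k)])
  refine h.mono' (by fun_prop) ((ae_restrict_iff' measurableSet_Ioi).2 (Eventually.of_forall fun t ht => ?_))
  rw [norm_mul, norm_pow, Complex.norm_real, Real.norm_of_nonneg (le_of_lt ht), Complex.norm_exp, Real.rpow_natCast]
  apply le_of_eq; congr 2
  rw [← Complex.ofReal_pow, Complex.re_mul_ofReal]; simp

lemma phi_rec {q : ℂ} (hq : 0 < q.re) (k : ℕ) :
    ((k:ℂ)+1) * ∫ t in Set.Ioi (0:ℝ), (t:ℂ)^k * Complex.exp (-q * (t:ℂ)^2) = 2 * q * ∫ t in Set.Ioi (0:ℝ), (t:ℂ)^(k+2) * Complex.exp (-q * (t:ℂ)^2) := by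
  set F : ℝ → ℂ := fun t => (t:ℂ)^(k+1) * Complex.exp (-q * (t:ℂ)^2)
  set F' : ℝ → ℂ := fun t => ((k:ℂ)+1) * ((t:ℂ)^k * Complex.exp (-q * (t:ℂ)^2)) - 2 * q * ((t:ℂ)^(k+2) * Complex.exp (-q * (t:ℂ)^2))
  have hF : ∀ t, HasDerivAt F (F' t) t := fun t => by
    have h1 : HasDerivAt (fun t : ℝ => (t:ℂ)) 1 t := Complex.ofRealCLM.hasDerivAt
    have h2 := (h1.pow (k+1)).mul ((h1.pow 2).const_mul (-q)).cexp
    refine (h2.congr_deriv (g' := F' t) ?_)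
    show _ = ((k:ℂ)+1) * ((t:ℂ)^k * Complex.exp (-q * (t:ℂ)^2)) - 2 * q * ((t:ℂ)^(k+2) * Complex.exp (-q * (t:ℂ)^2))
    simp only [Pi.pow_apply, Nat.add_sub_cancel]; push_cast; ring
  have hFi : IntegrableOn F' (Set.Ioi 0) := ((phi_int hq k).const_mul _).sub ((phi_int hq (k+2)).const_mul _)
  have ht : Tendsto F atTop (𝓝 0) := tendsto_zero_of_hasDerivAt_of_integrableOn_Ioi (fun t _ => hF t) hFi (phi_int hq (k+1))
  have := integral_Ioi_of_hasDerivAt_of_tendsto' (a := 0) (fun t _ => hF t) hFi ht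
  simp only [F'] at this
  rw [integral_sub ((phi_int hq k).const_mul _) ((phi_int hq (k+2)).const_mul _), integral_const_mul, integral_const_mul] at this
  simp only [F] at this
  refine sub_eq_zero.1 (this.trans ?_)
  simp

lemma phi_val {q : ℂ} (hq : 0 < q.re) : ∀ k : ℕ, ∫ t in Set.Ioi (0:ℝ), (t:ℂ)^k * Complex.exp (-q * (t:ℂ)^2) =
    Complex.Gamma (((k:ℂ)+1)/2) / 2 * q ^ (-((k:ℂ)+1)/2) := by
  have hq0 : q ≠ 0 := fun h => by simp [h] at hq
  intro k
  induction k using Nat.twoStepInduction with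
  | zero =>
    simp only [pow_zero, one_mul, Nat.cast_zero, zero_add]
    rw [integral_gaussian_complex_Ioi hq, Complex.Gamma_one_half_eq, div_eq_mul_inv (π:ℂ) q, Complex.cpow_def_of_ne_zero (mul_ne_zero (by exact_mod_cast Real.pi_ne_zero) (inv_ne_zero hq0)),
      Complex.log_ofReal_mul Real.pi_pos (inv_ne_zero hq0), Complex.log_inv _ (by
        intro h; have := (Complex.arg_eq_pi_iff.1 h).1; linarith), Complex.cpow_def_of_ne_zero (by exact_mod_cast Real.pi_ne_zero), Complex.cpow_def_of_ne_zero hq0,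
      Complex.ofReal_log Real.pi_pos.le, add_mul, Complex.exp_add]
    rw [show -Complex.log q * (1/2) = Complex.log q * (-1/2) by ring]
    ring
  | one =>
    have := integral_mul_cexp_neg_mul_sq hq
    simp only [pow_one]
    rw [this]
    norm_num
    rw [Complex.cpow_neg_one]; ring
  | more k ih _ =>
    have h := phi_rec hq k
    rw [ih] at h
    have hk : (k:ℂ) + 1 ≠ 0 := by exact_mod_cast Nat.succ_ne_zero k
    have e1 : Complex.Gamma ((((k+2:ℕ):ℂ)+1)/2) = ((k:ℂ)+1)/2 * Complex.Gamma (((k:ℂ)+1)/2) := by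
      rw [← Complex.Gamma_add_one _ (by simpa using hk)]; congr 1; push_cast; ring
    have e2 : q ^ (-(((k+2:ℕ):ℂ)+1)/2) = q ^ (-((k:ℂ)+1)/2) / q := by
      rw [show (-(((k+2:ℕ):ℂ)+1)/2) = (-((k:ℂ)+1)/2) - 1 by push_cast; ring, Complex.cpow_sub _ _ hq0, Complex.cpow_one]
    rw [e1, e2]
    have h2 : (2 * q) ≠ 0 := mul_ne_zero two_ne_zero hq0
    apply mul_left_cancel₀ h2
    rw [← h]; field_simp

end GammaC


section GaussDet
variable {n : ℕ}

open scoped MatrixOrder in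
lemma simdiag {P M : Matrix (Fin n) (Fin n) ℝ} (hP : P.PosDef) (hM : M.transpose = M) :
    ∃ (T : Matrix (Fin n) (Fin n) ℝ) (l : Fin n → ℝ), T.det ≠ 0 ∧ T.transpose * P * T = 1 ∧ T.transpose * M * T = Matrix.diagonal l := by
  obtain ⟨C, hCu, hC⟩ := CStarAlgebra.isStrictlyPositive_iff_eq_star_mul_self.mp hP.isStrictlyPositive
  rw [Matrix.star_eq_conjTranspose, Matrix.conjTranspose_eq_transpose_of_trivial] at hC
  have hCd : IsUnit C.det := (Matrix.isUnit_iff_isUnit_det _).1 hCu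
  have h1 : C * C⁻¹ = 1 := Matrix.mul_nonsing_inv _ hCd
  have h1' : C⁻¹.transpose * C.transpose = 1 := by rw [← Matrix.transpose_mul, h1, Matrix.transpose_one]
  set N := C⁻¹.transpose * M * C⁻¹ with hN
  have hNh : N.IsHermitian := by
    rw [Matrix.IsHermitian, Matrix.conjTranspose_eq_transpose_of_trivial, hN, Matrix.transpose_mul, Matrix.transpose_mul, Matrix.transpose_transpose, hM, Matrix.mul_assoc]
  set U : Matrix (Fin n) (Fin n) ℝ := (hNh.eigenvectorUnitary : Matrix (Fin n) (Fin n) ℝ) with hU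
  have hUU : U.transpose * U = 1 := by
    have := Unitary.coe_star_mul_self hNh.eigenvectorUnitary
    rwa [Matrix.star_eq_conjTranspose, Matrix.conjTranspose_eq_transpose_of_trivial] at this
  have hsp : N = U * Matrix.diagonal hNh.eigenvalues * U.transpose := by
    have := hNh.spectral_theorem
    rw [Unitary.conjStarAlgAut_apply, Matrix.star_eq_conjTranspose, Matrix.conjTranspose_eq_transpose_of_trivial] at this
    exact this
  refine ⟨C⁻¹ * U, hNh.eigenvalues, ?_, ?_, ?_⟩
  · rw [Matrix.det_mul]
    refine mul_ne_zero ?_ ?_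
    · intro h; have := congrArg Matrix.det h1; rw [Matrix.det_mul, h] at this; simp at this
    · intro h; have := congrArg Matrix.det hUU; rw [Matrix.det_mul, h] at this; simp at this
  · rw [hC, Matrix.transpose_mul]
    calc U.transpose * C⁻¹.transpose * (C.transpose * C) * (C⁻¹ * U) = U.transpose * (C⁻¹.transpose * C.transpose) * (C * C⁻¹) * U := by
          simp only [Matrix.mul_assoc]
      _ = 1 := by rw [h1, h1']; simpa using hUU
  · rw [Matrix.transpose_mul]
    calc U.transpose * C⁻¹.transpose * M * (C⁻¹ * U) = U.transpose * N * U := by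
          simp only [hN, Matrix.mul_assoc]
      _ = (U.transpose * U) * Matrix.diagonal hNh.eigenvalues * (U.transpose * U) := by
          refine (congrArg (fun Z => U.transpose * Z * U) hsp).trans ?_
          simp only [Matrix.mul_assoc]
      _ = _ := by rw [hUU]; simp

lemma qf_mulVec (B : Matrix (Fin n) (Fin n) ℂ) (T : Matrix (Fin n) (Fin n) ℝ) (z : Fin n → ℝ) :
    qf B (WithLp.toLp 2 (T.mulVec z)) = qf ((T.map Complex.ofReal).transpose * B * (T.map Complex.ofReal)) (WithLp.toLp 2 z) := by
  have h : ∀ (D : Matrix (Fin n) (Fin n) ℂ) (w : Fin n → ℝ), qf D (WithLp.toLp 2 w) = (fun i => (w i : ℂ)) ⬝ᵥ (D.mulVec (fun i => (w i : ℂ))) := by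
    intro D w
    simp only [qf, dotProduct, Matrix.mulVec, Finset.mul_sum]
    exact Finset.sum_congr rfl fun r _ => Finset.sum_congr rfl fun s _ => by ring
  rw [h, h]
  have e : (fun i => ((T.mulVec z i : ℝ) : ℂ)) = (T.map Complex.ofReal).mulVec (fun i => (z i : ℂ)) := by
    funext i; simp [Matrix.mulVec, dotProduct]
  rw [e, ← Matrix.mulVec_mulVec, ← Matrix.mulVec_mulVec, Matrix.dotProduct_mulVec _ (T.map Complex.ofReal).transpose, Matrix.vecMul_transpose]

lemma gauss_det {B : Matrix (Fin n) (Fin n) ℂ} (hB : B.transpose = B) (hre : ∀ x : RX n, x ≠ 0 → 0 < (qf B x).re) :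
    (∫ x : RX n, Complex.exp (-qf B x)) ^ 2 * B.det = (π:ℂ)^n := by
  have hs : ∀ r s, B r s = B s r := fun r s => congrFun (congrFun hB s) r
  have hP : (B.map Complex.re).PosDef := by
    refine Matrix.PosDef.of_dotProduct_mulVec_pos ?_ fun x hx => ?_
    · ext i j; simp [hs i j]
    · have := hre (WithLp.toLp 2 x) (by simpa using hx)
      refine this.trans_eq ?_
      simp only [qf, dotProduct, Matrix.mulVec, Finset.mul_sum, Complex.re_sum]
      refine Finset.sum_congr rfl fun r _ => Finset.sum_congr rfl fun s _ => ?_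
      simp; ring
  obtain ⟨T, l, hT, hT1, hT2⟩ := simdiag (M := B.map Complex.im) hP (by ext i j; simp [hs i j])
  have hBd : (T.map Complex.ofReal).transpose * B * (T.map Complex.ofReal) = Matrix.diagonal (fun j => (1:ℂ) + l j * Complex.I) := by
    ext i j
    have a1 := congrFun (congrFun hT1 i) j
    have a2 := congrFun (congrFun hT2 i) j
    have e : ((T.map Complex.ofReal).transpose * B * (T.map Complex.ofReal)) i j = (((T.transpose * (B.map Complex.re) * T) i j : ℝ) : ℂ) + (((T.transpose * (B.map Complex.im) * T) i j : ℝ) : ℂ) * Complex.I := by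
      simp only [Matrix.mul_apply, Matrix.transpose_apply, Matrix.map_apply, Complex.ofReal_sum, Complex.ofReal_mul, Finset.sum_mul, ← Finset.sum_add_distrib]
      refine Finset.sum_congr rfl fun r _ => Finset.sum_congr rfl fun s _ => ?_
      conv_lhs => rw [← Complex.re_add_im (B s r)]
      ring
    rw [e, a1, a2]
    by_cases hij : i = j
    · subst hij; simp
    · simp [hij]
  have hdet : (T.det : ℂ)^2 * B.det = ∏ j, ((1:ℂ) + l j * Complex.I) := by
    have := congrArg Matrix.det hBd
    rw [Matrix.det_mul, Matrix.det_mul, Matrix.det_transpose, Matrix.det_diagonal] at this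
    have e : (T.map Complex.ofReal).det = (T.det : ℂ) := (RingHom.map_det Complex.ofRealHom T).symm
    rw [e] at this; rw [← this]; ring
  have hcv : ∫ x : RX n, Complex.exp (-qf B x) = ∫ x : Fin n → ℝ, Complex.exp (-qf B (WithLp.toLp 2 x)) :=
    ((PiLp.volume_preserving_toLp (Fin n)).integral_comp (MeasurableEquiv.toLp 2 _).measurableEmbedding _).symm
  have hint : ∫ z : Fin n → ℝ, Complex.exp (-qf B (WithLp.toLp 2 (T.mulVec z))) = ∏ j, ((π:ℂ) / (1 + l j * Complex.I)) ^ (1/2:ℂ) := by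
    simp only [qf_mulVec, hBd]
    have : ∀ z : Fin n → ℝ, Complex.exp (-qf (Matrix.diagonal (fun j => (1:ℂ) + l j * Complex.I)) (WithLp.toLp 2 z)) = ∏ j, Complex.exp (-(1 + l j * Complex.I) * (z j : ℂ)^2) := fun z => by
      rw [← Complex.exp_sum]
      congr 1
      rw [qf, ← Finset.sum_neg_distrib]
      refine Finset.sum_congr rfl fun j _ => ?_
      rw [Finset.sum_eq_single j]
      · simp; ring
      · intro s _ hs; simp [Matrix.diagonal_apply_ne' _ hs]
      · simp
    simp only [this]
    rw [integral_fintype_prod_volume_eq_prod (fun j (x:ℝ) => Complex.exp (-(1 + l j * Complex.I) * (x : ℂ)^2))]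
    refine Finset.prod_congr rfl fun j _ => integral_gaussian_complex (by simp)
  have hmap := Real.map_matrix_volume_pi_eq_smul_volume_pi hT
  have hc : Continuous (fun x : Fin n → ℝ => Complex.exp (-qf B (WithLp.toLp 2 x))) :=
    (((contDiff_qf (B := B)).continuous.comp (PiLp.continuous_toLp 2 _)).neg).cexp
  have h3 : ∫ z : Fin n → ℝ, Complex.exp (-qf B (WithLp.toLp 2 (T.mulVec z))) = (|T.det⁻¹| : ℝ) • ∫ x : Fin n → ℝ, Complex.exp (-qf B (WithLp.toLp 2 x)) := by
    rw [← ENNReal.toReal_ofReal (abs_nonneg (T.det⁻¹)), ← integral_smul_measure, ← hmap, integral_map]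
    · rfl
    · exact (LinearMap.continuous_of_finiteDimensional _).aemeasurable
    · exact hc.aestronglyMeasurable
  rw [hcv]
  rw [hint] at h3
  set J0 := ∫ x : Fin n → ℝ, Complex.exp (-qf B (WithLp.toLp 2 x))
  have h4 : (∏ j, ((π:ℂ) / (1 + l j * Complex.I)) ^ (1/2:ℂ))^2 = (π:ℂ)^n / ∏ j, ((1:ℂ) + l j * Complex.I) := by
    rw [← Finset.prod_pow]
    have : ∀ j, (((π:ℂ) / (1 + l j * Complex.I)) ^ (1/2:ℂ))^2 = (π:ℂ) / (1 + l j * Complex.I) := fun j => by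
      rw [one_div]; exact Complex.cpow_ofNat_inv_pow _ 2
    simp only [this, Finset.prod_div_distrib]; simp
  have h5 : (|T.det⁻¹| • J0)^2 = ((T.det:ℂ)^2)⁻¹ * J0^2 := by
    rw [smul_pow, sq_abs, Complex.real_smul]; push_cast; rw [inv_pow]
  rw [h3, h5, ← hdet] at h4
  have hTc : (T.det : ℂ) ≠ 0 := by exact_mod_cast hT
  have hBne : B.det ≠ 0 := by
    intro h0; rw [h0, mul_zero] at hdet
    obtain ⟨j, _, hj⟩ := Finset.prod_eq_zero_iff.1 hdet.symm
    have := congrArg Complex.re hj; simp at this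
  field_simp at h4
  exact h4
end GaussDet


section Norml
variable {n : ℕ}

lemma toUp_mp (hn : 0 < n) : MeasurePreserving (fun p : RV n × ℝ => (toUp p.1 p.2 : RX n)) (volume.prod volume) volume := by
  obtain ⟨m, rfl⟩ : ∃ m, n = m + 1 := ⟨n - 1, by omega⟩
  have h1 := (PiLp.volume_preserving_toLp (Fin (m+1))).comp ((volume_preserving_piFinSuccAbove (fun _ => ℝ) (Fin.last m)).symm.comp
    ((Measure.measurePreserving_swap (μ := (volume : Measure (Fin m → ℝ))) (ν := (volume : Measure ℝ))).comp ((PiLp.volume_preserving_ofLp (Fin m)).prod (MeasurePreserving.id (volume : Measure ℝ)))))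
  suffices e : (fun p : RV (m+1) × ℝ => (toUp p.1 p.2 : RX (m+1))) = (WithLp.toLp 2 ∘ (MeasurableEquiv.piFinSuccAbove (fun _ => ℝ) (Fin.last m)).symm ∘ Prod.swap ∘ Prod.map WithLp.ofLp id : EuclideanSpace ℝ (Fin m) × ℝ → RX (m+1)) by
    rw [e]; exact h1
  funext p
  ext i
  refine Fin.lastCases ?_ (fun j => ?_) i
  · simp [toUp, MeasurableEquiv.piFinSuccAbove, Fin.insertNthEquiv]
  · simp [toUp, MeasurableEquiv.piFinSuccAbove, Fin.insertNthEquiv]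

lemma qf_lower (hn : 0 < n) {B : Matrix (Fin n) (Fin n) ℂ} (hre : ∀ x : RX n, x ≠ 0 → 0 < (qf B x).re) :
    ∃ c : ℝ, 0 < c ∧ ∀ x : RX n, c * ‖x‖^2 ≤ (qf B x).re := by
  haveI : Nonempty (Fin n) := ⟨⟨0, hn⟩⟩
  obtain ⟨x0, hx0, hmin⟩ := (isCompact_sphere (0 : RX n) 1).exists_isMinOn (NormedSpace.sphere_nonempty.2 zero_le_one)
    (Complex.continuous_re.comp (contDiff_qf (B := B)).continuous).continuousOn
  have hx00 : x0 ≠ 0 := by intro h; simp [h] at hx0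
  refine ⟨(qf B x0).re, hre x0 hx00, fun x => ?_⟩
  by_cases hx : x = 0
  · simp [hx, qf]
  have hxn : 0 < ‖x‖ := norm_pos_iff.2 hx
  have h1 := hmin (a := (‖x‖⁻¹ • x)) (by simp [norm_smul, hxn.ne'])
  simp only [Function.comp, Set.mem_setOf_eq] at h1
  have h2 : qf B x = ((‖x‖^2:ℝ):ℂ) * qf B (‖x‖⁻¹ • x) := by
    rw [← qf_smul, smul_smul, mul_inv_cancel₀ hxn.ne', one_smul]
  rw [h2, Complex.re_ofReal_mul, mul_comm]
  gcongr

lemma sphereArea_eq (hn : 0 < n) : sphereArea n = 2 * √π^n / Real.Gamma (n/2) := by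
  have hn' : (0:ℝ) < n := by exact_mod_cast hn
  haveI : Nonempty (Fin n) := ⟨⟨0, hn⟩⟩
  have hg := Real.Gamma_pos_of_pos (half_pos hn')
  rw [sphereArea, EuclideanSpace.volume_ball]
  simp only [ENNReal.ofReal_one, one_pow, one_mul, Fintype.card_fin]
  rw [Real.Gamma_add_one (by positivity), ENNReal.toReal_ofReal (by positivity)]
  field_simp

lemma toUp_neg (y : RV n) (t : ℝ) : (toUp (-y) (-t) : RX n) = - toUp y t := by
  ext i; simp only [toUp, PiLp.neg_apply]; by_cases h : (i:ℕ) < n - 1 <;> simp [h]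

lemma toUp_smul (c : ℝ) (y : RV n) (t : ℝ) : (toUp (c • y) (c * t) : RX n) = c • toUp y t := by
  ext i; simp only [toUp, PiLp.smul_apply]; by_cases h : (i:ℕ) < n - 1 <;> simp [h]

lemma cont_toUp (t : ℝ) (hn : 0 < n) : Continuous (fun y : RV n => (toUp y t : RX n)) := by
  rw [continuous_iff_continuousAt]
  intro y
  have : (fun y : RV n => (toUp y t : RX n)) = fun y => toUp 0 t + J n y := by
    funext y; ext i; simp only [J_apply, toUp, PiLp.add_apply]; by_cases h : (i:ℕ) < n - 1 <;> simp [h]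
  rw [this]; exact (continuous_const.add (J n).continuous).continuousAt

lemma qf_one_lower (hn : 0 < n) {B : Matrix (Fin n) (Fin n) ℂ} (hre : ∀ x : RX n, x ≠ 0 → 0 < (qf B x).re) :
    ∃ c : ℝ, 0 < c ∧ ∀ y : RV n, c * (1 + ‖y‖)^2 ≤ (qf B (toUp y 1)).re := by
  obtain ⟨c, hc, h⟩ := qf_lower hn hre
  refine ⟨c/2, by positivity, fun y => le_trans ?_ (h _)⟩
  rw [toUp_norm_sq hn, div_mul_eq_mul_div, div_le_iff₀ two_pos, mul_assoc]
  gcongr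
  nlinarith [sq_nonneg (1 - ‖y‖)]

lemma prod_int (hn : 0 < n) {B : Matrix (Fin n) (Fin n) ℂ} (hre : ∀ x : RX n, x ≠ 0 → 0 < (qf B x).re) :
    Integrable (fun p : RV n × ℝ => (p.2:ℂ)^(n-1) * Complex.exp (-qf B (toUp p.1 1) * (p.2:ℂ)^2)) (volume.prod (volume.restrict (Set.Ioi 0))) := by
  obtain ⟨c, hc, hlow⟩ := qf_one_lower hn hre
  have hpos : ∀ y : RV n, 0 < (qf B (toUp y 1)).re := fun y => lt_of_lt_of_le (by positivity) (hlow y)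
  have hcont : Continuous (fun p : RV n × ℝ => (p.2:ℂ)^(n-1) * Complex.exp (-qf B (toUp p.1 1) * (p.2:ℂ)^2)) := by
    have h1 : Continuous (fun p : RV n × ℝ => qf B (toUp p.1 1)) := (contDiff_qf (B := B)).continuous.comp ((cont_toUp 1 hn).comp continuous_fst)
    fun_prop
  have hcast : ((n-1:ℕ):ℂ) + 1 = n := by exact_mod_cast congrArg (Nat.cast : ℕ → ℂ) (Nat.sub_add_cancel hn)
  have hm := hcont.aestronglyMeasurable (μ := (volume : Measure (RV n)).prod ((volume : Measure ℝ).restrict (Set.Ioi 0)))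
  rw [integrable_prod_iff hm]
  refine ⟨Eventually.of_forall fun y => phi_int (hpos y) _, ?_⟩
  have hI : Integrable (fun y : RV n => (1 + ‖y‖)^(-(n:ℝ))) := by
    refine integrable_one_add_norm ?_
    rw [finrank_RV]; exact_mod_cast (by omega : n - 1 < n)
  refine (hI.const_mul (‖Complex.Gamma ((n:ℂ)/2)‖ / 2 * c^(-(n:ℝ)/2))).mono' hm.norm.integral_prod_right' (Eventually.of_forall fun y => ?_)
  have e : ((∫ t in Set.Ioi (0:ℝ), ‖(t:ℂ)^(n-1) * Complex.exp (-qf B (toUp y 1) * (t:ℂ)^2)‖ : ℝ) : ℂ) = Complex.Gamma ((n:ℂ)/2) / 2 * (((qf B (toUp y 1)).re : ℝ) : ℂ) ^ (-(n:ℂ)/2) := by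
    have := phi_val (q := (((qf B (toUp y 1)).re : ℝ) : ℂ)) (by simpa using hpos y) (n-1)
    rw [hcast] at this
    rw [← this, ← integral_complex_ofReal]
    refine setIntegral_congr_fun measurableSet_Ioi fun t ht => ?_
    have ht' : (0:ℝ) < t := ht
    simp only [norm_mul, norm_pow, Complex.norm_real, Real.norm_of_nonneg ht'.le, Complex.norm_exp]
    push_cast
    congr 3
    rw [← Complex.ofReal_pow, Complex.re_mul_ofReal]; push_cast; simp
  rw [← Complex.norm_real, e, norm_mul, norm_div, Complex.norm_cpow_eq_rpow_re_of_pos (hpos y)]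
  have e2 : (-(n:ℂ)/2).re = -(n:ℝ)/2 := by
    rw [show (-(n:ℂ)/2) = ((-(n:ℝ)/2 : ℝ) : ℂ) by push_cast; rfl, Complex.ofReal_re]
  rw [e2, Complex.norm_ofNat, mul_assoc]
  gcongr
  calc (qf B (toUp y 1)).re ^ (-(n:ℝ)/2) ≤ (c * (1 + ‖y‖)^2) ^ (-(n:ℝ)/2) :=
        Real.rpow_le_rpow_of_nonpos (by positivity) (hlow y) (by
          have : (0:ℝ) ≤ n := Nat.cast_nonneg n
          linarith)
    _ = _ := by
        rw [Real.mul_rpow hc.le (by positivity), ← Real.rpow_natCast, ← Real.rpow_mul (by positivity)]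
        congr 2; push_cast; ring

lemma gauss_slice (hn : 0 < n) {B : Matrix (Fin n) (Fin n) ℂ} (hre : ∀ x : RX n, x ≠ 0 → 0 < (qf B x).re) :
    ∫ x : RX n, Complex.exp (-qf B x) = Complex.Gamma ((n:ℂ)/2) * ∫ y : RV n, qf B (toUp y 1) ^ (-(n:ℂ)/2) := by
  obtain ⟨c, hc, hlow⟩ := qf_lower hn hre
  obtain ⟨c', hc', hlow'⟩ := qf_one_lower hn hre
  have hpos : ∀ y : RV n, 0 < (qf B (toUp y 1)).re := fun y => lt_of_lt_of_le (by positivity) (hlow' y)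
  have hqc := (contDiff_qf (B := B)).continuous
  have hcast : ((n-1:ℕ):ℂ) + 1 = n := by exact_mod_cast congrArg (Nat.cast : ℕ → ℂ) (Nat.sub_add_cancel hn)
  have hFc : AEStronglyMeasurable (fun x : RX n => Complex.exp (-qf B x)) volume := (hqc.neg.cexp).aestronglyMeasurable
  have hF : Integrable (fun x : RX n => Complex.exp (-qf B x)) := by
    have h0 := (GaussianFourier.integrable_cexp_neg_mul_sq_norm_add (V := RX n) (b := (c:ℂ)) (by simpa using hc) 0 0).norm
    refine h0.mono' hFc (Eventually.of_forall fun x => ?_)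
    simp only [zero_mul, add_zero, Complex.norm_exp]
    rw [Real.exp_le_exp]
    have := hlow x
    rw [← Complex.ofReal_pow, Complex.re_mul_ofReal]
    simp only [Complex.neg_re, Complex.ofReal_re]; linarith
  have hmp := toUp_mp hn
  have hF2 : Integrable (fun p : RV n × ℝ => Complex.exp (-qf B (toUp p.1 p.2))) (volume.prod volume) := (hmp.integrable_comp hFc).2 hF
  have e1 : ∫ x : RX n, Complex.exp (-qf B x) = ∫ t : ℝ, ∫ y : RV n, Complex.exp (-qf B (toUp y t)) := by
    rw [← integral_prod_symm _ hF2]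
    rw [← hmp.map_eq] at hFc
    have := integral_map hmp.measurable.aemeasurable hFc
    rw [hmp.map_eq] at this; exact this
  set h : ℝ → ℂ := fun t => ∫ y : RV n, Complex.exp (-qf B (toUp y t)) with hh
  have hhi : Integrable h := hF2.integral_prod_right
  have hev : ∀ t, h (-t) = h t := fun t => by
    simp only [hh]
    rw [← integral_neg_eq_self]
    congr 1; funext y
    rw [toUp_neg, show -toUp y t = (-1:ℝ) • (toUp y t : RX n) by simp, qf_smul]; simp
  have e2 : ∫ t : ℝ, h t = 2 * ∫ t in Set.Ioi (0:ℝ), h t := by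
    rw [← intervalIntegral.integral_Iic_add_Ioi (b := 0) hhi.integrableOn hhi.integrableOn, two_mul]
    congr 1
    have := integral_comp_neg_Iic (0:ℝ) h
    simp only [hev, neg_zero] at this
    exact this
  have e3 : ∀ t ∈ Set.Ioi (0:ℝ), h t = ∫ y : RV n, (t:ℂ)^(n-1) * Complex.exp (-qf B (toUp y 1) * (t:ℂ)^2) := fun t ht => by
    have ht' : (0:ℝ) < t := ht
    have := Measure.integral_comp_smul (volume : Measure (RV n)) (fun y => Complex.exp (-qf B (toUp y t))) t
    rw [finrank_RV, abs_of_pos (by positivity)] at this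
    rw [integral_const_mul]
    have e4 : ∀ y : RV n, Complex.exp (-qf B (toUp (t • y) t)) = Complex.exp (-qf B (toUp y 1) * (t:ℂ)^2) := fun y => by
      have := toUp_smul t y 1
      rw [mul_one] at this
      rw [this, qf_smul]; congr 1; push_cast; ring
    simp only [e4] at this
    rw [this, Complex.real_smul]
    have : (t:ℂ) ≠ 0 := by exact_mod_cast ht'.ne'
    push_cast
    rw [mul_inv_cancel_left₀ (pow_ne_zero _ this)]
  rw [e1, e2, setIntegral_congr_fun measurableSet_Ioi e3]
  have hsw := integral_integral_swap (f := fun (y : RV n) (t : ℝ) => (t:ℂ)^(n-1) * Complex.exp (-qf B (toUp y 1) * (t:ℂ)^2)) (prod_int hn hre)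
  rw [← hsw]
  have e5 : ∀ y : RV n, ∫ t in Set.Ioi (0:ℝ), (t:ℂ)^(n-1) * Complex.exp (-qf B (toUp y 1) * (t:ℂ)^2) = Complex.Gamma ((n:ℂ)/2) / 2 * qf B (toUp y 1) ^ (-(n:ℂ)/2) := fun y => by
    have := phi_val (hpos y) (n-1)
    rwa [hcast] at this
  simp only [e5]
  rw [integral_const_mul]; ring

lemma norml_d (hn : 0 < n) {A B S : Matrix (Fin n) (Fin n) ℂ} (h : KD B A S) {d : ℂ}
    (hd : d = 2 / (sphereArea n : ℂ) * ∫ y : RV n, qf B (toUp y 1) ^ (-(n:ℂ)/2)) : d ^ 2 = S.det := by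
  have h1 := gauss_det h.hB h.hre
  rw [gauss_slice hn h.hre] at h1
  have hn' : (0:ℝ) < n := by exact_mod_cast hn
  have hg : Complex.Gamma ((n:ℂ)/2) = ((Real.Gamma (n/2) : ℝ) : ℂ) := by
    rw [← Complex.Gamma_ofReal]; push_cast; rfl
  have hg0 : ((Real.Gamma ((n:ℝ)/2) : ℝ) : ℂ) ≠ 0 := by exact_mod_cast (Real.Gamma_pos_of_pos (half_pos hn')).ne'
  have hpi : ((√π : ℝ) : ℂ)^n ≠ 0 := by
    apply pow_ne_zero; exact_mod_cast (Real.sqrt_pos.2 Real.pi_pos).ne'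
  have hpi2 : (((√π : ℝ) : ℂ)^n)^2 = (π:ℂ)^n := by
    rw [← pow_mul, mul_comm, pow_mul, ← Complex.ofReal_pow, Real.sq_sqrt Real.pi_pos.le]
  have hSB : S.det * B.det = 1 := by rw [← Matrix.det_mul, h.hinv, Matrix.det_one]
  set K := ∫ y : RV n, qf B (toUp y 1) ^ (-(n:ℂ)/2)
  have hd2 : d = Complex.Gamma ((n:ℂ)/2) * K / ((√π : ℝ) : ℂ)^n := by
    rw [hd, sphereArea_eq hn, hg]; push_cast; field_simp
  have hB0 : B.det ≠ 0 := right_ne_zero_of_mul_eq_one hSB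
  apply mul_right_cancel₀ hB0
  rw [hSB, hd2, div_pow, div_mul_eq_mul_div, h1, hpi2, div_self]
  rw [← hpi2]; exact pow_ne_zero _ hpi
end Norml


section NTLim

section gen
variable {E : Type*} [NormedAddCommGroup E] [NormedSpace ℝ E] [FiniteDimensional ℝ E]
  [MeasurableSpace E] [BorelSpace E] (μ : Measure E) [μ.IsAddHaarMeasure]

lemma bavg_le_MF' (h : E → ℝ≥0∞) (x : E) {r : ℝ} (hr : 0 < r) :
    bavg μ h x r ≤ ENNReal.ofReal (2 ^ Module.finrank ℝ E) * MF μ h x := by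
  obtain ⟨k, hk1, hk2⟩ := exists_mem_Ico_zpow hr one_lt_two
  refine le_trans ?_ (mul_le_mul_right (bavg_le_MF μ h x (k+1)) _)
  have hk0 : (0:ℝ) < 2^k := by positivity
  have e : μ (ball x (2^(k+1))) = ENNReal.ofReal (2 ^ Module.finrank ℝ E) * μ (ball x (2^k)) := by
    rw [zpow_add_one₀ two_ne_zero, mul_comm, Measure.addHaar_ball_mul_of_pos μ x two_pos, Measure.addHaar_ball_center μ x]
  have h0 : ENNReal.ofReal (2 ^ Module.finrank ℝ E) ≠ 0 := by simp
  unfold bavg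
  rw [e, ENNReal.mul_inv (Or.inl h0) (Or.inl ENNReal.ofReal_ne_top), mul_assoc, ← mul_assoc (ENNReal.ofReal _),
    ENNReal.mul_inv_cancel h0 ENNReal.ofReal_ne_top, one_mul]
  gcongr

lemma bavg_sub_le {f : E → ℂ} (hf : StronglyMeasurable f) (x : E) {r : ℝ} (hr : 0 < r) :
    bavg μ (fun y => ‖f y - f x‖ₑ) x r ≤ bavg μ (fun y => ‖f y‖ₑ) x r + ‖f x‖ₑ := by
  unfold bavg
  calc _ ≤ (μ (ball x r))⁻¹ * ∫⁻ y in ball x r, (‖f y‖ₑ + ‖f x‖ₑ) ∂μ := by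
        gcongr; exact enorm_sub_le
    _ = _ := by
        rw [lintegral_add_left hf.enorm, lintegral_const, Measure.restrict_apply_univ, mul_add, mul_comm ‖f x‖ₑ, ← mul_assoc,
          ENNReal.inv_mul_cancel (meas_ball_ne_zero μ x hr) (meas_ball_ne_top μ x r), one_mul]

lemma wt_tendsto {h : E → ℝ≥0∞} (hh : Measurable h) (x : E) (hM : MF μ h x ≠ ∞)
    (h0 : Tendsto (fun r => bavg μ h x r) (𝓝[>] 0) (𝓝 0)) :
    Tendsto (fun t : ℝ => ∫⁻ z, ENNReal.ofReal (wt (Module.finrank ℝ E) t ‖x - z‖) * h z ∂μ) (𝓝[>] 0) (𝓝 0) := by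
  set m := Module.finrank ℝ E
  set a : ℕ → ℝ≥0∞ := fun k => ENNReal.ofReal (2 ^ (m + 1) * (2⁻¹) ^ k) * μ (ball 0 1) with ha
  have ha_top : ∀ k, a k ≠ ∞ := fun k => ENNReal.mul_ne_top ENNReal.ofReal_ne_top (meas_ball_ne_top μ _ _)
  have hsum : ∑' k, a k ≠ ∞ := by
    rw [ha, ENNReal.tsum_mul_right]
    refine ENNReal.mul_ne_top ?_ (meas_ball_ne_top μ _ _)
    rw [← ENNReal.ofReal_tsum_of_nonneg (fun k => by positivity)]
    · exact ENNReal.ofReal_ne_top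
    · exact (summable_geometric_of_lt_one (by norm_num) (by norm_num)).mul_left _
  have key : Tendsto (fun t : ℝ => ∑' k : ℕ, a k * bavg μ h x (2^k * t)) (𝓝[>] 0) (𝓝 0) := by
    simp only [← lintegral_count]
    have e0 : (0:ℝ≥0∞) = ∫⁻ k : ℕ, 0 ∂Measure.count := by simp
    rw [e0]
    refine tendsto_lintegral_filter_of_dominated_convergence (fun k => a k * (ENNReal.ofReal (2^m) * MF μ h x)) (Eventually.of_forall fun t => by fun_prop) ?_ ?_ ?_
    · filter_upwards [self_mem_nhdsWithin] with t ht
      refine Eventually.of_forall fun k => ?_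
      have : (0:ℝ) < t := ht
      gcongr
      exact bavg_le_MF' μ h x (by positivity)
    · rw [lintegral_count, ENNReal.tsum_mul_right]
      exact ENNReal.mul_ne_top hsum (ENNReal.mul_ne_top ENNReal.ofReal_ne_top hM)
    · refine Eventually.of_forall fun k => ?_
      have h1 : Tendsto (fun t : ℝ => 2^k * t) (𝓝[>] 0) (𝓝[>] 0) := by
        refine tendsto_nhdsWithin_iff.2 ⟨?_, ?_⟩
        · refine tendsto_nhdsWithin_of_tendsto_nhds ?_
          have : Continuous (fun t : ℝ => 2^k * t) := by fun_prop
          simpa using this.tendsto 0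
        · filter_upwards [self_mem_nhdsWithin] with t ht
          have : (0:ℝ) < t := ht
          exact Set.mem_Ioi.2 (by positivity)
      have := ENNReal.Tendsto.const_mul (a := a k) (h0.comp h1) (Or.inr (ha_top k))
      simpa using this
  refine tendsto_of_tendsto_of_tendsto_of_le_of_le' tendsto_const_nhds key (Eventually.of_forall fun t => zero_le) ?_
  filter_upwards [self_mem_nhdsWithin] with t ht
  exact wt_lintegral_le μ h hh x ht

end gen

variable {n : ℕ} {p : ℝ}

lemma leb_ae (hp : 1 < p) {f : RV n → ℂ} (hf : MemLp f (ENNReal.ofReal p) volume) (hfm : StronglyMeasurable f) :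
    ∀ᵐ x : RV n, MF volume (fun y => ‖f y - f x‖ₑ) x ≠ ∞ ∧
      Tendsto (fun r => bavg volume (fun y => ‖f y - f x‖ₑ) x r) (𝓝[>] 0) (𝓝 0) := by
  have hli : LocallyIntegrable f volume := hf.locallyIntegrable (by simpa using hp.le)
  obtain ⟨C, hC, hMF⟩ := MF_strong (volume : Measure (RV n)) p hp
  have h1 := hMF (fun y => ‖f y‖ₑ) hfm.enorm
  have h2 : ∫⁻ x, (MF volume (fun y => ‖f y‖ₑ) x) ^ p ≠ ∞ :=
    ne_top_of_le_ne_top (ENNReal.mul_ne_top ENNReal.ofReal_ne_top ((memLp_iff' hp hf.1).1 hf).ne) h1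
  have h3 := ae_lt_top ((measurable_MF volume hfm.enorm).pow_const p) h2
  filter_upwards [h3, (Besicovitch.vitaliFamily (volume : Measure (RV n))).ae_tendsto_lintegral_enorm_sub_div hli] with x hx hx2
  refine ⟨?_, ?_⟩
  · have hx' : MF volume (fun y => ‖f y‖ₑ) x ≠ ∞ := by
      intro h; rw [h, ENNReal.top_rpow_of_pos (by linarith)] at hx; exact lt_irrefl _ hx
    refine ne_top_of_le_ne_top (ENNReal.add_ne_top.2 ⟨hx', (enorm_ne_top : ‖f x‖ₑ ≠ ∞)⟩) (iSup_le fun k => ?_)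
    exact (bavg_sub_le volume hfm x (by positivity)).trans (by gcongr; exact bavg_le_MF _ _ _ _)
  · have h4 := hx2.comp (Besicovitch.tendsto_filterAt volume x)
    refine tendsto_of_tendsto_of_tendsto_of_le_of_le' tendsto_const_nhds h4 (Eventually.of_forall fun t => zero_le) ?_
    filter_upwards [self_mem_nhdsWithin] with r hr
    have : (0:ℝ) < r := hr
    simp only [Function.comp, bavg]
    rw [ENNReal.div_eq_inv_mul, Measure.addHaar_closedBall _ _ this.le, Measure.addHaar_ball_of_pos _ _ this]
    gcongr
    exact ball_subset_closedBall

lemma nt_lim (hn : 2 ≤ n) (hp : 1 < p) {κ : ℝ} (hκ : 0 < κ) {G : RX n → ℂ} (hG : HomK (n-1) G) {C : ℝ} (hC : 0 < C)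
    (hb : ∀ (w : RV n) (t : ℝ), 0 < t → ‖G (toUp w t)‖ ≤ C * (t / ‖(toUp w t : RX n)‖^n)) (h1 : ∀ t : ℝ, 0 < t → ∫ w : RV n, G (toUp w t) = 1)
    {f : RV n → ℂ} (hf : MemLp f (ENNReal.ofReal p) volume) :
    ∀ᵐ x : RV n, Tendsto (fun q : RV n × ℝ => convK G f (toUp q.1 q.2)) (ntFilter κ x) (𝓝 (f x)) := by
  have hn0 : 0 < n := by omega
  wlog hfm : StronglyMeasurable f generalizing f
  · have h2 := this (f := hf.1.mk f) ((memLp_congr_ae hf.1.ae_eq_mk).1 hf) hf.1.stronglyMeasurable_mk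
    filter_upwards [h2, hf.1.ae_eq_mk] with x hx hx2
    rw [hx2]
    refine hx.congr fun q => ?_
    refine integral_congr_ae ?_
    filter_upwards [hf.1.ae_eq_mk] with z hz
    rw [hz]
  filter_upwards [leb_ae hp hf hfm] with x hx
  have hw := wt_tendsto volume (h := fun y => ‖f y - f x‖ₑ) (hfm.sub stronglyMeasurable_const).enorm x hx.1 hx.2
  rw [finrank_RV] at hw
  have hq2 : Tendsto (fun q : RV n × ℝ => q.2) (ntFilter κ x) (𝓝[>] 0) := by
    refine tendsto_nhdsWithin_iff.2 ⟨?_, ?_⟩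
    · exact (continuous_snd.tendsto (x, (0:ℝ))).mono_left inf_le_left
    · exact eventually_inf_principal.2 (Eventually.of_forall fun q hq => hq.1)
  have hlim := ENNReal.Tendsto.const_mul (a := ENNReal.ofReal (C * (2+κ)^n)) (hw.comp hq2) (Or.inr ENNReal.ofReal_ne_top)
  rw [mul_zero] at hlim
  rw [tendsto_iff_edist_tendsto_0]
  refine tendsto_of_tendsto_of_tendsto_of_le_of_le' tendsto_const_nhds hlim (Eventually.of_forall fun t => zero_le) ?_
  refine eventually_inf_principal.2 (Eventually.of_forall ?_)
  rintro ⟨y, t⟩ ⟨ht, hd⟩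
  simp only [Function.comp] at ht hd ⊢
  have hsub : ∀ z, (toUp y t : RX n) - J n z = toUp (y - z) t := fun z => by
    rw [← toUp_sub_J hn0, xinit_toUp, xlast_toUp hn0]
  have hxl : 0 < xlast (toUp y t : RX n) := by rwa [xlast_toUp hn0]
  have hi1 := convK_integrable hn hp le_rfl hG hf hxl
  have e1 : ∫ z, G (toUp y t - J n z) = 1 := by
    simp only [hsub]
    rw [← h1 t ht]
    exact integral_sub_left_eq_self (fun w => G (toUp w t)) volume y
  have hi2 : Integrable (fun z => G (toUp y t - J n z)) := Integrable.of_integral_ne_zero (by rw [e1]; exact one_ne_zero)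
  have e2 : convK G f (toUp y t) - f x = ∫ z, (f z - f x) * G (toUp y t - J n z) := by
    simp only [sub_mul]
    rw [integral_sub hi1 (hi2.const_mul _), integral_const_mul, e1, mul_one]; rfl
  rw [edist_eq_enorm_sub, e2, ← lintegral_const_mul']
  · refine (enorm_integral_le_lintegral_enorm _).trans (lintegral_mono fun z => ?_)
    rw [enorm_mul, mul_comm, ← mul_assoc, ← ENNReal.ofReal_mul (by positivity), ← ofReal_norm]
    gcongr
    rw [hsub]
    refine (hb _ t ht).trans ?_
    rw [mul_assoc, wt, Nat.sub_add_cancel hn0]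
    gcongr
    rw [← mul_div_assoc, div_le_div_iff₀ (pow_pos (lt_of_lt_of_le ht (by
      have := abs_xlast_le hn0 (toUp (y - z) t); rw [xlast_toUp hn0] at this; exact (le_abs_self t).trans this)) n) (by positivity)]
    have h5 : t ≤ ‖(toUp (y - z) t : RX n)‖ := by
      have := abs_xlast_le hn0 (toUp (y - z) t); rw [xlast_toUp hn0] at this; exact (le_abs_self t).trans this
    have h6 : ‖y - z‖ ≤ ‖(toUp (y - z) t : RX n)‖ := by
      have := toUp_norm_sq hn0 (y - z) t
      exact (pow_le_pow_iff_left₀ (norm_nonneg _) (norm_nonneg _) two_ne_zero).1 (by nlinarith)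
    have h7 : ‖x - z‖ ≤ κ * t + ‖y - z‖ := by
      have : x - z = (x - y) + (y - z) := by abel
      rw [this]; refine (norm_add_le _ _).trans ?_
      rw [← dist_eq_norm]; linarith
    have h8 : t + ‖x - z‖ ≤ (2 + κ) * ‖(toUp (y - z) t : RX n)‖ := by nlinarith
    calc t * (t + ‖x - z‖)^n ≤ t * ((2 + κ) * ‖(toUp (y - z) t : RX n)‖)^n := by gcongr
      _ = _ := by rw [mul_pow]; ring
  · exact ENNReal.ofReal_ne_top
end NTLim


section Fin9
variable {n : ℕ} {p : ℝ}

lemma Gn_bound (hn : 0 < n) {B : Matrix (Fin n) (Fin n) ℂ} (hre : ∀ x : RX n, x ≠ 0 → 0 < (qf B x).re) :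
    ∃ C : ℝ, 0 < C ∧ ∀ (w : RV n) (t : ℝ), 0 < t → ‖Gn B (toUp w t)‖ ≤ C * (t / ‖(toUp w t : RX n)‖^n) := by
  obtain ⟨c, hc, hlow⟩ := qf_lower hn hre
  refine ⟨c^(-(n:ℝ)/2), by positivity, fun w t ht => ?_⟩
  have hx : 0 < ‖(toUp w t : RX n)‖ := lt_of_lt_of_le ht (by
    have := abs_xlast_le hn (toUp w t); rw [xlast_toUp hn] at this; exact (le_abs_self t).trans this)
  set x : RX n := toUp w t
  rw [Gn, xlast_toUp hn, norm_mul, Complex.norm_real, Real.norm_of_nonneg ht.le,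
    show (-(n:ℂ)/2) = ((-(n:ℝ)/2 : ℝ) : ℂ) by push_cast; rfl, Complex.norm_cpow_real]
  calc t * ‖qf B x‖ ^ (-(n:ℝ)/2) ≤ t * (c * ‖x‖^2) ^ (-(n:ℝ)/2) := by
        have hn' : (0:ℝ) ≤ n := Nat.cast_nonneg n
        exact mul_le_mul_of_nonneg_left (Real.rpow_le_rpow_of_nonpos (by positivity)
          ((hlow x).trans (Complex.re_le_norm _)) (by linarith)) ht.le
    _ = _ := by
        rw [Real.mul_rpow hc.le (by positivity), ← Real.rpow_natCast ‖x‖ 2, ← Real.rpow_mul hx.le,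
          show ((2:ℕ):ℝ) * (-(n:ℝ)/2) = -(n:ℝ) by push_cast; ring, Real.rpow_neg hx.le, Real.rpow_natCast]
        field_simp

lemma Gn_integral (hn : 0 < n) {B : Matrix (Fin n) (Fin n) ℂ} (hre : ∀ x : RX n, x ≠ 0 → 0 < (qf B x).re) {t : ℝ} (ht : 0 < t) :
    ∫ w : RV n, Gn B (toUp w t) = ∫ y : RV n, qf B (toUp y 1) ^ (-(n:ℂ)/2) := by
  have := Measure.integral_comp_smul (volume : Measure (RV n)) (fun y => Gn B (toUp y t)) t
  rw [finrank_RV, abs_of_pos (by positivity)] at this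
  have hne : ∀ y : RV n, (toUp y 1 : RX n) ≠ 0 := fun y h => by
    have := xlast_toUp hn y 1; rw [h, xlast_eq hn] at this; simp at this
  have htc : (t:ℂ) ≠ 0 := by exact_mod_cast ht.ne'
  have e4 : ∀ y : RV n, Gn B (toUp (t • y) t) = ((t:ℂ)^(n-1))⁻¹ * qf B (toUp y 1) ^ (-(n:ℂ)/2) := fun y => by
    have := toUp_smul t y 1
    rw [mul_one] at this
    rw [Gn, xlast_toUp hn, this, qpow_smul hre (hne y) ht, ← mul_assoc]
    congr 1
    obtain ⟨m, rfl⟩ : ∃ m, n = m + 1 := ⟨n - 1, by omega⟩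
    push_cast
    rw [pow_succ]; field_simp
  simp only [e4] at this
  rw [integral_const_mul, Complex.real_smul] at this
  push_cast at this
  exact (mul_left_cancel₀ (inv_ne_zero (pow_ne_zero _ htc)) this).symm

lemma lint_le (hp : 1 < p) {h : RV n → ℂ} {T : ℝ≥0∞} (hT : eLpNorm h (ENNReal.ofReal p) volume ≤ T) : ∫⁻ x, ‖h x‖ₑ ^ p ≤ T ^ p := by
  have h0 : ENNReal.ofReal p ≠ 0 := by simp; linarith
  rw [eLpNorm_eq_lintegral_rpow_enorm_toReal h0 ENNReal.ofReal_ne_top, ENNReal.toReal_ofReal (by linarith)] at hT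
  calc _ = ((∫⁻ x, ‖h x‖ₑ ^ p) ^ (1/p)) ^ p := by
        rw [← ENNReal.rpow_mul, one_div_mul_cancel (by linarith), ENNReal.rpow_one]
    _ ≤ _ := ENNReal.rpow_le_rpow hT (by linarith)

end Fin9


/-- Well-posedness data for the higher order Dirichlet problem for a
scalar elliptic operator `L = Σ a_{rs}∂_r∂_s` in the upper half space: for a suitable
square root `d` of `det A_sym` there is a constant `C` such that for every
`f ∈ L^p_ℓ(ℝ^{n-1})` (encoded by `f` together with its weak derivatives `g k d ∈ L^p`
of all orders `k ≤ ℓ`), the explicit Poisson integral `u` solves `Lu = 0` in `ℝⁿ₊`,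
attains `f` as nontangential boundary limit a.e., and satisfies
`N_κ(∇^k u) ∈ L^p` for `0 ≤ k ≤ ℓ` together with the natural estimate. -/
theorem statement9
    (n : ℕ) (hn : 2 ≤ n)
    (A : Matrix (Fin n) (Fin n) ℂ)
    (hell : ∀ ξ : EuclideanSpace ℝ (Fin n), ξ ≠ 0 →
      0 < (∑ r, ∑ s, A r s * (ξ r : ℂ) * (ξ s : ℂ)).re)
    (Asym : Matrix (Fin n) (Fin n) ℂ) (hAsym : Asym = ((1 : ℂ) / 2) • (A + A.transpose))
    (p : ℝ) (hp : 1 < p) (ℓ : ℕ) (κ : ℝ) (hκ : 0 < κ) :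
    ∃ d : ℂ, d ^ 2 = Asym.det ∧
    ∃ C : ℝ, 0 < C ∧
      ∀ (f : EuclideanSpace ℝ (Fin (n - 1)) → ℂ)
        (g : (k : ℕ) → (Fin k → Fin (n - 1)) → EuclideanSpace ℝ (Fin (n - 1)) → ℂ),
        MemLp f (ENNReal.ofReal p) volume →
        (∀ k : ℕ, k ≤ ℓ → ∀ d' : Fin k → Fin (n - 1),
          MemLp (g k d') (ENNReal.ofReal p) volume ∧ IsWeakDeriv k d' f (g k d')) →
        (let u : EuclideanSpace ℝ (Fin n) → ℂ := fun x =>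
          (2 * (xlast x : ℂ) / ((sphereArea n : ℂ) * d)) *
            ∫ y' : EuclideanSpace ℝ (Fin (n - 1)), f y' *
              (∑ r, ∑ s, Asym⁻¹ r s *
                  ((toUp (xinit x - y') (xlast x) r : ℝ) : ℂ) *
                  ((toUp (xinit x - y') (xlast x) s : ℝ) : ℂ)) ^ (-(n : ℂ) / 2)
        (∀ x ∈ upperHalfSpace n, (∑ r, ∑ s, A r s * pd r (pd s u) x) = 0) ∧
        (∀ᵐ x' : EuclideanSpace ℝ (Fin (n - 1)),
          Filter.Tendsto (fun q : (EuclideanSpace ℝ (Fin (n - 1))) × ℝ => u (toUp q.1 q.2))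
            (ntFilter κ x') (nhds (f x'))) ∧
        (∀ k : ℕ, k ≤ ℓ → ∀ dd : Fin k → Fin n,
          ∫⁻ x' : EuclideanSpace ℝ (Fin (n - 1)), (ntMax κ (mpd k dd u) x') ^ p < ∞) ∧
        (∑ k ∈ Finset.range (ℓ + 1), ∑ dd : Fin k → Fin n,
            (∫⁻ x' : EuclideanSpace ℝ (Fin (n - 1)), (ntMax κ (mpd k dd u) x') ^ p)
              ^ (1 / p))
          ≤ ENNReal.ofReal C *
            (eLpNorm f (ENNReal.ofReal p) volume +
              ∑ k ∈ Finset.range (ℓ + 1), ∑ d' : Fin k → Fin (n - 1),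
                eLpNorm (g k d') (ENNReal.ofReal p) volume)) := by
  have hn0 : 0 < n := by omega
  obtain ⟨hKD, hdet⟩ := KD.mk' hell hAsym
  set B := Asym⁻¹ with hB
  set K : ℂ := ∫ y : RV n, qf B (toUp y 1) ^ (-(n:ℂ)/2) with hK
  have hE := fun s => Ek_homK hn0 hKD.hre s
  have hbs := fun i s => hKD.hbase hn i s
  obtain ⟨d, hd⟩ : ∃ d : ℂ, d = 2 / (sphereArea n : ℂ) * K := ⟨_, rfl⟩
  have hd2 : d ^ 2 = Asym.det := norml_d hn0 hKD hd
  have hd0 : d ≠ 0 := by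
    intro h; rw [h] at hd2; exact hdet (by rw [← hd2]; simp)
  have hω : (sphereArea n : ℂ) ≠ 0 := by intro h; rw [h] at hd; simp at hd; exact hd0 hd
  set c : ℂ := 2 / ((sphereArea n : ℂ) * d) with hc
  have hcK : c * K = 1 := by
    have : K = d * (sphereArea n : ℂ) / 2 := by rw [hd]; field_simp
    rw [hc, this]; field_simp
  have hG : TK (Ek B) 0 (fun x => c * Gn B x) := (hKD.Gn_TK hn0).smul c
  have hPK : ∀ (k : ℕ) (dd : Fin k → Fin n), PK n p κ k (itpd k dd (fun x => c * Gn B x)) := fun k dd =>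
    (hG.itpd hE hbs k dd).pk hn hp hκ hE (fun s x _ => Ek_odd s x)
  choose Ak hAk hPK using hPK
  have hp0 : 0 < p := by linarith
  set C : ℝ := (∑ k ∈ Finset.range (ℓ + 1), ∑ dd : Fin k → Fin n, (Ak k dd)^(1/p)) + 1 with hC
  have hCs : ∀ k (dd : Fin k → Fin n), 0 ≤ (Ak k dd)^(1/p) := fun k dd => Real.rpow_nonneg (hAk k dd).le _
  have hC0 : 0 < C := by
    have : 0 ≤ ∑ k ∈ Finset.range (ℓ + 1), ∑ dd : Fin k → Fin n, (Ak k dd)^(1/p) :=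
      Finset.sum_nonneg fun k _ => Finset.sum_nonneg fun dd _ => hCs k dd
    linarith
  refine ⟨d, hd2, C, hC0, fun f g hf hg => ?_⟩
  intro u
  have hint : ∀ x, ∫ y, f y * Gn B (x - J n y) = (xlast x : ℂ) * ∫ y, f y * qf B (toUp (xinit x - y) (xlast x)) ^ (-(n:ℂ)/2) := fun x => by
    rw [← integral_const_mul]
    congr 1; funext y
    rw [Gn, xlast_sub_J hn0, toUp_sub_J hn0]; ring
  have hu1 : u = fun x => c * convK (Gn B) f x := by
    funext x
    rw [convK, hint]
    show (2 * (xlast x : ℂ) / ((sphereArea n : ℂ) * d)) * (∫ y, f y * qf B (toUp (xinit x - y) (xlast x)) ^ (-(n:ℂ)/2)) = _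
    rw [hc]; ring
  have hu2 : u = convK (fun x => c * Gn B x) f := by
    rw [hu1]; funext x
    rw [convK, convK, ← integral_const_mul]
    congr 1; funext y; ring
  clear_value u
  set T := eLpNorm f (ENNReal.ofReal p) volume + ∑ k ∈ Finset.range (ℓ + 1), ∑ d' : Fin k → Fin (n - 1), eLpNorm (g k d') (ENNReal.ofReal p) volume with hT
  have hTtop : T ≠ ∞ := by
    refine ENNReal.add_ne_top.2 ⟨hf.2.ne, ENNReal.sum_ne_top.2 fun k hk => ENNReal.sum_ne_top.2 fun d' _ => ?_⟩
    exact ((hg k (by have := Finset.mem_range.1 hk; omega) d').1).2.ne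
  have hN : ∀ k ≤ ℓ, ∀ dd : Fin k → Fin n, ∫⁻ x', (ntMax κ (mpd k dd u) x') ^ p ≤ ENNReal.ofReal (Ak k dd) * T^p := by
    intro k hk dd
    obtain ⟨W, _, hW1, hW2⟩ := hPK k dd f g (T^p) hf (fun i hi d' => hg i (hi.trans hk) d') (lint_le hp le_self_add)
      (fun i hi d' => lint_le hp (by
        refine le_trans ?_ le_add_self
        refine le_trans ?_ (Finset.single_le_sum (fun _ _ => zero_le) (Finset.mem_range.2 (by omega : i < ℓ + 1)))
        exact Finset.single_le_sum (f := fun d' => eLpNorm (g i d') (ENNReal.ofReal p) volume) (fun _ _ => zero_le) (Finset.mem_univ d')))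
    refine le_trans (lintegral_mono fun x => ENNReal.rpow_le_rpow ?_ hp0.le) hW2
    refine iSup_le fun y => iSup_le fun t => iSup_le fun hyt => ?_
    rw [hu2, mpd_convK hn hp hE hbs hG hf k dd _ (by rw [xlast_toUp hn0]; exact hyt.1)]
    exact hW1 x y t hyt.1 hyt.2
  refine ⟨fun x hx => ?_, ?_, fun k hk dd => ?_, ?_⟩
  · rw [hu1]; exact hKD.pde_conv hn hp hf hx c
  · obtain ⟨C1, hC1, hb⟩ := Gn_bound hn0 hKD.hre
    have hc0 : 0 < ‖c‖ := norm_pos_iff.2 (left_ne_zero_of_mul_eq_one hcK)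
    rw [hu2]
    refine nt_lim hn hp hκ (hG.homK hE) (C := ‖c‖ * C1) (by positivity) (fun w t ht => ?_) (fun t ht => ?_) hf
    · rw [norm_mul, mul_assoc]; gcongr; exact hb w t ht
    · rw [integral_const_mul, Gn_integral hn0 hKD.hre ht]; exact hcK
  · exact lt_of_le_of_lt (hN k hk dd) (ENNReal.mul_lt_top ENNReal.ofReal_lt_top (ENNReal.rpow_lt_top_of_nonneg hp0.le hTtop))
  · calc _ ≤ ∑ k ∈ Finset.range (ℓ + 1), ∑ dd : Fin k → Fin n, ENNReal.ofReal ((Ak k dd)^(1/p)) * T := by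
          refine Finset.sum_le_sum fun k hk => Finset.sum_le_sum fun dd _ => ?_
          refine (ENNReal.rpow_le_rpow (hN k (by have := Finset.mem_range.1 hk; omega) dd) (by positivity)).trans_eq ?_
          rw [ENNReal.mul_rpow_of_nonneg _ _ (by positivity), ← ENNReal.rpow_mul, mul_one_div_cancel hp0.ne', ENNReal.rpow_one,
            ENNReal.ofReal_rpow_of_pos (hAk k dd)]
      _ = ENNReal.ofReal (∑ k ∈ Finset.range (ℓ + 1), ∑ dd : Fin k → Fin n, (Ak k dd)^(1/p)) * T := by
          rw [ENNReal.ofReal_sum_of_nonneg (fun k _ => Finset.sum_nonneg fun dd _ => hCs k dd), Finset.sum_mul]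
          refine Finset.sum_congr rfl fun k _ => ?_
          rw [ENNReal.ofReal_sum_of_nonneg (fun dd _ => hCs k dd), Finset.sum_mul]
      _ ≤ _ := by gcongr; rw [hC]; linarith

end
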